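/- Let β ∈ {0, 1}, d ≥ 1, λ ∈ 2^ℤ, and let (q, r) satisfy 2 < q ≤ ∞, 2 ≤ r ≤ ∞ and 2/q + d/r = d/2. Then for every Schwartz function f on ℝ^d and either choice of sign, ‖S_{m_β}(±t) P_λ f‖_{L^q_t L^r_x(ℝ^{d+1})} ≲ [c_{β,d}(λ)]^{2/(qd)} ‖P_λ f‖_{L^2(ℝ^d)}, where c_{β,d}(λ) = λ^{d/2-1} ⟨√β λ⟩^{-d/2} ⟨λ⟩^{d/4+1} and the implicit constant is independent of λ and f. -/

import Mathlib

noncomputable section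

open MeasureTheory Complex Real
open scoped FourierTransform ENNReal

/-- Euclidean space `ℝ^d`. -/
abbrev Euc (d : ℕ) := EuclideanSpace ℝ (Fin d)

/-- Japanese bracket `⟨x⟩ = (1+|x|²)^{1/2}`. -/
def jap (x : ℝ) : ℝ := Real.sqrt (1 + x ^ 2)

/-- The symbol `m_β(r) = √(r(1+βr²)tanh r)`. -/
def mSymb (β r : ℝ) : ℝ := Real.sqrt (r * (1 + β * r ^ 2) * Real.tanh r)

/-- The constant `c_{β,d}(λ) = λ^{d/2-1}⟨√β λ⟩^{-d/2}⟨λ⟩^{d/4+1}`. -/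
def cFactor (β : ℝ) (d : ℕ) (lam : ℝ) : ℝ :=
  lam ^ ((d : ℝ) / 2 - 1) * jap (Real.sqrt β * lam) ^ (-(d : ℝ) / 2) *
    jap lam ^ ((d : ℝ) / 4 + 1)

/-- `χ ∈ C_0^∞(ℝ)`, `0 ≤ χ ≤ 1`, `χ ≡ 1` on `[-1,1]`, `supp χ ⊆ [-2,2]`. -/
def IsCutoff (χ : ℝ → ℝ) : Prop :=
  ContDiff ℝ (⊤ : ℕ∞) χ ∧ HasCompactSupport χ ∧ (∀ s, 0 ≤ χ s ∧ χ s ≤ 1) ∧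
    (∀ s ∈ Set.Icc (-1 : ℝ) 1, χ s = 1) ∧ Function.support χ ⊆ Set.Icc (-2 : ℝ) 2

/-- `ρ(s) = χ(s) - χ(2s)`. -/
def rho (χ : ℝ → ℝ) (s : ℝ) : ℝ := χ s - χ (2 * s)

/-- Fourier multiplier operator with symbol `m`. -/
def mulOp {d : ℕ} (m : Euc d → ℂ) (f : Euc d → ℂ) : Euc d → ℂ :=
  𝓕⁻ fun ξ => m ξ * 𝓕 f ξ

/-- The Littlewood–Paley type projection `P_λ` with multiplier `ρ(|ξ|/λ)`. -/
def proj {d : ℕ} (χ : ℝ → ℝ) (lam : ℝ) (f : Euc d → ℂ) : Euc d → ℂ :=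
  mulOp (fun ξ => (rho χ (‖ξ‖ / lam) : ℂ)) f

/-- The propagator `S_{m_β}(t) = exp(-it m_β(D))`, so that `S_{m_β}(±t) = prop β (±t)`. -/
def propg (β : ℝ) {d : ℕ} (t : ℝ) (f : Euc d → ℂ) : Euc d → ℂ :=
  mulOp (fun ξ => Complex.exp (-Complex.I * (t * mSymb β ‖ξ‖))) f

/-- The `L^q` norm in time of an `ℝ≥0∞`-valued function (with the usual modification
for `q = ∞`). -/
def timeLp (q : ℝ≥0∞) (φ : ℝ → ℝ≥0∞) : ℝ≥0∞ :=
  if q = ∞ then essSup φ volume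
  else (∫⁻ t, φ t ^ q.toReal) ^ (1 / q.toReal)

/-- The mixed norm `‖u‖_{L^q_t L^r_x(ℝ^{d+1})}`. -/
def mixedNorm {d : ℕ} (q r : ℝ≥0∞) (u : ℝ → Euc d → ℂ) : ℝ≥0∞ :=
  timeLp q fun t => eLpNorm (u t) r volume

open scoped ComplexConjugate

lemma lintegral_abs_rpow_neg_near {γ R : ℝ} (hγ1 : γ < 1) (hR : 0 < R) :
    ∫⁻ x in {x : ℝ | |x| ≤ R}, ENNReal.ofReal (|x| ^ (-γ)) ≤
      ENNReal.ofReal (2 * (R ^ (1 - γ) / (1 - γ))) := by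
  have hset : {x : ℝ | |x| ≤ R} = Set.Icc (-R) R := by ext; simp [abs_le]
  have hInt : IntervalIntegrable (fun x : ℝ => |x| ^ (-γ)) volume 0 R := by
    have := intervalIntegral.intervalIntegrable_rpow' (a := 0) (b := R) (r := -γ) (by linarith)
    refine this.congr ?_
    intro x hx
    rw [Set.uIoc_of_le hR.le] at hx
    simp [abs_of_pos hx.1]
  have hInt' : IntervalIntegrable (fun x : ℝ => |x| ^ (-γ)) volume (-R) 0 := by
    have := (intervalIntegrable_iff_integrableOn_Ioc_of_le hR.le).1 hInt
    have h2 := hInt.comp_sub_left 0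
    simpa using h2.symm
  have hI : IntervalIntegrable (fun x : ℝ => |x| ^ (-γ)) volume (-R) R := hInt'.trans hInt
  rw [hset, ← ofReal_integral_eq_lintegral_ofReal]
  · apply ENNReal.ofReal_le_ofReal
    rw [integral_Icc_eq_integral_Ioc, ← intervalIntegral.integral_of_le (by linarith),
      ← intervalIntegral.integral_add_adjacent_intervals hInt' hInt]
    have h1 : ∫ x in (0:ℝ)..R, |x| ^ (-γ) = R ^ (1 - γ) / (1 - γ) := by
      have : ∫ x in (0:ℝ)..R, |x| ^ (-γ) = ∫ x in (0:ℝ)..R, x ^ (-γ) := by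
        apply intervalIntegral.integral_congr_ae
        filter_upwards with x hx
        rw [Set.uIoc_of_le hR.le] at hx
        simp [abs_of_pos hx.1]
      rw [this, integral_rpow (Or.inl (by linarith))]
      rw [Real.zero_rpow (by linarith)]
      ring_nf
    have h2 : ∫ x in (-R)..0, |x| ^ (-γ) = R ^ (1 - γ) / (1 - γ) := by
      rw [← h1]
      have := intervalIntegral.integral_comp_neg (a := 0) (b := R) (fun x : ℝ => |x| ^ (-γ))
      simpa using this.symm
    rw [h1, h2]; linarith
  · exact (integrableOn_Icc_iff_integrableOn_Ioc (by simp)).2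
      ((intervalIntegrable_iff_integrableOn_Ioc_of_le (by linarith)).1 hI)
  · exact Filter.Eventually.of_forall fun x => by positivity

lemma lintegral_abs_rpow_neg_two_far {R : ℝ} (hR : 0 < R) :
    ∫⁻ x in {x : ℝ | R < |x|}, ENNReal.ofReal (|x| ^ (-2 : ℝ)) ≤ ENNReal.ofReal (2 / R) := by
  have hset : {x : ℝ | R < |x|} = Set.Iio (-R) ∪ Set.Ioi R := by
    ext x; simp [lt_abs, or_comm, lt_neg]
  have hpos : ∫⁻ x in Set.Ioi R, ENNReal.ofReal (|x| ^ (-2 : ℝ)) = ENNReal.ofReal (1 / R) := by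
    have h0 : ∫⁻ x in Set.Ioi R, ENNReal.ofReal (|x| ^ (-2 : ℝ)) =
        ∫⁻ x in Set.Ioi R, ENNReal.ofReal (x ^ (-2 : ℝ)) := by
      apply setLIntegral_congr_fun measurableSet_Ioi
      intro x hx
      simp [abs_of_pos (hR.trans hx)]
    rw [h0, ← ofReal_integral_eq_lintegral_ofReal (integrableOn_Ioi_rpow_of_lt (by norm_num) hR),
      integral_Ioi_rpow_of_lt (by norm_num) hR]
    · norm_num [Real.rpow_neg_one]
    · filter_upwards [ae_restrict_mem measurableSet_Ioi] with x hx
      exact Real.rpow_nonneg (hR.trans hx).le _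
  have hneg : ∫⁻ x in Set.Iio (-R), ENNReal.ofReal (|x| ^ (-2 : ℝ)) = ENNReal.ofReal (1 / R) := by
    rw [← hpos]
    have := (Measure.measurePreserving_neg (volume : Measure ℝ)).setLIntegral_comp_preimage
      (s := Set.Ioi R) measurableSet_Ioi
      (f := fun x : ℝ => ENNReal.ofReal (|x| ^ (-2 : ℝ))) (by fun_prop)
    rw [← this]
    simp
  rw [hset]
  refine (lintegral_union_le _ _ _).trans ?_
  rw [hpos, hneg, ← ENNReal.ofReal_add (by positivity) (by positivity)]
  apply le_of_eq; congr 1; ring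

lemma lintegral_mul_abs_sub_rpow_sublevel_le {γ : ℝ} (hγ0 : 0 < γ) (hγ1 : γ < 1) {f : ℝ → ℝ}
    (hf0 : ∀ t, 0 ≤ f t) (hfm : Measurable f) (t R : ℝ) (hR : 0 < R) :
    ∫⁻ s in {s | f s ≤ f t}, ENNReal.ofReal (f s * |t - s| ^ (-γ)) ≤
      ENNReal.ofReal (f t * (2 * (R ^ (1 - γ) / (1 - γ)))) +
      (∫⁻ s, ENNReal.ofReal (f s ^ (2 / (2 - γ)))) ^ ((2 - γ) / 2) *
        ENNReal.ofReal ((2 / R) ^ (γ / 2)) := by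
  set k : ℝ → ℝ≥0∞ := fun x => ENNReal.ofReal (|x| ^ (-γ)) with hk
  have hkm : Measurable k := by fun_prop
  set Nr : Set ℝ := {x : ℝ | |x| ≤ R}
  set Fr : Set ℝ := {x : ℝ | R < |x|}
  have hNr : MeasurableSet Nr := measurableSet_le (by fun_prop) (by fun_prop)
  have hFr : MeasurableSet Fr := measurableSet_lt (by fun_prop) (by fun_prop)
  have hS : MeasurableSet {s | f s ≤ f t} := measurableSet_le hfm measurable_const
  have step : ∫⁻ s in {s | f s ≤ f t}, ENNReal.ofReal (f s * |t - s| ^ (-γ)) ≤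
      ∫⁻ s, (ENNReal.ofReal (f t) * Nr.indicator k (t - s) +
        ENNReal.ofReal (f s) * Fr.indicator k (t - s)) := by
    rw [← lintegral_indicator hS]
    apply lintegral_mono
    intro s
    by_cases hs : f s ≤ f t
    · rw [Set.indicator_of_mem (by exact hs), ENNReal.ofReal_mul (hf0 s)]
      by_cases hr : |t - s| ≤ R
      · refine le_trans ?_ le_self_add
        rw [Set.indicator_of_mem (by exact hr)]
        gcongr
      · refine le_trans ?_ le_add_self
        rw [Set.indicator_of_mem (by exact not_le.1 hr)]
    · rw [Set.indicator_of_notMem (by exact hs)]; exact zero_le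
  refine step.trans ?_
  rw [lintegral_add_left (by
    refine Measurable.const_mul ?_ _
    exact (hkm.indicator hNr).comp (by fun_prop))]
  refine add_le_add ?_ ?_
  · have hm : Measurable fun s => Nr.indicator k (t - s) :=
      (hkm.indicator hNr).comp (measurable_const.sub measurable_id)
    rw [lintegral_const_mul _ hm,
      lintegral_sub_left_eq_self (fun x => Nr.indicator k x) t, lintegral_indicator hNr,
      ENNReal.ofReal_mul (hf0 t)]
    gcongr
    exact lintegral_abs_rpow_neg_near hγ1 hR
  · have hpq : (2 / (2 - γ)).HolderConjugate (2 / γ) := by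
      rw [Real.holderConjugate_iff]
      constructor
      · rw [lt_div_iff₀] <;> linarith
      · field_simp; ring
    have hH := ENNReal.lintegral_mul_le_Lp_mul_Lq volume hpq
      (f := fun s => ENNReal.ofReal (f s)) (g := fun s => Fr.indicator k (t - s))
      (by fun_prop) ((hkm.indicator hFr).comp (by fun_prop)).aemeasurable
    refine hH.trans ?_
    have e1 : (1 / (2 / (2 - γ))) = (2 - γ) / 2 := by field_simp
    have e2 : (1 / (2 / γ)) = γ / 2 := by field_simp
    rw [e1, e2]
    have e3 : (fun s => ENNReal.ofReal (f s) ^ (2 / (2 - γ))) =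
        fun s => ENNReal.ofReal (f s ^ (2 / (2 - γ))) := by
      funext s
      rw [ENNReal.ofReal_rpow_of_nonneg (hf0 s) (by have : 0 < 2 - γ := by linarith
                                                    positivity)]
    rw [e3]
    gcongr
    have e4 : ∫⁻ s, (Fr.indicator k (t - s)) ^ (2 / γ) =
        ∫⁻ x in Fr, ENNReal.ofReal (|x| ^ (-2 : ℝ)) := by
      rw [lintegral_sub_left_eq_self (fun x => (Fr.indicator k x) ^ (2 / γ)) t,
        ← lintegral_indicator hFr]
      congr 1; funext x
      by_cases hx : x ∈ Fr
      · rw [Set.indicator_of_mem hx, Set.indicator_of_mem hx, hk]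
        simp only
        rw [ENNReal.ofReal_rpow_of_nonneg (by positivity) (by positivity),
          ← Real.rpow_mul (abs_nonneg _)]
        congr 2; field_simp
      · rw [Set.indicator_of_notMem hx, Set.indicator_of_notMem hx,
        ENNReal.zero_rpow_of_pos (by positivity)]
    rw [e4, ← ENNReal.ofReal_rpow_of_nonneg (by positivity) (by positivity)]
    gcongr
    exact lintegral_abs_rpow_neg_two_far hR

/-- The diagonal Hardy–Littlewood–Sobolev inequality on the real line. -/
theorem hardyLittlewoodSobolev_diagonal {γ : ℝ} (hγ0 : 0 < γ) (hγ1 : γ < 1) {f : ℝ → ℝ}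
    (hf0 : ∀ t, 0 ≤ f t) (hfm : Measurable f) {A : ℝ} (hA : 0 < A)
    (hN : ∫⁻ s, ENNReal.ofReal (f s ^ (2 / (2 - γ))) = ENNReal.ofReal A) :
    ∫⁻ t, ∫⁻ s, ENNReal.ofReal (f t * f s * |t - s| ^ (-γ)) ≤
      ENNReal.ofReal (2 * (2 / (1 - γ) + 2 ^ (γ / 2)) * A ^ (2 - γ)) := by
  have h2γ : 0 < 2 - γ := by linarith
  have h1γ : 0 < 1 - γ := by linarith
  set p := 2 / (2 - γ) with hp
  have hp0 : 0 < p := by positivity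
  set c := 2 / (1 - γ) + 2 ^ (γ / 2) with hc
  have hc0 : 0 < c := by positivity
  have inner (t : ℝ) : ∫⁻ s in {s | f s ≤ f t}, ENNReal.ofReal (f t * f s * |t - s| ^ (-γ)) ≤
      ENNReal.ofReal (c * A ^ (1 - γ) * f t ^ p) := by
    rcases (hf0 t).eq_or_lt with h0 | h0
    · simp [← h0]
    have hR : 0 < A / f t ^ p := by positivity
    have h := lintegral_mul_abs_sub_rpow_sublevel_le hγ0 hγ1 hf0 hfm t (A / f t ^ p) hR
    rw [← hp, hN] at h
    have e0 : ∫⁻ s in {s | f s ≤ f t}, ENNReal.ofReal (f t * f s * |t - s| ^ (-γ)) =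
        ENNReal.ofReal (f t) *
          ∫⁻ s in {s | f s ≤ f t}, ENNReal.ofReal (f s * |t - s| ^ (-γ)) := by
      rw [← lintegral_const_mul _ (by fun_prop)]
      congr 1; funext s
      rw [← ENNReal.ofReal_mul h0.le, mul_assoc]
    rw [e0]
    refine (mul_le_mul_right h _).trans ?_
    rw [ENNReal.ofReal_rpow_of_pos hA, ← ENNReal.ofReal_mul (by positivity),
      ← ENNReal.ofReal_add (by positivity) (by positivity), ← ENNReal.ofReal_mul h0.le]
    apply ENNReal.ofReal_le_ofReal
    apply le_of_eq
    have hfp : ∀ x : ℝ, (f t ^ p) ^ x = f t ^ (p * x) := fun x => (Real.rpow_mul h0.le _ _).symm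
    have a1 : (A / f t ^ p) ^ (1 - γ) = A ^ (1 - γ) * f t ^ (p - 2) := by
      rw [Real.div_rpow hA.le (by positivity), hfp, div_eq_mul_inv, ← Real.rpow_neg h0.le]
      congr 2
      rw [hp]; field_simp; ring
    have a2 : A ^ ((2 - γ) / 2) * (2 / (A / f t ^ p)) ^ (γ / 2) =
        2 ^ (γ / 2) * A ^ (1 - γ) * f t ^ (p - 1) := by
      have : 2 / (A / f t ^ p) = 2 * A⁻¹ * f t ^ p := by field_simp
      rw [this, Real.mul_rpow (by positivity) (by positivity),
        Real.mul_rpow (by positivity) (by positivity), hfp, Real.inv_rpow hA.le,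
        ← Real.rpow_neg hA.le]
      have h1 : A ^ (1 - γ) = A ^ ((2 - γ) / 2) * A ^ (-(γ / 2)) := by
        rw [← Real.rpow_add hA]; congr 1; ring
      have h2 : p * (γ / 2) = p - 1 := by rw [hp]; field_simp; ring
      rw [h1, h2]; ring
    have b1 : f t ^ p = f t * f t * f t ^ (p - 2) := by
      rw [show p = 1 + 1 + (p - 2) by ring, Real.rpow_add h0, Real.rpow_add h0, Real.rpow_one]
      ring_nf
    have b2 : f t ^ p = f t * f t ^ (p - 1) := by
      rw [show p = 1 + (p - 1) by ring, Real.rpow_add h0, Real.rpow_one]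
      ring_nf
    rw [a1, a2, hc, add_mul, add_mul, mul_add]
    congr 1
    · rw [b1]; field_simp
    · rw [b2]; ring
  set g : ℝ → ℝ → ℝ≥0∞ := fun t s => ENNReal.ofReal (f t * f s * |t - s| ^ (-γ)) with hg
  have hgm : Measurable (Function.uncurry g) := by
    simp only [hg, Function.uncurry_def]; fun_prop
  set L : Set (ℝ × ℝ) := {z | f z.2 ≤ f z.1} with hL
  have hLm : MeasurableSet L := measurableSet_le (by fun_prop) (by fun_prop)
  set G : ℝ → ℝ → ℝ≥0∞ := fun t s => L.indicator (Function.uncurry g) (t, s) with hG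
  have hGm : Measurable (Function.uncurry G) := hgm.indicator hLm
  have hInt : ∀ t, ∫⁻ s, G t s ≤ ENNReal.ofReal (c * A ^ (1 - γ) * f t ^ p) := by
    intro t
    refine le_trans (le_of_eq ?_) (inner t)
    rw [← lintegral_indicator (measurableSet_le hfm measurable_const)]
    rfl
  have hG1 : ∫⁻ t, ∫⁻ s, G t s ≤ ENNReal.ofReal (c * A ^ (2 - γ)) := by
    refine (lintegral_mono hInt).trans ?_
    have : (fun t => ENNReal.ofReal (c * A ^ (1 - γ) * f t ^ p)) =
        fun t => ENNReal.ofReal (c * A ^ (1 - γ)) * ENNReal.ofReal (f t ^ p) := by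
      funext t; rw [ENNReal.ofReal_mul (by positivity)]
    rw [this, lintegral_const_mul _ (by fun_prop), hN, ← ENNReal.ofReal_mul (by positivity)]
    apply ENNReal.ofReal_le_ofReal
    rw [show 2 - γ = (1 - γ) + 1 by ring, Real.rpow_add hA, Real.rpow_one, mul_assoc]
  have hsum : ∀ t s, g t s ≤ G t s + G s t := by
    intro t s
    rcases le_total (f s) (f t) with h | h
    · refine le_trans (le_of_eq ?_) le_self_add
      simp only [hG]; rw [Set.indicator_of_mem (by exact h)]; rfl
    · refine le_trans (le_of_eq ?_) le_add_self
      simp only [hG]; rw [Set.indicator_of_mem (by exact h)]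
      simp only [hg, Function.uncurry_def]
      rw [abs_sub_comm, mul_comm (f t)]
  calc ∫⁻ t, ∫⁻ s, g t s ≤ ∫⁻ t, ∫⁻ s, (G t s + G s t) :=
        lintegral_mono fun t => lintegral_mono fun s => hsum t s
    _ = (∫⁻ t, ∫⁻ s, G t s) + ∫⁻ t, ∫⁻ s, G s t := by
        rw [← lintegral_add_left (f := fun t => ∫⁻ s, G t s) hGm.lintegral_prod_right']
        congr 1; funext t
        rw [lintegral_add_left (by exact hGm.comp (by fun_prop : Measurable fun s => (t, s)))]
    _ = (∫⁻ t, ∫⁻ s, G t s) + ∫⁻ t, ∫⁻ s, G t s := by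
        congr 1
        exact lintegral_lintegral_swap (f := fun t s => G s t)
          (hGm.comp measurable_swap).aemeasurable
    _ ≤ ENNReal.ofReal (c * A ^ (2 - γ)) + ENNReal.ofReal (c * A ^ (2 - γ)) := add_le_add hG1 hG1
    _ = _ := by
        rw [← ENNReal.ofReal_add (by positivity) (by positivity)]; congr 1; ring

lemma lintegral_le_of_forall_Icc_le {g : ℝ → ℝ≥0∞} (hg : Measurable g) {K : ℝ≥0∞}
    (h : ∀ R : ℝ, 0 < R → ∫⁻ t in Set.Icc (-R) R, g t ≤ K) : ∫⁻ t, g t ≤ K := by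
  have hc : AECover volume Filter.atTop (fun R : ℝ => Set.Icc (-R) R) :=
    aecover_Icc Filter.tendsto_neg_atTop_atBot Filter.tendsto_id
  refine le_of_tendsto (hc.lintegral_tendsto_of_countably_generated hg.aemeasurable) ?_
  filter_upwards [Filter.eventually_gt_atTop 0] with R hR using h R hR

/-- The abstract `TT*` estimate: decay of the Gram kernel `⟪v s, v t⟫` like `|t - s| ^ (-γ)`
gives an `L^{2/γ}` bound for the coefficients `⟪v t, F⟫`. -/
theorem lintegral_norm_inner_rpow_le_of_gram_decay {H : Type*} [NormedAddCommGroup H]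
    [InnerProductSpace ℂ H] [CompleteSpace H] {γ : ℝ} (hγ0 : 0 < γ) (hγ1 : γ < 1)
    {v : ℝ → H} (hv : StronglyMeasurable v) {B D : ℝ} (hB : ∀ t, ‖v t‖ ≤ B) (hD : 0 < D)
    (hdec : ∀ s t, s ≠ t → ‖inner ℂ (v s) (v t)‖ ≤ D * |s - t| ^ (-γ)) (F : H) :
    ∫⁻ t, ENNReal.ofReal (‖inner ℂ (v t) F‖ ^ (2 / γ)) ≤
      ENNReal.ofReal ((D * (2 * (2 / (1 - γ) + 2 ^ (γ / 2)))) ^ (1 / γ) * ‖F‖ ^ (2 / γ)) := by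
  have h1γ : 0 < 1 - γ := by linarith
  have h2γ : 0 < 2 - γ := by linarith
  set q := 2 / γ with hq
  have hq2 : 2 < q := by rw [hq, lt_div_iff₀ hγ0]; linarith
  set c := 2 * (2 / (1 - γ) + 2 ^ (γ / 2)) with hc
  have hc0 : 0 < c := by positivity
  have hB0 : 0 ≤ B := (norm_nonneg _).trans (hB 0)
  set z : ℝ → ℂ := fun t => inner ℂ (v t) F with hz
  have hzm : Measurable z := (hv.inner stronglyMeasurable_const).measurable
  have hzb : ∀ t, ‖z t‖ ≤ B * ‖F‖ := fun t =>
    (norm_inner_le_norm _ _).trans (mul_le_mul_of_nonneg_right (hB t) (norm_nonneg _))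
  change ∫⁻ t, ENNReal.ofReal (‖z t‖ ^ q) ≤ _
  have hzq : Measurable fun t => ‖z t‖ ^ q := hzm.norm.pow_const q
  apply lintegral_le_of_forall_Icc_le (by fun_prop)
  intro R hR
  set I := Set.Icc (-R) R
  have hI : MeasurableSet I := measurableSet_Icc
  have hfinI : volume I ≠ ∞ := by simp [I]
  have hAint : IntegrableOn (fun t => ‖z t‖ ^ q) I := by
    refine Measure.integrableOn_of_bounded (M := (B * ‖F‖) ^ q) hfinI
      hzq.aestronglyMeasurable ?_
    filter_upwards with t
    rw [Real.norm_of_nonneg (by positivity)]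
    exact Real.rpow_le_rpow (norm_nonneg _) (hzb t) (by linarith)
  set A := ∫ t in I, ‖z t‖ ^ q with hA
  have hA0 : 0 ≤ A := integral_nonneg fun t => by positivity
  have hAl : ∫⁻ t in I, ENNReal.ofReal (‖z t‖ ^ q) = ENNReal.ofReal A :=
    (ofReal_integral_eq_lintegral_ofReal hAint
      (Filter.Eventually.of_forall fun t => by positivity)).symm
  rw [hAl]
  apply ENNReal.ofReal_le_ofReal
  rcases hA0.eq_or_lt with hA00 | hApos
  · rw [← hA00]; positivity
  -- the extremal density
  set a : ℝ → ℂ := I.indicator fun t => ((‖z t‖ ^ (q - 2) : ℝ) : ℂ) * z t with ha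
  set f : ℝ → ℝ := I.indicator fun t => ‖z t‖ ^ (q - 1) with hf
  have ham : Measurable a := by
    refine Measurable.indicator ?_ hI
    fun_prop
  have hfm : Measurable f := by
    refine Measurable.indicator ?_ hI
    fun_prop
  have hf0 : ∀ t, 0 ≤ f t := fun t => Set.indicator_nonneg (fun t _ => by positivity) t
  have haf : ∀ t, ‖a t‖ = f t := by
    intro t
    by_cases ht : t ∈ I
    · simp only [ha, hf, Set.indicator_of_mem ht, norm_mul, Complex.norm_real]
      rw [Real.norm_of_nonneg (by positivity)]
      rcases (norm_nonneg (z t)).eq_or_lt with h0 | h0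
      · rw [← h0, Real.zero_rpow (by linarith), Real.zero_rpow (by linarith)]; simp
      · rw [← Real.rpow_add_one h0.ne']; congr 1; ring
    · simp [ha, hf, Set.indicator_of_notMem ht]
  set w : ℝ → H := fun t => a t • v t with hw
  have hwm : StronglyMeasurable w := ham.stronglyMeasurable.smul hv
  have hwsupp : ∀ t, t ∉ I → w t = 0 := fun t ht => by simp [hw, ha, Set.indicator_of_notMem ht]
  have hwint : Integrable w := by
    have : IntegrableOn w I := by
      refine Measure.integrableOn_of_bounded (M := (B * ‖F‖) ^ (q - 1) * B) hfinI
        hwm.aestronglyMeasurable ?_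
      filter_upwards [ae_restrict_mem hI] with t ht
      rw [hw]; simp only [norm_smul, haf, hf, Set.indicator_of_mem ht]
      have := Real.rpow_le_rpow (norm_nonneg _) (hzb t) (by linarith : 0 ≤ q - 1)
      exact mul_le_mul this (hB t) (norm_nonneg _) (by positivity)
    rw [← integrable_indicator_iff hI] at this
    have hwI : I.indicator w = w := by
      funext t
      by_cases ht : t ∈ I
      · simp [Set.indicator_of_mem ht]
      · simp [Set.indicator_of_notMem ht, hwsupp t ht]
    rwa [hwI] at this
  set W : H := ∫ t, w t with hW
  have hWF : inner ℂ W F = (A : ℂ) := by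
    have h1 : inner ℂ F W = ∫ t, inner ℂ F (w t) := (integral_inner hwint F).symm
    have h2 : ∀ t, inner ℂ F (w t) = ((I.indicator (fun t => ‖z t‖ ^ q) t : ℝ) : ℂ) := by
      intro t
      by_cases ht : t ∈ I
      · simp only [hw, ha, Set.indicator_of_mem ht, inner_smul_right]
        have : inner ℂ F (v t) = (starRingEnd ℂ) (z t) := (inner_conj_symm _ _).symm
        rw [this, mul_assoc, Complex.mul_conj, Complex.normSq_eq_norm_sq, ← Complex.ofReal_mul]
        congr 1
        rcases (norm_nonneg (z t)).eq_or_lt with h0 | h0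
        · rw [← h0, Real.zero_rpow (x := q) (by linarith)]; simp
        · rw [← Real.rpow_natCast, ← Real.rpow_add h0]; congr 1; push_cast; ring
      · simp [hw, ha, Set.indicator_of_notMem ht]
    rw [← inner_conj_symm, h1, integral_congr_ae (Filter.Eventually.of_forall h2),
      integral_complex_ofReal, integral_indicator hI, Complex.conj_ofReal]
  have hWn : ‖W‖ ^ 2 ≤ D * c * A ^ (2 - γ) := by
    have hN : ∫⁻ s, ENNReal.ofReal (f s ^ (2 / (2 - γ))) = ENNReal.ofReal A := by
      rw [← hAl, ← lintegral_indicator hI]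
      congr 1; funext t
      by_cases ht : t ∈ I
      · simp only [hf, Set.indicator_of_mem ht]
        rw [← Real.rpow_mul (norm_nonneg _)]
        congr 2
        rw [hq]; field_simp
      · simp only [hf, Set.indicator_of_notMem ht]
        rw [Real.zero_rpow (by positivity)]; simp
    have hls := hardyLittlewoodSobolev_diagonal hγ0 hγ1 hf0 hfm hApos hN
    rw [← hc] at hls
    have hww : ∀ t s, s ≠ t → ‖inner ℂ (w t) (w s)‖ₑ ≤
        ENNReal.ofReal D * ENNReal.ofReal (f t * f s * |t - s| ^ (-γ)) := by
      intro t s hst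
      rw [← ofReal_norm, ← ENNReal.ofReal_mul hD.le]
      apply ENNReal.ofReal_le_ofReal
      simp only [hw, inner_smul_left, inner_smul_right, norm_mul, RCLike.norm_conj, haf]
      have := hdec t s hst.symm
      calc f s * (f t * ‖inner ℂ (v t) (v s)‖) = f t * f s * ‖inner ℂ (v t) (v s)‖ := by ring
        _ ≤ f t * f s * (D * |t - s| ^ (-γ)) :=
          mul_le_mul_of_nonneg_left this (mul_nonneg (hf0 _) (hf0 _))
        _ = _ := by ring
    have hb : ENNReal.ofReal (‖W‖ ^ 2) ≤ ENNReal.ofReal (D * c * A ^ (2 - γ)) := by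
      calc ENNReal.ofReal (‖W‖ ^ 2) = ‖inner ℂ W W‖ₑ := by
            rw [← ofReal_norm, inner_self_eq_norm_sq_to_K]; simp
        _ = ‖∫ t, inner ℂ W (w t)‖ₑ := by rw [integral_inner hwint]
        _ ≤ ∫⁻ t, ‖inner ℂ W (w t)‖ₑ := enorm_integral_le_lintegral_enorm _
        _ ≤ ∫⁻ t, ∫⁻ s, ‖inner ℂ (w t) (w s)‖ₑ := by
            apply lintegral_mono; intro t
            have : ‖inner ℂ W (w t)‖ₑ = ‖inner ℂ (w t) W‖ₑ := by
              rw [← ofReal_norm, ← ofReal_norm, norm_inner_symm]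
            simp only [this]
            rw [hW, ← integral_inner hwint]
            exact enorm_integral_le_lintegral_enorm _
        _ ≤ ∫⁻ t, ∫⁻ s, ENNReal.ofReal D * ENNReal.ofReal (f t * f s * |t - s| ^ (-γ)) := by
            apply lintegral_mono; intro t
            apply lintegral_mono_ae
            filter_upwards [compl_mem_ae_iff.2 (measure_singleton t)] with s hs
            exact hww t s hs
        _ = ENNReal.ofReal D * ∫⁻ t, ∫⁻ s, ENNReal.ofReal (f t * f s * |t - s| ^ (-γ)) := by
            rw [← lintegral_const_mul' _ _ ENNReal.ofReal_ne_top]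
            congr 1; funext t
            rw [lintegral_const_mul' _ _ ENNReal.ofReal_ne_top]
        _ ≤ ENNReal.ofReal D * ENNReal.ofReal (c * A ^ (2 - γ)) := by gcongr
        _ = _ := by rw [← ENNReal.ofReal_mul hD.le, mul_assoc D c]
    exact (ENNReal.ofReal_le_ofReal_iff (by positivity)).1 hb
  have hAle : A ≤ ‖W‖ * ‖F‖ := by
    have := norm_inner_le_norm (𝕜 := ℂ) W F
    rwa [hWF, Complex.norm_real, Real.norm_of_nonneg hA0] at this
  have hsq : A ^ 2 ≤ D * c * A ^ (2 - γ) * ‖F‖ ^ 2 := by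
    calc A ^ 2 ≤ (‖W‖ * ‖F‖) ^ 2 := by gcongr
      _ = ‖W‖ ^ 2 * ‖F‖ ^ 2 := by ring
      _ ≤ _ := by gcongr
  have hAγ : A ^ γ ≤ D * c * ‖F‖ ^ 2 := by
    have e : A ^ 2 = A ^ (2 - γ) * A ^ γ := by
      rw [← Real.rpow_add hApos, ← Real.rpow_natCast]; congr 1; push_cast; ring
    rw [e] at hsq
    have hp : 0 < A ^ (2 - γ) := by positivity
    refine le_of_mul_le_mul_left (hsq.trans (le_of_eq ?_)) hp
    ring
  calc A = (A ^ γ) ^ (1 / γ) := by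
        rw [← Real.rpow_mul hA0, mul_one_div_cancel hγ0.ne', Real.rpow_one]
    _ ≤ (D * c * ‖F‖ ^ 2) ^ (1 / γ) := Real.rpow_le_rpow (by positivity) hAγ (by positivity)
    _ = _ := by
        rw [Real.mul_rpow (by positivity) (by positivity), ← Real.rpow_natCast,
          ← Real.rpow_mul (norm_nonneg _)]
        congr 2
        rw [hq]; push_cast; ring

/-- Analytic interpolation family `z ↦ sgn x · |x| ^ (p (1 - z / 2))` through a complex number. -/
def interpPow (p : ℝ) (x z : ℂ) : ℂ :=
  x / ‖x‖ * Complex.exp (p * (1 - z / 2) * Real.log ‖x‖)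

lemma norm_interpPow (p : ℝ) {x : ℂ} (hx : x ≠ 0) (z : ℂ) :
    ‖interpPow p x z‖ = ‖x‖ ^ (p * (1 - z.re / 2)) := by
  have hx' : 0 < ‖x‖ := norm_pos_iff.2 hx
  rw [interpPow, norm_mul, norm_div, Complex.norm_real, norm_norm, div_self hx'.ne', one_mul,
    Complex.norm_exp, Real.rpow_def_of_pos hx']
  congr 1
  have : (p * (1 - z / 2) * Real.log ‖x‖ : ℂ) = ((p * Real.log ‖x‖ : ℝ) : ℂ) * (1 - z / 2) := by
    push_cast; ring
  rw [this, Complex.re_ofReal_mul]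
  simp; ring

lemma interpPow_zero (p : ℝ) (z : ℂ) : interpPow p 0 z = 0 := by simp [interpPow]

lemma interpPow_self {p : ℝ} {θ : ℝ} (hp : p * (1 - θ / 2) = 1) (x : ℂ) :
    interpPow p x θ = x := by
  rcases eq_or_ne x 0 with rfl | hx
  · exact interpPow_zero _ _
  have hx' : 0 < ‖x‖ := norm_pos_iff.2 hx
  have : ((p : ℂ) * (1 - θ / 2) * Real.log ‖x‖) = ((Real.log ‖x‖ : ℝ) : ℂ) := by
    have : ((p : ℂ) * (1 - θ / 2)) = ((p * (1 - θ / 2) : ℝ) : ℂ) := by push_cast; ring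
    rw [this, hp]; simp
  rw [interpPow, this, ← Complex.ofReal_exp, Real.exp_log hx', div_mul_cancel₀]
  exact_mod_cast hx'.ne'

lemma differentiable_interpPow (p : ℝ) (x : ℂ) : Differentiable ℂ (interpPow p x) := by
  unfold interpPow; fun_prop

lemma norm_interpPow_le {p : ℝ} (hp : 0 < p) (x : ℂ) {z : ℂ} (h0 : 0 ≤ z.re) (h1 : z.re ≤ 1) :
    ‖interpPow p x z‖ ≤ (1 + ‖x‖) ^ p := by
  rcases eq_or_ne x 0 with rfl | hx
  · rw [interpPow_zero]; simp
  rw [norm_interpPow p hx]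
  calc ‖x‖ ^ (p * (1 - z.re / 2)) ≤ (1 + ‖x‖) ^ (p * (1 - z.re / 2)) :=
        Real.rpow_le_rpow (norm_nonneg _) (by linarith) (by
          apply mul_nonneg hp.le; linarith)
    _ ≤ (1 + ‖x‖) ^ p :=
        Real.rpow_le_rpow_of_exponent_le (by linarith [norm_nonneg x]) (by nlinarith)

/-- Riesz–Thorin interpolation between weighted `ℓ¹` and `ℓ²` for finite bilinear forms,
normalised vectors. -/
lemma norm_bilin_le_of_normalized {ι κ : Type*} (s : Finset ι) (u : Finset κ) {μ : ι → ℝ}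
    {ν : κ → ℝ}
    (b : ι → κ → ℂ) {M₀ M₁ : ℝ}
    (h₀ : ∀ (x : ι → ℂ) (y : κ → ℂ), ‖∑ i ∈ s, ∑ j ∈ u, x i * y j * b i j‖ ≤
      M₀ * (∑ i ∈ s, ‖x i‖ * μ i) * ∑ j ∈ u, ‖y j‖ * ν j)
    (h₁ : ∀ (x : ι → ℂ) (y : κ → ℂ), ‖∑ i ∈ s, ∑ j ∈ u, x i * y j * b i j‖ ≤
      M₁ * √(∑ i ∈ s, ‖x i‖ ^ 2 * μ i) * √(∑ j ∈ u, ‖y j‖ ^ 2 * ν j))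
    {p θ : ℝ} (hp : 0 < p) (hθ0 : 0 ≤ θ) (hθ1 : θ ≤ 1) (hpθ : p * (1 - θ / 2) = 1)
    (x : ι → ℂ) (y : κ → ℂ) (hx : ∑ i ∈ s, ‖x i‖ ^ p * μ i = 1)
    (hy : ∑ j ∈ u, ‖y j‖ ^ p * ν j = 1) :
    ‖∑ i ∈ s, ∑ j ∈ u, x i * y j * b i j‖ ≤ M₀ ^ (1 - θ) * M₁ ^ θ := by
  set f : ℂ → ℂ := fun z => ∑ i ∈ s, ∑ j ∈ u, interpPow p (x i) z * interpPow p (y j) z * b i j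
    with hf
  have hfd : Differentiable ℂ f := by
    rw [hf]
    refine Differentiable.fun_sum fun i _ => Differentiable.fun_sum fun j _ => ?_
    exact ((differentiable_interpPow p _).mul (differentiable_interpPow p _)).mul_const _
  have hbd : BddAbove (Set.image (norm ∘ f) (HadamardThreeLines.verticalClosedStrip 0 1)) := by
    refine ⟨∑ i ∈ s, ∑ j ∈ u, (1 + ‖x i‖) ^ p * (1 + ‖y j‖) ^ p * ‖b i j‖, ?_⟩
    rintro _ ⟨z, hz, rfl⟩
    have hz' : 0 ≤ z.re ∧ z.re ≤ 1 := by
      simpa [HadamardThreeLines.verticalClosedStrip] using hz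
    simp only [Function.comp, hf]
    refine (norm_sum_le _ _).trans (Finset.sum_le_sum fun i _ => ?_)
    refine (norm_sum_le _ _).trans (Finset.sum_le_sum fun j _ => ?_)
    rw [norm_mul, norm_mul]
    gcongr
    · exact norm_interpPow_le hp _ hz'.1 hz'.2
    · exact norm_interpPow_le hp _ hz'.1 hz'.2
  have key0 : ∀ (x : ℂ) (z : ℂ), z.re = 0 → ‖interpPow p x z‖ = ‖x‖ ^ p := by
    intro x z hz
    rcases eq_or_ne x 0 with rfl | hx
    · rw [interpPow_zero, norm_zero, Real.zero_rpow hp.ne']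
    · rw [norm_interpPow p hx, hz]; simp
  have key1 : ∀ (x : ℂ) (z : ℂ), z.re = 1 → ‖interpPow p x z‖ ^ 2 = ‖x‖ ^ p := by
    intro x z hz
    rcases eq_or_ne x 0 with rfl | hx
    · rw [interpPow_zero, norm_zero, Real.zero_rpow hp.ne']; simp
    · rw [norm_interpPow p hx, hz, ← Real.rpow_natCast, ← Real.rpow_mul (norm_nonneg _)]
      congr 1; push_cast; ring
  have hmain := HadamardThreeLines.norm_le_interp_of_mem_verticalClosedStrip₀₁' f
    (z := (θ : ℂ)) (a := M₀) (b := M₁) (by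
      simp [HadamardThreeLines.verticalClosedStrip, hθ0, hθ1]) hfd.diffContOnCl hbd
    (by
      intro z hz
      have hz' : z.re = 0 := by simpa using hz
      refine (h₀ _ _).trans (le_of_eq ?_)
      simp only [key0 _ z hz', hx, hy, mul_one])
    (by
      intro z hz
      have hz' : z.re = 1 := by simpa using hz
      refine (h₁ _ _).trans (le_of_eq ?_)
      simp only [key1 _ z hz', hx, hy, mul_one, Real.sqrt_one])
  simpa [hf, interpPow_self hpθ] using hmain

/-- Riesz–Thorin interpolation between weighted `ℓ¹` and `ℓ²` for finite bilinear forms. -/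
theorem norm_bilin_le_of_interpolation {ι κ : Type*} (s : Finset ι) (u : Finset κ) {μ : ι → ℝ}
    {ν : κ → ℝ}
    (hμ : ∀ i, 0 ≤ μ i) (hν : ∀ i, 0 ≤ ν i)
    (b : ι → κ → ℂ) {M₀ M₁ : ℝ}
    (h₀ : ∀ (x : ι → ℂ) (y : κ → ℂ), ‖∑ i ∈ s, ∑ j ∈ u, x i * y j * b i j‖ ≤
      M₀ * (∑ i ∈ s, ‖x i‖ * μ i) * ∑ j ∈ u, ‖y j‖ * ν j)
    (h₁ : ∀ (x : ι → ℂ) (y : κ → ℂ), ‖∑ i ∈ s, ∑ j ∈ u, x i * y j * b i j‖ ≤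
      M₁ * √(∑ i ∈ s, ‖x i‖ ^ 2 * μ i) * √(∑ j ∈ u, ‖y j‖ ^ 2 * ν j))
    {p θ : ℝ} (hp : 0 < p) (hθ0 : 0 ≤ θ) (hθ1 : θ ≤ 1) (hpθ : p * (1 - θ / 2) = 1)
    (x : ι → ℂ) (y : κ → ℂ) :
    ‖∑ i ∈ s, ∑ j ∈ u, x i * y j * b i j‖ ≤ M₀ ^ (1 - θ) * M₁ ^ θ *
      (∑ i ∈ s, ‖x i‖ ^ p * μ i) ^ (1 / p) * (∑ j ∈ u, ‖y j‖ ^ p * ν j) ^ (1 / p) := by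
  set X := ∑ i ∈ s, ‖x i‖ ^ p * μ i with hX
  set Y := ∑ j ∈ u, ‖y j‖ ^ p * ν j with hY
  have hXi : ∀ i, 0 ≤ ‖x i‖ ^ p * μ i := fun i => mul_nonneg (by positivity) (hμ i)
  have hYi : ∀ i, 0 ≤ ‖y i‖ ^ p * ν i := fun i => mul_nonneg (by positivity) (hν i)
  have vanish : ∀ {w : ℂ} {m : ℝ}, ‖w‖ ^ p * m = 0 → ‖w‖ ^ 2 * m = 0 := by
    intro w m h
    rcases mul_eq_zero.1 h with h | h
    · rw [(Real.rpow_eq_zero (norm_nonneg _) hp.ne').1 h]; simp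
    · simp [h]
  rcases (Finset.sum_nonneg fun i _ => hXi i : 0 ≤ X).eq_or_lt with h0 | hXpos
  · have : ∑ i ∈ s, ‖x i‖ ^ 2 * μ i = 0 := Finset.sum_eq_zero fun i hi =>
      vanish ((Finset.sum_eq_zero_iff_of_nonneg fun i _ => hXi i).1 h0.symm i hi)
    have h := h₁ x y
    rw [this, Real.sqrt_zero, mul_zero, zero_mul] at h
    rw [show X = 0 from h0.symm, Real.zero_rpow (by positivity), mul_zero, zero_mul]; exact h
  rcases (Finset.sum_nonneg fun i _ => hYi i : 0 ≤ Y).eq_or_lt with h0 | hYpos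
  · have : ∑ i ∈ u, ‖y i‖ ^ 2 * ν i = 0 := Finset.sum_eq_zero fun i hi =>
      vanish ((Finset.sum_eq_zero_iff_of_nonneg fun i _ => hYi i).1 h0.symm i hi)
    have h := h₁ x y
    rw [this, Real.sqrt_zero, mul_zero] at h
    rw [show Y = 0 from h0.symm, Real.zero_rpow (by positivity), mul_zero]; exact h
  have hXp : 0 < X ^ (1 / p) := by positivity
  have hYp : 0 < Y ^ (1 / p) := by positivity
  have resc : ∀ {Z : ℝ}, 0 < Z → ∀ w : ℂ, ‖w / ((Z ^ (1 / p) : ℝ) : ℂ)‖ ^ p = ‖w‖ ^ p / Z := by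
    intro Z hZ w
    rw [norm_div, Complex.norm_real, Real.norm_of_nonneg (by positivity),
      Real.div_rpow (norm_nonneg _) (by positivity), ← Real.rpow_mul hZ.le,
        one_div_mul_cancel hp.ne',
      Real.rpow_one]
  have h := norm_bilin_le_of_normalized s u b h₀ h₁ hp hθ0 hθ1 hpθ
    (fun i => x i / ((X ^ (1 / p) : ℝ) : ℂ)) (fun j => y j / ((Y ^ (1 / p) : ℝ) : ℂ))
    (by
      refine Eq.trans ?_ (div_self hXpos.ne')
      conv_rhs => rw [Finset.sum_div]
      exact Finset.sum_congr rfl fun i _ => by rw [resc hXpos, div_mul_eq_mul_div])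
    (by
      refine Eq.trans ?_ (div_self hYpos.ne')
      conv_rhs => rw [Finset.sum_div]
      exact Finset.sum_congr rfl fun i _ => by rw [resc hYpos, div_mul_eq_mul_div])
  have e : ∑ i ∈ s, ∑ j ∈ u, x i / ((X ^ (1 / p) : ℝ) : ℂ) * (y j / ((Y ^ (1 / p) : ℝ) : ℂ)) * b i j
      = (∑ i ∈ s, ∑ j ∈ u, x i * y j * b i j) /
        (((X ^ (1 / p) : ℝ) : ℂ) * ((Y ^ (1 / p) : ℝ) : ℂ)) := by
    rw [Finset.sum_div]
    refine Finset.sum_congr rfl fun i _ => ?_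
    rw [Finset.sum_div]
    refine Finset.sum_congr rfl fun j _ => ?_
    have h1 : ((X ^ (1 / p) : ℝ) : ℂ) ≠ 0 := by exact_mod_cast hXp.ne'
    have h2 : ((Y ^ (1 / p) : ℝ) : ℂ) ≠ 0 := by exact_mod_cast hYp.ne'
    field_simp
  rw [e, norm_div, norm_mul, Complex.norm_real, Complex.norm_real,
    Real.norm_of_nonneg hXp.le, Real.norm_of_nonneg hYp.le, div_le_iff₀ (by positivity)] at h
  rw [mul_assoc (M₀ ^ (1 - θ) * M₁ ^ θ)]
  exact h

/-- The functions `F i` are continuous on `(1/4, 4)` and bounded uniformly in `i`. -/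
def UnifBdd {ι : Type*} (F : ι → ℝ → ℂ) : Prop :=
  (∀ i, ContinuousOn (F i) (Set.Ioo (1 / 4) 4)) ∧
    ∃ C, ∀ i, ∀ v ∈ Set.Ioo (1 / 4 : ℝ) 4, ‖F i v‖ ≤ C

/-- `UnifSmooth n F`: the functions `F i` have `n` continuous derivatives on `(1/4, 4)`, all of
them bounded uniformly in the parameter `i`. -/
def UnifSmooth {ι : Type*} : ℕ → (ι → ℝ → ℂ) → Prop
  | 0, F => UnifBdd F
  | n + 1, F => UnifBdd F ∧
      ∃ F' : ι → ℝ → ℂ, (∀ i, ∀ v ∈ Set.Ioo (1 / 4 : ℝ) 4, HasDerivAt (F i) (F' i v) v) ∧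
        UnifSmooth n F'

namespace UnifSmooth

variable {ι : Type*}

lemma zero_of {n : ℕ} {F : ι → ℝ → ℂ} (h : UnifSmooth n F) : UnifSmooth 0 F := by
  cases n with
  | zero => exact h
  | succ n => exact h.1

lemma of_succ {n : ℕ} {F : ι → ℝ → ℂ} (h : UnifSmooth (n + 1) F) : UnifSmooth n F := by
  induction n generalizing F with
  | zero => exact h.1
  | succ n ih =>
    obtain ⟨h0, F', hF', hn⟩ := h
    exact ⟨h0, F', hF', ih hn⟩

/-- A family which is differentiable and bounded is as smooth as its derivative allows. -/
lemma succ_intro {n : ℕ} {F F' : ι → ℝ → ℂ} {C : ℝ}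
    (hC : ∀ i, ∀ v ∈ Set.Ioo (1 / 4 : ℝ) 4, ‖F i v‖ ≤ C)
    (hd : ∀ i, ∀ v ∈ Set.Ioo (1 / 4 : ℝ) 4, HasDerivAt (F i) (F' i v) v)
    (h : UnifSmooth n F') : UnifSmooth (n + 1) F :=
  ⟨⟨fun i v hv => (hd i v hv).continuousAt.continuousWithinAt, C, hC⟩, F', hd, h⟩

lemma const {n : ℕ} {c : ι → ℂ} {C : ℝ} (hc : ∀ i, ‖c i‖ ≤ C) :
    UnifSmooth n fun i (_ : ℝ) => c i := by
  induction n generalizing c C with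
  | zero => exact ⟨fun _ => continuousOn_const, C, fun i _ _ => hc i⟩
  | succ n ih =>
    exact succ_intro (fun i _ _ => hc i) (fun i v _ => hasDerivAt_const v (c i))
      (ih (c := fun _ => 0) (C := 0) (by simp))

lemma add {n : ℕ} {F G : ι → ℝ → ℂ} (hF : UnifSmooth n F) (hG : UnifSmooth n G) :
    UnifSmooth n fun i v => F i v + G i v := by
  induction n generalizing F G with
  | zero =>
    obtain ⟨hFc, A, hA⟩ := hF
    obtain ⟨hGc, B, hB⟩ := hG
    exact ⟨fun i => (hFc i).add (hGc i), A + B,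
      fun i v hv => (norm_add_le _ _).trans (add_le_add (hA i v hv) (hB i v hv))⟩
  | succ n ih =>
    obtain ⟨⟨-, A, hA⟩, F', hF', hFn⟩ := hF
    obtain ⟨⟨-, B, hB⟩, G', hG', hGn⟩ := hG
    exact succ_intro (C := A + B)
      (fun i v hv => (norm_add_le _ _).trans (add_le_add (hA i v hv) (hB i v hv)))
      (fun i v hv => (hF' i v hv).add (hG' i v hv)) (ih hFn hGn)

lemma mul {n : ℕ} {F G : ι → ℝ → ℂ} (hF : UnifSmooth n F) (hG : UnifSmooth n G) :
    UnifSmooth n fun i v => F i v * G i v := by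
  induction n generalizing F G with
  | zero =>
    obtain ⟨hFc, A, hA⟩ := hF
    obtain ⟨hGc, B, hB⟩ := hG
    refine ⟨fun i => (hFc i).mul (hGc i), A * B, fun i v hv => ?_⟩
    rw [norm_mul]
    exact mul_le_mul (hA i v hv) (hB i v hv) (norm_nonneg _) ((norm_nonneg _).trans (hA i v hv))
  | succ n ih =>
    have hF1 := hF.of_succ
    have hG1 := hG.of_succ
    obtain ⟨⟨-, A, hA⟩, F', hF', hFn⟩ := hF
    obtain ⟨⟨-, B, hB⟩, G', hG', hGn⟩ := hG
    refine succ_intro (C := A * B) (fun i v hv => ?_)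
      (fun i v hv => (hF' i v hv).mul (hG' i v hv)) ((ih hFn hG1).add (ih hF1 hGn))
    rw [norm_mul]
    exact mul_le_mul (hA i v hv) (hB i v hv) (norm_nonneg _) ((norm_nonneg _).trans (hA i v hv))

lemma const_mul {n : ℕ} {F : ι → ℝ → ℂ} (c : ℂ) (hF : UnifSmooth n F) :
    UnifSmooth n fun i v => c * F i v :=
  (const (c := fun _ => c) (C := ‖c‖) fun _ => le_rfl).mul hF

lemma neg {n : ℕ} {F : ι → ℝ → ℂ} (hF : UnifSmooth n F) : UnifSmooth n fun i v => -F i v := by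
  simpa using hF.const_mul (-1)

lemma sub {n : ℕ} {F G : ι → ℝ → ℂ} (hF : UnifSmooth n F) (hG : UnifSmooth n G) :
    UnifSmooth n fun i v => F i v - G i v := by
  simpa [sub_eq_add_neg] using hF.add hG.neg

lemma pow {n : ℕ} {F : ι → ℝ → ℂ} (hF : UnifSmooth n F) (k : ℕ) :
    UnifSmooth n fun i v => F i v ^ k := by
  induction k with
  | zero => simpa using const (ι := ι) (n := n) (c := fun _ => 1) (C := 1) (by simp)
  | succ k ih => simpa [pow_succ] using ih.mul hF

lemma inv {n : ℕ} {F : ι → ℝ → ℂ} (hF : UnifSmooth n F) {c : ℝ} (hc : 0 < c)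
    (hlow : ∀ i, ∀ v ∈ Set.Ioo (1 / 4 : ℝ) 4, c ≤ ‖F i v‖) :
    UnifSmooth n fun i v => (F i v)⁻¹ := by
  have hne : ∀ i, ∀ v ∈ Set.Ioo (1 / 4 : ℝ) 4, F i v ≠ 0 := fun i v hv =>
    norm_pos_iff.1 (hc.trans_le (hlow i v hv))
  have hb : ∀ i, ∀ v ∈ Set.Ioo (1 / 4 : ℝ) 4, ‖(F i v)⁻¹‖ ≤ c⁻¹ := fun i v hv => by
    rw [norm_inv]; exact inv_anti₀ hc (hlow i v hv)
  induction n with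
  | zero => exact ⟨fun i => (hF.1 i).inv₀ (hne i), c⁻¹, hb⟩
  | succ n ih =>
    have h1 := ih hF.of_succ
    obtain ⟨-, F', hF', hFn⟩ := hF
    refine succ_intro hb (F' := fun i v => -(F' i v * ((F i v)⁻¹ * (F i v)⁻¹)))
      (fun i v hv => ?_) (hFn.mul (h1.mul h1)).neg
    refine ((hF' i v hv).fun_inv (hne i v hv)).congr_deriv ?_
    field_simp [hne i v hv]

lemma ofReal_id {n : ℕ} : UnifSmooth n fun (_ : ι) (v : ℝ) => (v : ℂ) := by
  have hb : ∀ v ∈ Set.Ioo (1 / 4 : ℝ) 4, ‖(v : ℂ)‖ ≤ 4 := fun v hv => by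
    rw [Complex.norm_real, Real.norm_of_nonneg (by linarith [hv.1])]; exact hv.2.le
  cases n with
  | zero => exact ⟨fun _ => Complex.continuous_ofReal.continuousOn, 4, fun _ => hb⟩
  | succ n =>
    exact succ_intro (fun _ => hb) (fun _ v _ => Complex.ofRealCLM.hasDerivAt)
      (const (c := fun _ => 1) (C := 1) (by simp))

lemma ofReal_inv {n : ℕ} : UnifSmooth n fun (_ : ι) (v : ℝ) => (v : ℂ)⁻¹ :=
  ofReal_id.inv (c := 1 / 4) (by norm_num) fun _ v hv => by
    rw [Complex.norm_real, Real.norm_of_nonneg (by linarith [hv.1])]; exact hv.1.le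

lemma of_contDiff {n : ℕ} {g : ℝ → ℝ} (hg : ContDiff ℝ (⊤ : ℕ∞) g) :
    UnifSmooth n fun (_ : ι) (v : ℝ) => (g v : ℂ) := by
  have hb : ∀ g : ℝ → ℝ, Continuous g →
      ∃ C, ∀ v ∈ Set.Ioo (1 / 4 : ℝ) 4, ‖(g v : ℂ)‖ ≤ C := fun g hg => by
    obtain ⟨C, hC⟩ := (isCompact_Icc (a := (1 / 4 : ℝ)) (b := 4)).exists_bound_of_continuousOn
      hg.continuousOn
    exact ⟨C, fun v hv => by simpa using hC v (Set.Ioo_subset_Icc_self hv)⟩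
  induction n generalizing g with
  | zero =>
    obtain ⟨C, hC⟩ := hb g hg.continuous
    exact ⟨fun _ => (Complex.continuous_ofReal.comp hg.continuous).continuousOn, C, fun _ => hC⟩
  | succ n ih =>
    obtain ⟨C, hC⟩ := hb g hg.continuous
    have hg' : ContDiff ℝ (⊤ : ℕ∞) (deriv g) := (contDiff_infty_iff_deriv.1 hg).2
    exact succ_intro (fun _ => hC)
      (fun _ v _ => ((hg.differentiable (by simp)) v).hasDerivAt.ofReal_comp) (ih hg')

/-- Change of the parameter set. -/
lemma comp {κ : Type*} {n : ℕ} {F : ι → ℝ → ℂ} (hF : UnifSmooth n F) (e : κ → ι) :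
    UnifSmooth n fun k v => F (e k) v := by
  induction n generalizing F with
  | zero => exact ⟨fun k => hF.1 (e k), hF.2.imp fun C hC k => hC (e k)⟩
  | succ n ih =>
    obtain ⟨⟨-, A, hA⟩, F', hF', hFn⟩ := hF
    exact succ_intro (fun k => hA (e k)) (fun k => hF' (e k)) (ih hFn)

end UnifSmooth

/-- Non-stationary phase: an oscillatory integral whose phase has no critical point decays
faster than any power, uniformly in parameters. -/
theorem norm_integral_exp_mul_le_of_nonstationary {ι : Type*} {n : ℕ} {φ : ι → ℝ → ℝ}
    {p : ι → ℝ → ℝ} (hφ : ∀ i, ∀ v ∈ Set.Ioo (1 / 4 : ℝ) 4, HasDerivAt (φ i) (p i v) v)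
    (hp : UnifSmooth n fun i v => (p i v : ℂ)) {c : ℝ} (hc : 0 < c)
    (hlow : ∀ i, ∀ v ∈ Set.Ioo (1 / 4 : ℝ) 4, c ≤ |p i v|)
    {a : ι → ℝ → ℂ} (ha : UnifSmooth n a)
    (hsupp : ∀ i, ∀ v ∉ Set.Icc (3 / 8 : ℝ) 3, a i v = 0) :
    ∃ C, ∀ i, ∀ T : ℝ, 0 < T →
      ‖∫ v in (1 / 3 : ℝ)..(7 / 2), Complex.exp (T * φ i v * I) * a i v‖ ≤ C * (T ^ n)⁻¹ := by
  induction n generalizing a with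
  | zero =>
    obtain ⟨-, C, hC⟩ := ha
    refine ⟨C * |7 / 2 - 1 / 3|, fun i T _ => ?_⟩
    rw [pow_zero, inv_one, mul_one]
    refine intervalIntegral.norm_integral_le_of_norm_le_const fun v hv => ?_
    rw [Set.uIoc_of_le (by norm_num)] at hv
    rw [norm_mul, show (T * φ i v * I : ℂ) = ((T * φ i v : ℝ) : ℂ) * I by push_cast; ring,
      Complex.norm_exp_ofReal_mul_I, one_mul]
    exact hC i v ⟨by linarith [hv.1], by linarith [hv.2]⟩
  | succ n ih =>
    have hpinv := hp.inv hc (fun i v hv => by simpa using hlow i v hv)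
    have hap := ha.mul hpinv
    have hp1 := hp.zero_of
    have ha1 := ha.zero_of
    have hpne : ∀ i, ∀ v ∈ Set.Ioo (1 / 4 : ℝ) 4, (p i v : ℂ) ≠ 0 := fun i v hv => by
      have := hc.trans_le (hlow i v hv)
      exact_mod_cast abs_pos.1 this
    obtain ⟨-, b, hb, hbn⟩ := hap
    have hbs : ∀ i, ∀ v ∉ Set.Icc (3 / 8 : ℝ) 3, (if v ∈ Set.Ioo (1 / 4 : ℝ) 4 then b i v else 0)
        = 0 := fun i v hv => by
      split_ifs with hvU
      · have h1 : HasDerivAt (fun v => a i v * (p i v : ℂ)⁻¹) 0 v := by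
          refine (hasDerivAt_const v (0 : ℂ)).congr_of_eventuallyEq ?_
          filter_upwards [isClosed_Icc.isOpen_compl.mem_nhds hv] with y hy
          rw [hsupp i y hy, zero_mul]
        exact (hb i v hvU).unique h1
      · rfl
    have hbn' : UnifSmooth n fun i v => if v ∈ Set.Ioo (1 / 4 : ℝ) 4 then b i v else 0 := by
      clear ih hb hbs
      have key : ∀ {m : ℕ} {b b' : ι → ℝ → ℂ}, (∀ i, ∀ v ∈ Set.Ioo (1 / 4 : ℝ) 4, b' i v = b i v) →
          UnifSmooth m b → UnifSmooth m b' := by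
        intro m b b' h hm
        have h0 : UnifSmooth 0 b' := ⟨fun i => (hm.zero_of.1 i).congr (h i),
          hm.zero_of.2.imp fun C hC i v hv => by rw [h i v hv]; exact hC i v hv⟩
        cases m with
        | zero => exact h0
        | succ m =>
          obtain ⟨-, F', hF', hn⟩ := hm
          refine ⟨h0, F', fun i v hv => (hF' i v hv).congr_of_eventuallyEq ?_, hn⟩
          filter_upwards [isOpen_Ioo.mem_nhds hv] with y hy using h i y hy
      exact key (fun i v hv => if_pos hv) hbn
    obtain ⟨C, hC⟩ := ih hp.of_succ hbn' hbs
    refine ⟨C, fun i T hT => ?_⟩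
    have hsub : Set.uIcc (1 / 3 : ℝ) (7 / 2) ⊆ Set.Ioo (1 / 4 : ℝ) 4 := by
      rw [Set.uIcc_of_le (by norm_num)]
      exact fun v hv => ⟨by linarith [hv.1], by linarith [hv.2]⟩
    have hexp : ∀ v ∈ Set.Ioo (1 / 4 : ℝ) 4, HasDerivAt (fun v => Complex.exp (T * φ i v * I))
        (Complex.exp (T * φ i v * I) * (T * p i v * I)) v := fun v hv =>
      (((hφ i v hv).ofReal_comp.const_mul (T : ℂ)).mul_const I).cexp
    have hexpc : ContinuousOn (fun v => Complex.exp (T * φ i v * I)) (Set.Ioo (1 / 4 : ℝ) 4) :=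
      fun v hv => (hexp v hv).continuousAt.continuousWithinAt
    have hibp := intervalIntegral.integral_mul_deriv_eq_deriv_mul
      (a := (1 / 3 : ℝ)) (b := 7 / 2)
      (u := fun v => a i v * (p i v : ℂ)⁻¹) (v := fun v => Complex.exp (T * φ i v * I))
      (fun v hv => hb i v (hsub hv)) (fun v hv => hexp v (hsub hv))
      (ContinuousOn.intervalIntegrable ((hbn.zero_of.1 i).mono hsub))
      (ContinuousOn.intervalIntegrable (ContinuousOn.mono (hexpc.mul
        ((continuousOn_const.mul (hp1.1 i)).mul continuousOn_const)) hsub))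
    have e1 : ∫ v in (1 / 3 : ℝ)..(7 / 2), a i v * (p i v : ℂ)⁻¹ *
        (Complex.exp (T * φ i v * I) * (T * p i v * I)) =
        (T * I) * ∫ v in (1 / 3 : ℝ)..(7 / 2), Complex.exp (T * φ i v * I) * a i v := by
      rw [← intervalIntegral.integral_const_mul]
      refine intervalIntegral.integral_congr fun v hv => ?_
      have := hpne i v (hsub hv)
      field_simp
    have e2 : ∫ v in (1 / 3 : ℝ)..(7 / 2), b i v * Complex.exp (T * φ i v * I) =
        ∫ v in (1 / 3 : ℝ)..(7 / 2), Complex.exp (T * φ i v * I) *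
          (if v ∈ Set.Ioo (1 / 4 : ℝ) 4 then b i v else 0) := by
      refine intervalIntegral.integral_congr fun v hv => ?_
      simp only [if_pos (hsub hv), mul_comm]
    rw [e1, e2, hsupp i (1 / 3) (by norm_num), hsupp i (7 / 2) (by norm_num)] at hibp
    simp only [zero_mul, sub_self, zero_sub] at hibp
    have hn := congrArg norm hibp
    rw [norm_mul, norm_neg, norm_mul, Complex.norm_I, mul_one, Complex.norm_real,
      Real.norm_of_nonneg hT.le] at hn
    have := hC i T hT
    rw [← hn] at this
    rw [pow_succ, mul_inv, ← mul_assoc, ← div_eq_mul_inv (C * (T ^ n)⁻¹), le_div_iff₀ hT, mul_comm]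
    exact this

/-- `k(r) = 2 r / sinh (2 r)`. -/
def symK (r : ℝ) : ℝ := 2 * r / Real.sinh (2 * r)

/-- `c(r) = 2 r coth (2 r)`. -/
def symC (r : ℝ) : ℝ := 2 * r * Real.cosh (2 * r) / Real.sinh (2 * r)

/-- `u(r) = βr² / (1 + βr²)`. -/
def symU (β r : ℝ) : ℝ := β * r ^ 2 / (1 + β * r ^ 2)

/-- The logarithmic derivative `r m'(r) / m(r)` of the symbol. -/
def symH (β r : ℝ) : ℝ := (1 + 2 * symU β r + symK r) / 2

lemma sinh_two_mul_pos {r : ℝ} (hr : 0 < r) : 0 < Real.sinh (2 * r) :=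
  Real.sinh_pos_iff.2 (by linarith)

lemma symK_pos {r : ℝ} (hr : 0 < r) : 0 < symK r :=
  div_pos (by linarith) (sinh_two_mul_pos hr)

lemma symK_le_one {r : ℝ} (hr : 0 < r) : symK r ≤ 1 :=
  (div_le_one (sinh_two_mul_pos hr)).2 (Real.self_le_sinh_iff.2 (by linarith))

lemma symC_nonneg {r : ℝ} (hr : 0 < r) : 0 ≤ symC r :=
  div_nonneg (mul_nonneg (by linarith) (Real.cosh_pos _).le) (sinh_two_mul_pos hr).le

lemma symC_le {r : ℝ} (hr : 0 < r) : symC r ≤ 1 + 2 * r := by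
  rw [symC, div_le_iff₀ (sinh_two_mul_pos hr)]
  have h1 : 2 * r ≤ Real.sinh (2 * r) := Real.self_le_sinh_iff.2 (by linarith)
  have h2 := Real.cosh_sub_sinh (2 * r)
  have h3 : Real.exp (-(2 * r)) ≤ 1 := Real.exp_le_one_iff.2 (by linarith)
  nlinarith

lemma symK_le_exp {r : ℝ} (hr : 0 < r) :
    symK r ≤ 2 * (1 + 2 * r) * Real.exp (-(2 * r)) := by
  rw [symK, div_le_iff₀ (sinh_two_mul_pos hr), Real.sinh_eq]
  set E := Real.exp (2 * r)
  have hE : 1 + 2 * r ≤ E := by simpa [add_comm] using Real.add_one_le_exp (2 * r)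
  have h1 : Real.exp (-(2 * r)) * E = 1 := by rw [← Real.exp_add]; simp
  set e := Real.exp (-(2 * r))
  have he : 0 < e := Real.exp_pos _
  have : (1 + 2 * r) * e ≤ 1 := by nlinarith
  have : e ≤ 1 := Real.exp_le_one_iff.2 (by linarith)
  nlinarith

lemma symK_mul_pow_symC_le (j : ℕ) {r : ℝ} (hr : 0 < r) :
    symK r * symC r ^ j ≤ 2 * ((j + 1).factorial * Real.exp 1) := by
  have h1 : symC r ^ j ≤ (1 + 2 * r) ^ j := pow_le_pow_left₀ (symC_nonneg hr) (symC_le hr) j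
  have h2 := Real.pow_div_factorial_le_exp (1 + 2 * r) (by linarith) (j + 1)
  rw [div_le_iff₀ (by positivity), Real.exp_add] at h2
  have h3 : Real.exp (2 * r) * Real.exp (-(2 * r)) = 1 := by rw [← Real.exp_add]; simp
  calc symK r * symC r ^ j ≤ 2 * (1 + 2 * r) * Real.exp (-(2 * r)) * (1 + 2 * r) ^ j :=
        mul_le_mul (symK_le_exp hr) h1 (pow_nonneg (symC_nonneg hr) _) (by positivity)
    _ = 2 * ((1 + 2 * r) ^ (j + 1) * Real.exp (-(2 * r))) := by ring
    _ ≤ 2 * (Real.exp 1 * Real.exp (2 * r) * (j + 1).factorial * Real.exp (-(2 * r))) := by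
        gcongr
    _ = 2 * ((j + 1).factorial * Real.exp 1) *
          (Real.exp (2 * r) * Real.exp (-(2 * r))) := by ring
    _ = _ := by rw [h3, mul_one]

lemma hasDerivAt_symK {r : ℝ} (hr : 0 < r) :
    HasDerivAt symK (symK r * (1 - symC r) / r) r := by
  have hs := (sinh_two_mul_pos hr).ne'
  have h2 : HasDerivAt (fun r : ℝ => 2 * r) 2 r := by simpa using (hasDerivAt_id r).const_mul 2
  refine (h2.div h2.sinh hs).congr_deriv ?_
  rw [symK, symC]
  field_simp

lemma hasDerivAt_symC {r : ℝ} (hr : 0 < r) :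
    HasDerivAt symC ((symC r - symK r ^ 2) / r) r := by
  have hs := (sinh_two_mul_pos hr).ne'
  have h2 : HasDerivAt (fun r : ℝ => 2 * r) 2 r := by simpa using (hasDerivAt_id r).const_mul 2
  refine ((h2.mul h2.cosh).div h2.sinh hs).congr_deriv ?_
  rw [symK, symC]
  have := Real.cosh_sq (2 * r)
  simp only [Pi.mul_apply]
  field_simp
  linear_combination (-2 * r) * this

lemma one_add_mul_sq_pos {β : ℝ} (hβ : 0 ≤ β) (r : ℝ) : 0 < 1 + β * r ^ 2 := by positivity

lemma symU_nonneg {β : ℝ} (hβ : 0 ≤ β) (r : ℝ) : 0 ≤ symU β r := by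
  unfold symU; positivity

lemma symU_le_one {β : ℝ} (hβ : 0 ≤ β) (r : ℝ) : symU β r ≤ 1 :=
  (div_le_one (one_add_mul_sq_pos hβ r)).2 (by linarith)

lemma hasDerivAt_symU {β : ℝ} (hβ : 0 ≤ β) {r : ℝ} (hr : 0 < r) :
    HasDerivAt (symU β) (2 * symU β r * (1 - symU β r) / r) r := by
  have hs := (one_add_mul_sq_pos hβ r).ne'
  have h2 : HasDerivAt (fun r : ℝ => β * r ^ 2) (β * (2 * r)) r := by
    simpa using (hasDerivAt_pow 2 r).const_mul β
  refine (h2.div (h2.const_add 1) hs).congr_deriv ?_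
  rw [symU]
  field_simp

lemma symH_ge {β : ℝ} (hβ : 0 ≤ β) {r : ℝ} (hr : 0 < r) : 1 / 2 ≤ symH β r := by
  have := symU_nonneg hβ r
  have := symK_pos hr
  unfold symH; linarith

lemma symH_le {β : ℝ} (hβ : 0 ≤ β) {r : ℝ} (hr : 0 < r) : symH β r ≤ 2 := by
  have := symU_le_one hβ r
  have := symK_le_one hr
  unfold symH; linarith

lemma hasDerivAt_symH {β : ℝ} (hβ : 0 ≤ β) {r : ℝ} (hr : 0 < r) :
    HasDerivAt (symH β)
      ((2 * symU β r * (1 - symU β r) + symK r * (1 - symC r) / 2) / r) r := by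
  refine ((((hasDerivAt_symU hβ hr).const_mul 2).const_add 1).add
    (hasDerivAt_symK hr)).div_const 2 |>.congr_deriv ?_
  field_simp

lemma tanh_pos_of_pos {r : ℝ} (hr : 0 < r) : 0 < Real.tanh r := by
  rw [Real.tanh_eq_sinh_div_cosh]
  exact div_pos (Real.sinh_pos_iff.2 hr) (Real.cosh_pos r)

lemma mSymb_pos {β : ℝ} (hβ : 0 ≤ β) {r : ℝ} (hr : 0 < r) : 0 < mSymb β r := by
  have := tanh_pos_of_pos hr
  exact Real.sqrt_pos.2 (by positivity)

lemma hasDerivAt_mSymb {β : ℝ} (hβ : 0 ≤ β) {r : ℝ} (hr : 0 < r) :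
    HasDerivAt (mSymb β) (mSymb β r * symH β r / r) r := by
  have ht := tanh_pos_of_pos hr
  have hs := Real.sinh_pos_iff.2 hr
  have hc := Real.cosh_pos r
  have hpos : 0 < r * (1 + β * r ^ 2) * Real.tanh r := by positivity
  have h2 : HasDerivAt (fun r : ℝ => β * r ^ 2) (β * (2 * r)) r := by
    simpa using (hasDerivAt_pow 2 r).const_mul β
  have h3 : HasDerivAt Real.tanh (1 / Real.cosh r ^ 2) r := by
    have h := (Real.hasDerivAt_sinh r).div (Real.hasDerivAt_cosh r) hc.ne'
    have e : Real.tanh = fun x => Real.sinh x / Real.cosh x := funext Real.tanh_eq_sinh_div_cosh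
    rw [e]
    refine h.congr_deriv ?_
    congr 1
    nlinarith [Real.cosh_sq r]
  have h := (((hasDerivAt_id r).mul (h2.const_add 1)).mul h3).sqrt hpos.ne'
  refine h.congr_deriv ?_
  have hm : 0 < √(r * (1 + β * r ^ 2) * Real.tanh r) := Real.sqrt_pos.2 hpos
  simp only [Pi.mul_apply, id]
  rw [div_eq_iff (by positivity)]
  have hq := Real.sq_sqrt hpos.le
  have hb := one_add_mul_sq_pos hβ r
  rw [mSymb, symH, symK, symU, Real.sinh_two_mul]
  have : √(r * (1 + β * r ^ 2) * Real.tanh r) * ((1 + 2 * (β * r ^ 2 / (1 + β * r ^ 2)) +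
      2 * r / (2 * Real.sinh r * Real.cosh r)) / 2) / r *
      (2 * √(r * (1 + β * r ^ 2) * Real.tanh r)) =
      √(r * (1 + β * r ^ 2) * Real.tanh r) ^ 2 * ((1 + 2 * (β * r ^ 2 / (1 + β * r ^ 2)) +
      2 * r / (2 * Real.sinh r * Real.cosh r))) / r := by ring
  rw [this, hq, Real.tanh_eq_sinh_div_cosh]
  field_simp

/-- The normalised phase `m(λv) / m(λ)`. -/
def phase (β lam v : ℝ) : ℝ := mSymb β (lam * v) / mSymb β lam

lemma phase_pos {β : ℝ} (hβ : 0 ≤ β) {lam v : ℝ} (hl : 0 < lam) (hv : 0 < v) :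
    0 < phase β lam v := div_pos (mSymb_pos hβ (mul_pos hl hv)) (mSymb_pos hβ hl)

lemma phase_one {β : ℝ} (hβ : 0 ≤ β) {lam : ℝ} (hl : 0 < lam) : phase β lam 1 = 1 := by
  rw [phase, mul_one, div_self (mSymb_pos hβ hl).ne']

lemma hasDerivAt_phase {β : ℝ} (hβ : 0 ≤ β) {lam v : ℝ} (hl : 0 < lam) (hv : 0 < v) :
    HasDerivAt (phase β lam) (phase β lam v * symH β (lam * v) / v) v := by
  have h := ((hasDerivAt_mSymb hβ (mul_pos hl hv)).comp v
    ((hasDerivAt_id v).const_mul lam)).div_const (mSymb β lam)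
  refine h.congr_deriv ?_
  rw [phase]
  field_simp

lemma hasDerivAt_comp_mul {g : ℝ → ℝ} {D lam v : ℝ} (hl : 0 < lam) (hv : 0 < v)
    (h : HasDerivAt g (D / (lam * v)) (lam * v)) :
    HasDerivAt (fun v => g (lam * v)) (D / v) v := by
  refine (h.comp v ((hasDerivAt_id v).const_mul lam)).congr_deriv ?_
  field_simp

lemma phase_mono {β : ℝ} (hβ : 0 ≤ β) {lam : ℝ} (hl : 0 < lam) :
    MonotoneOn (phase β lam) (Set.Ioi 0) := by
  refine monotoneOn_of_deriv_nonneg (convex_Ioi 0)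
    (fun v hv => (hasDerivAt_phase hβ hl hv).continuousAt.continuousWithinAt)
    (fun v hv => ?_) fun v hv => ?_ <;> rw [interior_Ioi] at hv
  · exact (hasDerivAt_phase hβ hl hv).differentiableAt.differentiableWithinAt
  · rw [(hasDerivAt_phase hβ hl hv).deriv]
    have h1 := phase_pos hβ hl hv
    have h2 := symH_ge hβ (mul_pos hl hv)
    have hv' : (0 : ℝ) < v := hv
    have h3 : 0 ≤ symH β (lam * v) := by linarith
    positivity

lemma phase_div_sq_anti {β : ℝ} (hβ : 0 ≤ β) {lam : ℝ} (hl : 0 < lam) :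
    AntitoneOn (fun v => phase β lam v / v ^ 2) (Set.Ioi 0) := by
  have hd : ∀ v : ℝ, 0 < v → HasDerivAt (fun v => phase β lam v / v ^ 2)
      (phase β lam v * (symH β (lam * v) - 2) / v ^ 3) v := fun v hv => by
    refine ((hasDerivAt_phase hβ hl hv).div (hasDerivAt_pow 2 v) (by positivity)).congr_deriv ?_
    field_simp
    ring
  refine antitoneOn_of_deriv_nonpos (convex_Ioi 0)
    (fun v hv => (hd v hv).continuousAt.continuousWithinAt)
    (fun v hv => ?_) fun v hv => ?_ <;> rw [interior_Ioi] at hv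
  · exact (hd v hv).differentiableAt.differentiableWithinAt
  · rw [(hd v hv).deriv]
    have h1 := phase_pos hβ hl hv
    have h2 := symH_le hβ (mul_pos hl hv)
    have hv' : (0 : ℝ) < v := hv
    exact div_nonpos_of_nonpos_of_nonneg (mul_nonpos_of_nonneg_of_nonpos h1.le (by linarith))
      (by positivity)

lemma phase_bounds {β : ℝ} (hβ : 0 ≤ β) {lam v : ℝ} (hl : 0 < lam)
    (hv : v ∈ Set.Ioo (1 / 4 : ℝ) 4) : 1 / 16 ≤ phase β lam v ∧ phase β lam v ≤ 16 := by
  have hv0 : 0 < v := by linarith [hv.1]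
  have h1 := phase_one hβ hl
  have h01 : (1 : ℝ) ∈ Set.Ioi (0 : ℝ) := Set.mem_Ioi.2 one_pos
  rcases le_total v 1 with h | h
  · have a := phase_mono hβ hl hv0 h01 h
    have b := phase_div_sq_anti hβ hl hv0 h01 h
    simp only [h1, one_pow, div_one] at b
    rw [le_div_iff₀ (by positivity)] at b
    rw [h1] at a
    exact ⟨by nlinarith [hv.1], by linarith⟩
  · have a := phase_mono hβ hl h01 hv0 h
    have b := phase_div_sq_anti hβ hl h01 hv0 h
    simp only [h1, one_pow, div_one] at b
    rw [div_le_iff₀ (by positivity)] at b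
    rw [h1] at a
    exact ⟨by linarith, by nlinarith [hv.2]⟩

lemma unifSmooth_symK_pow_mul (n i j : ℕ) :
    UnifSmooth n fun (lam : Set.Ioi (0 : ℝ)) (v : ℝ) =>
      ((symK (lam * v) ^ (i + 1) * symC (lam * v) ^ j : ℝ) : ℂ) := by
  have hpos : ∀ (lam : Set.Ioi (0 : ℝ)) (v : ℝ), v ∈ Set.Ioo (1 / 4 : ℝ) 4 →
      0 < (lam : ℝ) ∧ 0 < v ∧ 0 < (lam : ℝ) * v := fun lam v hv => by
    have h1 : (0 : ℝ) < lam := lam.2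
    have h2 : 0 < v := by linarith [hv.1]
    exact ⟨h1, h2, mul_pos h1 h2⟩
  have hb : ∀ (i j : ℕ) (lam : Set.Ioi (0 : ℝ)), ∀ v ∈ Set.Ioo (1 / 4 : ℝ) 4,
      ‖((symK (lam * v) ^ (i + 1) * symC (lam * v) ^ j : ℝ) : ℂ)‖ ≤
        2 * ((j + 1).factorial * Real.exp 1) := fun i j lam v hv => by
    obtain ⟨-, -, h⟩ := hpos lam v hv
    have hk := symK_pos h
    have hc := symC_nonneg h
    rw [Complex.norm_real, Real.norm_of_nonneg (by positivity)]
    refine le_trans ?_ (symK_mul_pow_symC_le j h)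
    refine mul_le_mul_of_nonneg_right ?_ (by positivity)
    exact pow_le_of_le_one hk.le (symK_le_one h) (by omega)
  have hd : ∀ (i j : ℕ) (lam : Set.Ioi (0 : ℝ)), ∀ v ∈ Set.Ioo (1 / 4 : ℝ) 4,
      HasDerivAt (fun v : ℝ => ((symK (lam * v) ^ (i + 1) * symC (lam * v) ^ j : ℝ) : ℂ))
        ((v : ℂ)⁻¹ * ((i + 1 : ℂ) * (((symK (lam * v) ^ (i + 1) * symC (lam * v) ^ j : ℝ) : ℂ) -
          ((symK (lam * v) ^ (i + 1) * symC (lam * v) ^ (j + 1) : ℝ) : ℂ)) +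
          (j : ℂ) * (((symK (lam * v) ^ (i + 1) * symC (lam * v) ^ j : ℝ) : ℂ) -
          ((symK (lam * v) ^ (i + 2 + 1) * symC (lam * v) ^ (j - 1) : ℝ) : ℂ)))) v :=
      fun i j lam v hv => by
    obtain ⟨h1, h2, h⟩ := hpos lam v hv
    have hk := (hasDerivAt_comp_mul h1 h2 (hasDerivAt_symK h)).pow (i + 1)
    have hc := (hasDerivAt_comp_mul h1 h2 (hasDerivAt_symC h)).pow j
    refine (hk.mul hc).ofReal_comp.congr_deriv ?_
    have hv0 : (v : ℂ) ≠ 0 := by exact_mod_cast h2.ne'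
    cases j with
    | zero => simp [pow_succ]; field_simp
    | succ j => simp [pow_succ]; field_simp
  induction n generalizing i j with
  | zero =>
    exact ⟨fun lam v hv => (hd i j lam v hv).continuousAt.continuousWithinAt, _, hb i j⟩
  | succ n ih =>
    exact UnifSmooth.succ_intro (hb i j) (hd i j) (UnifSmooth.ofReal_inv.mul
      ((((ih i j).sub (ih i (j + 1))).const_mul _).add
        (((ih i j).sub (ih (i + 2) (j - 1))).const_mul _)))

lemma unifSmooth_symU {β : ℝ} (hβ : 0 ≤ β) (n : ℕ) :
    UnifSmooth n fun (lam : Set.Ioi (0 : ℝ)) (v : ℝ) => ((symU β (lam * v) : ℝ) : ℂ) := by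
  have hb : ∀ (lam : Set.Ioi (0 : ℝ)), ∀ v ∈ Set.Ioo (1 / 4 : ℝ) 4,
      ‖((symU β (lam * v) : ℝ) : ℂ)‖ ≤ 1 := fun lam v _ => by
    rw [Complex.norm_real, Real.norm_of_nonneg (symU_nonneg hβ _)]
    exact symU_le_one hβ _
  have hd : ∀ (lam : Set.Ioi (0 : ℝ)), ∀ v ∈ Set.Ioo (1 / 4 : ℝ) 4,
      HasDerivAt (fun v : ℝ => ((symU β (lam * v) : ℝ) : ℂ))
        ((v : ℂ)⁻¹ * (2 * (((symU β (lam * v) : ℝ) : ℂ) -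
          ((symU β (lam * v) : ℝ) : ℂ) * ((symU β (lam * v) : ℝ) : ℂ)))) v := fun lam v hv => by
    have h1 : (0 : ℝ) < lam := lam.2
    have h2 : 0 < v := by linarith [hv.1]
    refine (hasDerivAt_comp_mul h1 h2
      (hasDerivAt_symU hβ (mul_pos h1 h2))).ofReal_comp.congr_deriv ?_
    push_cast
    ring
  induction n with
  | zero =>
    exact ⟨fun lam v hv => (hd lam v hv).continuousAt.continuousWithinAt, _, hb⟩
  | succ n ih =>
    exact UnifSmooth.succ_intro hb hd (UnifSmooth.ofReal_inv.mul ((ih.sub (ih.mul ih)).const_mul 2))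

lemma unifSmooth_symH {β : ℝ} (hβ : 0 ≤ β) (n : ℕ) :
    UnifSmooth n fun (lam : Set.Ioi (0 : ℝ)) (v : ℝ) => ((symH β (lam * v) : ℝ) : ℂ) := by
  have h1 : UnifSmooth n fun (_ : Set.Ioi (0 : ℝ)) (_ : ℝ) => (1 / 2 : ℂ) :=
    UnifSmooth.const (C := ‖(1 / 2 : ℂ)‖) fun _ => le_rfl
  have h := (h1.add (unifSmooth_symU hβ n)).add
    ((unifSmooth_symK_pow_mul n 0 0).const_mul (1 / 2))
  convert h using 3 with lam v
  rw [symH]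
  push_cast
  ring

lemma unifSmooth_phase {β : ℝ} (hβ : 0 ≤ β) (n : ℕ) :
    UnifSmooth n fun (lam : Set.Ioi (0 : ℝ)) (v : ℝ) => ((phase β lam v : ℝ) : ℂ) := by
  have hb : ∀ (lam : Set.Ioi (0 : ℝ)), ∀ v ∈ Set.Ioo (1 / 4 : ℝ) 4,
      ‖((phase β lam v : ℝ) : ℂ)‖ ≤ 16 := fun lam v hv => by
    have h := phase_bounds hβ lam.2 hv
    rw [Complex.norm_real, Real.norm_of_nonneg (by linarith [h.1])]
    exact h.2
  have hd : ∀ (lam : Set.Ioi (0 : ℝ)), ∀ v ∈ Set.Ioo (1 / 4 : ℝ) 4,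
      HasDerivAt (fun v : ℝ => ((phase β lam v : ℝ) : ℂ))
        ((v : ℂ)⁻¹ * (((phase β lam v : ℝ) : ℂ) * ((symH β (lam * v) : ℝ) : ℂ))) v :=
      fun lam v hv => by
    refine (hasDerivAt_phase hβ lam.2 (by linarith [hv.1])).ofReal_comp.congr_deriv ?_
    push_cast
    ring
  induction n with
  | zero =>
    exact ⟨fun lam v hv => (hd lam v hv).continuousAt.continuousWithinAt, _, hb⟩
  | succ n ih =>
    exact UnifSmooth.succ_intro hb hd (UnifSmooth.ofReal_inv.mul (ih.mul (unifSmooth_symH hβ n)))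

/-- The derivative of the normalised phase. -/
def phaseDeriv (β lam v : ℝ) : ℝ := phase β lam v * symH β (lam * v) / v

lemma unifSmooth_phaseDeriv {β : ℝ} (hβ : 0 ≤ β) (n : ℕ) :
    UnifSmooth n fun (lam : Set.Ioi (0 : ℝ)) (v : ℝ) => ((phaseDeriv β lam v : ℝ) : ℂ) := by
  convert UnifSmooth.ofReal_inv.mul ((unifSmooth_phase hβ n).mul (unifSmooth_symH hβ n))
    using 3 with lam v
  rw [phaseDeriv]
  push_cast
  ring

lemma phaseDeriv_ge {β : ℝ} (hβ : 0 ≤ β) {lam v : ℝ} (hl : 0 < lam)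
    (hv : v ∈ Set.Ioo (1 / 4 : ℝ) 4) : 1 / 128 ≤ phaseDeriv β lam v := by
  have hv0 : 0 < v := by linarith [hv.1]
  have h1 := (phase_bounds hβ hl hv).1
  have h2 := symH_ge hβ (mul_pos hl hv0)
  rw [phaseDeriv, le_div_iff₀ hv0]
  nlinarith [hv.2]

/-- `r² m''(r) / m(r)`. -/
def symG (β r : ℝ) : ℝ :=
  symH β r ^ 2 - symH β r + (2 * symU β r * (1 - symU β r) + symK r * (1 - symC r) / 2)

lemma hasDerivAt_phaseDeriv {β : ℝ} (hβ : 0 ≤ β) {lam v : ℝ} (hl : 0 < lam) (hv : 0 < v) :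
    HasDerivAt (phaseDeriv β lam) (phase β lam v * symG β (lam * v) / v ^ 2) v := by
  have h := ((hasDerivAt_phase hβ hl hv).mul
    (hasDerivAt_comp_mul hl hv (hasDerivAt_symH hβ (mul_pos hl hv)))).div (hasDerivAt_id v) hv.ne'
  refine h.congr_deriv ?_
  rw [symG]
  simp only [Pi.mul_apply, id]
  field_simp
  ring

lemma sinh_le_mul_cosh {x : ℝ} (hx : 0 ≤ x) : Real.sinh x ≤ x * Real.cosh x := by
  have hd : ∀ x : ℝ, HasDerivAt (fun x => x * Real.cosh x - Real.sinh x) (x * Real.sinh x) x :=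
    fun x => (((hasDerivAt_id x).mul (Real.hasDerivAt_cosh x)).sub
      (Real.hasDerivAt_sinh x)).congr_deriv (by simp)
  have hm : MonotoneOn (fun x => x * Real.cosh x - Real.sinh x) (Set.Ici 0) := by
    refine monotoneOn_of_deriv_nonneg (convex_Ici 0)
      (fun v _ => (hd v).continuousAt.continuousWithinAt)
      (fun v _ => (hd v).differentiableAt.differentiableWithinAt) fun v hv => ?_
    rw [interior_Ici] at hv
    rw [(hd v).deriv]
    exact mul_nonneg (le_of_lt hv) (Real.sinh_nonneg_iff.2 (le_of_lt hv))
  have := hm Set.self_mem_Ici hx hx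
  simp only [zero_mul, Real.sinh_zero, sub_zero] at this
  linarith

lemma one_add_sq_half_le_cosh (x : ℝ) : 1 + x ^ 2 / 2 ≤ Real.cosh x := by
  have h := sum_le_hasSum (Finset.range 2) (fun n _ => by
    rw [pow_mul]; positivity) (Real.hasSum_cosh x)
  simpa [Finset.sum_range_succ] using h

lemma self_add_cube_le_sinh {x : ℝ} (hx : 0 ≤ x) : x + x ^ 3 / 6 ≤ Real.sinh x := by
  have h := sum_le_hasSum (Finset.range 2) (fun n _ => by positivity) (Real.hasSum_sinh x)
  norm_num [Finset.sum_range_succ, Nat.factorial] at h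
  exact h

lemma symK_le_rational {r : ℝ} (hr : 0 < r) : symK r ≤ 1 - 2 / 3 * (r ^ 2 / (1 + r ^ 2)) := by
  have h : 2 * r + (2 * r) ^ 3 / 6 ≤ Real.sinh (2 * r) :=
    self_add_cube_le_sinh (by linarith)
  rw [symK]
  calc 2 * r / Real.sinh (2 * r) ≤ 2 * r / (2 * r + (2 * r) ^ 3 / 6) := by gcongr
    _ ≤ _ := by
      rw [div_le_iff₀ (by positivity)]
      field_simp
      nlinarith [pow_pos hr 3, pow_pos hr 5]

lemma one_le_symC {r : ℝ} (hr : 0 < r) : 1 ≤ symC r := by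
  rw [symC, one_le_div (sinh_two_mul_pos hr)]
  exact sinh_le_mul_cosh (by linarith)

lemma symG_zero_le {r : ℝ} (hr : 0 < r) : symG 0 r ≤ -(1 / 6 * (r ^ 2 / (1 + r ^ 2))) := by
  have h1 := symK_le_rational hr
  have h2 := symK_pos hr
  have h3 := one_le_symC hr
  have h4 := symK_le_one hr
  have e : symG 0 r = -((1 - symK r ^ 2) / 4 + symK r * (symC r - 1) / 2) := by
    simp only [symG, symH, symU]; ring
  rw [e]
  have : 0 ≤ symK r * (symC r - 1) := mul_nonneg h2.le (by linarith)
  nlinarith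

lemma symK_ge {r : ℝ} (hr : 0 < r) : 1 - r ^ 2 ≤ symK r := by
  rcases le_total (1 - r ^ 2) 0 with h | h
  · exact h.trans (symK_pos hr).le
  have hs := Real.sinh_pos_iff.2 hr
  have hc := Real.cosh_pos r
  have h1 := sinh_le_mul_cosh hr.le
  rw [symK, le_div_iff₀ (sinh_two_mul_pos hr), Real.sinh_two_mul]
  have h2 : Real.cosh r ^ 2 * (1 - r ^ 2) ≤ 1 := by
    have := Real.cosh_sq r
    have := pow_le_pow_left₀ hs.le h1 2
    nlinarith
  have h3 : (1 - r ^ 2) * (Real.sinh r * Real.cosh r) ≤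
      (1 - r ^ 2) * (r * Real.cosh r * Real.cosh r) := by gcongr
  nlinarith

lemma symG_one_eq {r : ℝ} (hr : 0 < r) : symG 1 r = symU 1 r * symK r +
    2 * symU 1 r - symU 1 r ^ 2 - ((1 - symK r) ^ 2 / 4 + r ^ 2 / Real.cosh r ^ 2) := by
  have hs := Real.sinh_pos_iff.2 hr
  have hc := Real.cosh_pos r
  have key : symK r * symC r = symK r ^ 2 + 2 * (r ^ 2 / Real.cosh r ^ 2) := by
    rw [symK, symC, Real.sinh_two_mul, Real.cosh_two_mul]
    field_simp
    linear_combination Real.cosh_sq r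
  simp only [symG, symH]
  linear_combination (-1 / 2) * key

lemma le_symG_one {r : ℝ} (hr : 0 < r) : 1 / 10 * (r ^ 2 / (1 + r ^ 2)) ≤ symG 1 r := by
  have hk := symK_pos hr
  have hk1 := symK_le_one hr
  have hk2 := symK_ge hr
  have hu : symU 1 r = r ^ 2 / (1 + r ^ 2) := by simp [symU]
  have hcosh : 1 + r ^ 2 / 2 ≤ Real.cosh r := one_add_sq_half_le_cosh r
  have h1 : r ^ 2 / Real.cosh r ^ 2 ≤ r ^ 2 / (1 + r ^ 2 / 2) ^ 2 := by gcongr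
  rw [symG_one_eq hr, hu]
  have hy : 0 < r ^ 2 := by positivity
  have h0 : 0 ≤ r ^ 2 / (1 + r ^ 2) * symK r := by positivity
  set y := r ^ 2
  suffices h : 1 / 10 * (y / (1 + y)) ≤ 2 * (y / (1 + y)) - (y / (1 + y)) ^ 2 -
      ((1 - symK r) ^ 2 / 4 + y / (1 + y / 2) ^ 2) by linarith
  rcases le_total y 1 with hle | hle
  · have : (1 - symK r) ^ 2 ≤ y ^ 2 := by nlinarith
    suffices h : 1 / 10 * (y / (1 + y)) ≤ 2 * (y / (1 + y)) - (y / (1 + y)) ^ 2 -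
      (y ^ 2 / 4 + y / (1 + y / 2) ^ 2) by linarith
    rw [← sub_nonneg]
    have e : 2 * (y / (1 + y)) - (y / (1 + y)) ^ 2 - (y ^ 2 / 4 + y / (1 + y / 2) ^ 2) -
      1 / 10 * (y / (1 + y)) = y * (20 * (2 + y) ^ 3 - 80 * (1 + y) ^ 2 -
        5 * y * (1 + y) ^ 2 * (2 + y) ^ 2 - 2 * (1 + y) * (2 + y) ^ 2) /
        (20 * (1 + y) ^ 2 * (2 + y) ^ 2) := by
      field_simp
      ring
    rw [e]
    refine div_nonneg (mul_nonneg hy.le ?_) (by positivity)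
    obtain ⟨z, hz⟩ : ∃ z, y = 1 - z := ⟨1 - y, by ring⟩
    have hz0 : 0 ≤ z := by linarith
    have hz1 : z ≤ 1 := by linarith
    have h2 : 0 ≤ z * (302 - 401 * z + 162 * z ^ 2) :=
      mul_nonneg hz0 (by nlinarith [sq_nonneg (324 * z - 401)])
    have h3 : 0 ≤ z ^ 3 * (1 - z) := mul_nonneg (by positivity) (by linarith)
    have h4 : 0 ≤ z ^ 5 := by positivity
    rw [hz]
    nlinarith
  · have : (1 - symK r) ^ 2 ≤ 1 := by nlinarith
    suffices h : 1 / 10 * (y / (1 + y)) ≤ 2 * (y / (1 + y)) - (y / (1 + y)) ^ 2 -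
      (1 / 4 + y / (1 + y / 2) ^ 2) by linarith
    rw [← sub_nonneg]
    obtain ⟨z, hz⟩ : ∃ z, y = 1 + z := ⟨y - 1, by ring⟩
    have hz0 : 0 ≤ z := by linarith
    have e : 2 * (y / (1 + y)) - (y / (1 + y)) ^ 2 - (1 / 4 + y / (1 + y / 2) ^ 2) -
      1 / 10 * (y / (1 + y)) = (4 + 62 * z + 77 * z ^ 2 + 52 * z ^ 3 + 13 * z ^ 4) /
        (20 * (1 + y) ^ 2 * (2 + y) ^ 2) := by
      rw [show 1 + y / 2 = (2 + y) / 2 by ring, eq_div_iff (by positivity)]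
      field_simp
      rw [hz]
      ring
    rw [e]
    positivity

lemma phase_second_deriv_bounds {β : ℝ} (hβ : β = 0 ∨ β = 1) : ∃ c > 0, ∀ lam > (0 : ℝ),
    (∀ v ∈ Set.Ioo (1 / 4 : ℝ) 4,
      c * (lam ^ 2 / (1 + lam ^ 2)) ≤ phase β lam v * symG β (lam * v) / v ^ 2) ∨
    (∀ v ∈ Set.Ioo (1 / 4 : ℝ) 4,
      c * (lam ^ 2 / (1 + lam ^ 2)) ≤ -(phase β lam v * symG β (lam * v) / v ^ 2)) := by
  have hβ0 : 0 ≤ β := by rcases hβ with rfl | rfl <;> norm_num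
  have key : ∀ lam > (0 : ℝ), ∀ v ∈ Set.Ioo (1 / 4 : ℝ) 4, ∀ g : ℝ,
      1 / 10 * ((lam * v) ^ 2 / (1 + (lam * v) ^ 2)) ≤ g →
      1 / 40960 * (lam ^ 2 / (1 + lam ^ 2)) ≤ phase β lam v * g / v ^ 2 := by
    intro lam hl v hv g hg
    have hv0 : 0 < v := by linarith [hv.1]
    have h1 := (phase_bounds hβ0 hl hv).1
    have h2 : 1 / 160 * (lam ^ 2 / (1 + lam ^ 2)) ≤ g := by
      refine le_trans ?_ hg
      rw [show 1 / 160 * (lam ^ 2 / (1 + lam ^ 2)) = 1 / 10 * (lam ^ 2 / (16 * (1 + lam ^ 2))) by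
        field_simp; norm_num]
      refine mul_le_mul_of_nonneg_left ?_ (by norm_num)
      rw [div_le_div_iff₀ (by positivity) (by positivity)]
      have : 1 ≤ 16 * v ^ 2 := by nlinarith [hv.1]
      nlinarith [mul_le_mul_of_nonneg_left this (by positivity : 0 ≤ lam ^ 2),
        (by positivity : 0 ≤ lam ^ 4 * v ^ 2)]
    rw [le_div_iff₀ (by positivity)]
    have h3 : v ^ 2 ≤ 16 := by nlinarith [hv.2]
    have h4 : 0 ≤ lam ^ 2 / (1 + lam ^ 2) := by positivity
    calc 1 / 40960 * (lam ^ 2 / (1 + lam ^ 2)) * v ^ 2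
        ≤ 1 / 40960 * (lam ^ 2 / (1 + lam ^ 2)) * 16 := by gcongr
      _ = 1 / 16 * (1 / 160 * (lam ^ 2 / (1 + lam ^ 2))) := by ring
      _ ≤ phase β lam v * g := mul_le_mul h1 h2 (by positivity) (by linarith)
  refine ⟨1 / 40960, by norm_num, fun lam hl => ?_⟩
  rcases hβ with rfl | rfl
  · right
    intro v hv
    have hr : 0 < lam * v := mul_pos hl (by linarith [hv.1])
    have h := symG_zero_le hr
    have h0 : 0 ≤ (lam * v) ^ 2 / (1 + (lam * v) ^ 2) := by positivity
    have := key lam hl v hv (-symG 0 (lam * v)) (by linarith)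
    rwa [mul_neg, neg_div] at this
  · left
    intro v hv
    exact key lam hl v hv _ (le_symG_one (mul_pos hl (by linarith [hv.1])))

/-- Van der Corput's second derivative test for compactly supported amplitudes. -/
theorem norm_integral_exp_mul_le_of_convex_phase {a b Λ M M₁ : ℝ} (hab : a ≤ b) (hΛ : 0 < Λ)
    {φ p p' : ℝ → ℝ} {ψ ψ' : ℝ → ℂ}
    (hφ : ∀ v ∈ Set.Icc a b, HasDerivAt φ (p v) v)
    (hp : ∀ v ∈ Set.Icc a b, HasDerivAt p (p' v) v) (hp' : ContinuousOn p' (Set.Icc a b))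
    (hconv : ∀ v ∈ Set.Icc a b, Λ ≤ p' v)
    (hψ : ∀ v ∈ Set.Icc a b, HasDerivAt ψ (ψ' v) v) (hψ' : ContinuousOn ψ' (Set.Icc a b))
    (hM : ∀ v ∈ Set.Icc a b, ‖ψ v‖ ≤ M) (hM₁ : ∀ v ∈ Set.Icc a b, ‖ψ' v‖ ≤ M₁)
    (ha : ψ a = 0) (hb : ψ b = 0) :
    ‖∫ v in a..b, Complex.exp (φ v * I) * ψ v‖ ≤ (2 * π * M + M₁ * (b - a)) / √Λ := by
  set s := √Λ with hs
  have hs0 : 0 < s := Real.sqrt_pos.2 hΛ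
  have hs2 : s ^ 2 = Λ := Real.sq_sqrt hΛ.le
  have hM0 : 0 ≤ M := (norm_nonneg _).trans (hM a ⟨le_rfl, hab⟩)
  have hM10 : 0 ≤ M₁ := (norm_nonneg _).trans (hM₁ a ⟨le_rfl, hab⟩)
  have hu : Set.uIcc a b = Set.Icc a b := Set.uIcc_of_le hab
  have hQ : ∀ v, 0 < p v ^ 2 + s ^ 2 := fun v => by positivity
  have hpc : ContinuousOn p (Set.Icc a b) := fun v hv => (hp v hv).continuousAt.continuousWithinAt
  have hψc : ContinuousOn ψ (Set.Icc a b) := fun v hv => (hψ v hv).continuousAt.continuousWithinAt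
  have hφc : ContinuousOn φ (Set.Icc a b) := fun v hv => (hφ v hv).continuousAt.continuousWithinAt
  have hQc : ContinuousOn (fun v => p v ^ 2 + s ^ 2) (Set.Icc a b) :=
    (hpc.pow 2).add continuousOn_const
  have hexp : ∀ v ∈ Set.Icc a b, HasDerivAt (fun v => Complex.exp (φ v * I))
      (Complex.exp (φ v * I) * (p v * I)) v := fun v hv =>
    ((hφ v hv).ofReal_comp.mul_const I).cexp
  have hec : ContinuousOn (fun v => Complex.exp (φ v * I)) (Set.Icc a b) := fun v hv =>
    (hexp v hv).continuousAt.continuousWithinAt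
  have hg : ∀ v ∈ Set.Icc a b, HasDerivAt (fun v => p v / (p v ^ 2 + s ^ 2))
      (p' v * (s ^ 2 - p v ^ 2) / (p v ^ 2 + s ^ 2) ^ 2) v := fun v hv => by
    refine ((hp v hv).div (((hp v hv).pow 2).add_const (s ^ 2)) (hQ v).ne').congr_deriv ?_
    simp only [Pi.pow_apply]
    push_cast
    ring
  have hgc' : ContinuousOn (fun v => p' v * (s ^ 2 - p v ^ 2) / (p v ^ 2 + s ^ 2) ^ 2)
      (Set.Icc a b) := (hp'.mul (continuousOn_const.sub (hpc.pow 2))).div (hQc.pow 2)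
        fun v _ => pow_ne_zero _ (hQ v).ne'
  have hgc : ContinuousOn (fun v => p v / (p v ^ 2 + s ^ 2)) (Set.Icc a b) :=
    hpc.div hQc fun v _ => (hQ v).ne'
  set w' : ℝ → ℂ := fun v => ψ' v * ((p v / (p v ^ 2 + s ^ 2) : ℝ) : ℂ) +
    ψ v * ((p' v * (s ^ 2 - p v ^ 2) / (p v ^ 2 + s ^ 2) ^ 2 : ℝ) : ℂ) with hw'
  have hw : ∀ v ∈ Set.Icc a b, HasDerivAt (fun v => ψ v * ((p v / (p v ^ 2 + s ^ 2) : ℝ) : ℂ))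
      (w' v) v := fun v hv => (hψ v hv).mul (hg v hv).ofReal_comp
  have hwc' : ContinuousOn w' (Set.Icc a b) :=
    (hψ'.mul (Complex.continuous_ofReal.comp_continuousOn hgc)).add
      (hψc.mul (Complex.continuous_ofReal.comp_continuousOn hgc'))
  have hibp := intervalIntegral.integral_mul_deriv_eq_deriv_mul (a := a) (b := b)
    (u := fun v => ψ v * ((p v / (p v ^ 2 + s ^ 2) : ℝ) : ℂ))
    (v := fun v => Complex.exp (φ v * I))
    (fun v hv => hw v (hu ▸ hv)) (fun v hv => hexp v (hu ▸ hv))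
    (ContinuousOn.intervalIntegrable (hu.symm ▸ hwc'))
    (ContinuousOn.intervalIntegrable (hu.symm ▸ (hec.mul
      ((Complex.continuous_ofReal.comp_continuousOn hpc).mul continuousOn_const))))
  simp only [ha, hb, zero_mul, sub_self, zero_sub] at hibp
  have hR : ContinuousOn (fun v => ((s ^ 2 / (p v ^ 2 + s ^ 2) : ℝ) : ℂ) *
      (Complex.exp (φ v * I) * ψ v)) (Set.Icc a b) :=
    (Complex.continuous_ofReal.comp_continuousOn
      (continuousOn_const.div hQc fun v _ => (hQ v).ne')).mul (hec.mul hψc)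
  have hmain : ∫ v in a..b, Complex.exp (φ v * I) * ψ v =
      ∫ v in a..b, (I * (w' v * Complex.exp (φ v * I)) +
        ((s ^ 2 / (p v ^ 2 + s ^ 2) : ℝ) : ℂ) * (Complex.exp (φ v * I) * ψ v)) := by
    rw [intervalIntegral.integral_add
        (ContinuousOn.intervalIntegrable (hu.symm ▸ (continuousOn_const.mul (hwc'.mul hec))))
        (ContinuousOn.intervalIntegrable (hu.symm ▸ hR)),
      intervalIntegral.integral_const_mul, ← neg_eq_iff_eq_neg.2 hibp,
      ← intervalIntegral.integral_neg, ← intervalIntegral.integral_const_mul,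
      ← intervalIntegral.integral_add]
    · refine intervalIntegral.integral_congr fun v _ => ?_
      have : ((p v : ℂ) ^ 2 + (s : ℂ) ^ 2) ≠ 0 := by exact_mod_cast (hQ v).ne'
      push_cast
      field_simp
      ring_nf
      simp only [I_sq]
      ring
    · exact ContinuousOn.intervalIntegrable (hu.symm ▸ (continuousOn_const.mul ((hψc.mul
        (Complex.continuous_ofReal.comp_continuousOn hgc)).mul (hec.mul
      ((Complex.continuous_ofReal.comp_continuousOn hpc).mul continuousOn_const))).neg))
    · exact ContinuousOn.intervalIntegrable (hu.symm ▸ hR)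
  have harc : ∀ v ∈ Set.uIcc a b, HasDerivAt (fun v => Real.arctan (p v / s) / s)
      (p' v / (p v ^ 2 + s ^ 2)) v := fun v hv => by
    refine (((hp v (hu ▸ hv)).div_const s).arctan.div_const s).congr_deriv ?_
    have := (hQ v).ne'
    field_simp
    ring
  have hBc : ContinuousOn (fun v => p' v / (p v ^ 2 + s ^ 2)) (Set.Icc a b) :=
    hp'.div hQc fun v _ => (hQ v).ne'
  have hBi : IntervalIntegrable (fun v => p' v / (p v ^ 2 + s ^ 2)) volume a b :=
    ContinuousOn.intervalIntegrable (hu.symm ▸ hBc)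
  rw [hmain]
  refine (intervalIntegral.norm_integral_le_of_norm_le hab (g := fun v =>
    M₁ / s + 2 * M * (p' v / (p v ^ 2 + s ^ 2))) ?_
    (intervalIntegrable_const.add (hBi.const_mul _))).trans ?_
  · refine Filter.Eventually.of_forall fun v hv => ?_
    have hv' : v ∈ Set.Icc a b := ⟨hv.1.le, hv.2⟩
    have hp0 : 0 < p' v := hΛ.trans_le (hconv v hv')
    have hE : ‖Complex.exp (φ v * I)‖ = 1 := Complex.norm_exp_ofReal_mul_I _
    have b1 : |p v / (p v ^ 2 + s ^ 2)| ≤ 1 / s := by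
      rw [abs_div, abs_of_pos (hQ v), div_le_div_iff₀ (hQ v) hs0, one_mul, ← sq_abs (p v)]
      nlinarith [sq_nonneg (|p v| - s), abs_nonneg (p v)]
    have b2 : |p' v * (s ^ 2 - p v ^ 2) / (p v ^ 2 + s ^ 2) ^ 2| ≤ p' v / (p v ^ 2 + s ^ 2) := by
      rw [abs_div, abs_mul, abs_of_pos hp0, abs_of_pos (pow_pos (hQ v) 2),
        div_le_div_iff₀ (pow_pos (hQ v) 2) (hQ v)]
      have : |s ^ 2 - p v ^ 2| ≤ p v ^ 2 + s ^ 2 := by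
        rw [abs_le]; constructor <;> nlinarith [sq_nonneg s, sq_nonneg (p v)]
      calc p' v * |s ^ 2 - p v ^ 2| * (p v ^ 2 + s ^ 2)
          ≤ p' v * (p v ^ 2 + s ^ 2) * (p v ^ 2 + s ^ 2) := by
            have := (hQ v).le
            gcongr
        _ = _ := by ring
    have b3 : |s ^ 2 / (p v ^ 2 + s ^ 2)| ≤ p' v / (p v ^ 2 + s ^ 2) := by
      rw [abs_of_pos (by positivity)]
      have := (hQ v)
      have := hconv v hv'
      rw [hs2] at *
      gcongr
    calc _ ≤ ‖w' v‖ + |s ^ 2 / (p v ^ 2 + s ^ 2)| * ‖ψ v‖ := by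
          refine (norm_add_le _ _).trans (le_of_eq ?_)
          simp only [norm_mul, hE, norm_I, Complex.norm_real, Real.norm_eq_abs, one_mul, mul_one]
      _ ≤ (M₁ * (1 / s) + M * (p' v / (p v ^ 2 + s ^ 2))) +
            p' v / (p v ^ 2 + s ^ 2) * M := by
          refine add_le_add ((norm_add_le _ _).trans (add_le_add ?_ ?_)) ?_
          · rw [norm_mul, Complex.norm_real, Real.norm_eq_abs]
            exact mul_le_mul (hM₁ v hv') b1 (abs_nonneg _) hM10
          · rw [norm_mul, Complex.norm_real, Real.norm_eq_abs]
            exact mul_le_mul (hM v hv') b2 (abs_nonneg _) hM0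
          · exact mul_le_mul b3 (hM v hv') (norm_nonneg _) ((abs_nonneg _).trans b3)
      _ = _ := by ring
  · rw [intervalIntegral.integral_add intervalIntegrable_const (hBi.const_mul _),
      intervalIntegral.integral_const_mul, intervalIntegral.integral_const,
      intervalIntegral.integral_eq_sub_of_hasDerivAt harc hBi, smul_eq_mul, ← sub_div]
    have h1 := Real.arctan_lt_pi_div_two (p b / s)
    have h2 := Real.neg_pi_div_two_lt_arctan (p a / s)
    have h3 : (b - a) * (M₁ / s) + 2 * M * ((Real.arctan (p b / s) - Real.arctan (p a / s)) / s) =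
      (2 * (Real.arctan (p b / s) - Real.arctan (p a / s)) * M + M₁ * (b - a)) / s := by ring
    rw [h3]
    gcongr
    linarith

/-- Van der Corput's second derivative test, with a second derivative of either sign. -/
theorem norm_integral_exp_mul_le_of_second_deriv {a b Λ M M₁ : ℝ} (hab : a ≤ b) (hΛ : 0 < Λ)
    {φ p p' : ℝ → ℝ} {ψ ψ' : ℝ → ℂ}
    (hφ : ∀ v ∈ Set.Icc a b, HasDerivAt φ (p v) v)
    (hp : ∀ v ∈ Set.Icc a b, HasDerivAt p (p' v) v) (hp' : ContinuousOn p' (Set.Icc a b))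
    (hconv : (∀ v ∈ Set.Icc a b, Λ ≤ p' v) ∨ ∀ v ∈ Set.Icc a b, Λ ≤ -p' v)
    (hψ : ∀ v ∈ Set.Icc a b, HasDerivAt ψ (ψ' v) v) (hψ' : ContinuousOn ψ' (Set.Icc a b))
    (hM : ∀ v ∈ Set.Icc a b, ‖ψ v‖ ≤ M) (hM₁ : ∀ v ∈ Set.Icc a b, ‖ψ' v‖ ≤ M₁)
    (ha : ψ a = 0) (hb : ψ b = 0) :
    ‖∫ v in a..b, Complex.exp (φ v * I) * ψ v‖ ≤ (2 * π * M + M₁ * (b - a)) / √Λ := by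
  rcases hconv with h | h
  · exact norm_integral_exp_mul_le_of_convex_phase hab hΛ hφ hp hp' h hψ hψ' hM hM₁ ha hb
  · have := norm_integral_exp_mul_le_of_convex_phase hab hΛ (φ := fun v => -φ v)
      (p := fun v => -p v) (p' := fun v => -p' v) (ψ := fun v => starRingEnd ℂ (ψ v))
      (ψ' := fun v => starRingEnd ℂ (ψ' v)) (M := M) (M₁ := M₁)
      (fun v hv => (hφ v hv).neg) (fun v hv => (hp v hv).neg) hp'.neg h
      (fun v hv => (hψ v hv).star) (Complex.continuous_conj.comp_continuousOn hψ')
      (fun v hv => by simpa using hM v hv) (fun v hv => by simpa using hM₁ v hv)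
      (by simp [ha]) (by simp [hb])
    rw [intervalIntegral.integral_of_le hab] at this ⊢
    rw [← Complex.norm_conj, ← integral_conj]
    refine le_of_eq_of_le (congrArg norm (integral_congr_ae (.of_forall fun v => ?_))) this
    simp only [map_mul, ← Complex.exp_conj, Complex.conj_ofReal, Complex.conj_I]
    simp

/-- Energy bound for a perturbed harmonic oscillator with an inverse square potential. -/
lemma norm_le_of_oscillator {a b : ℝ → ℂ} {g : ℂ} {s₀ : ℝ} (hs₀ : 0 < s₀)
    (ha : ∀ s, 0 < s → HasDerivAt a (2 * π * I * b s) s)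
    (hb : ∀ s, 0 < s → HasDerivAt b (2 * π * I * a s + g * a s / s ^ 2) s) :
    ∃ C, ∀ s, s₀ ≤ s → ‖a s‖ ≤ C ∧ ‖b s‖ ≤ C := by
  set E : ℝ → ℝ := fun s => ‖a s‖ ^ 2 + ‖b s‖ ^ 2
  have hE : ∀ s, 0 < s → HasDerivAt E (2 * inner ℝ (a s) (2 * π * I * b s) +
      2 * inner ℝ (b s) (2 * π * I * a s + g * a s / s ^ 2)) s := fun s hs =>
    (ha s hs).norm_sq.add (hb s hs).norm_sq
  have hE' : ∀ s, 0 < s → 2 * inner ℝ (a s) (2 * π * I * b s) +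
      2 * inner ℝ (b s) (2 * π * I * a s + g * a s / s ^ 2) ≤ ‖g‖ / s ^ 2 * E s := by
    intro s hs
    have h0 : inner ℝ (a s) (2 * π * I * b s) + inner ℝ (b s) (2 * π * I * a s) = 0 := by
      simp only [Complex.inner]
      simp
      ring
    have h1 : inner ℝ (b s) (g * a s / s ^ 2) ≤ ‖b s‖ * (‖g‖ * ‖a s‖ / s ^ 2) := by
      refine (real_inner_le_norm _ _).trans (le_of_eq ?_)
      rw [norm_div, norm_mul, norm_pow, Complex.norm_real, Real.norm_of_nonneg hs.le]
    rw [inner_add_right]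
    have h2 : 2 * (‖b s‖ * (‖g‖ * ‖a s‖ / s ^ 2)) ≤ ‖g‖ / s ^ 2 * E s := by
      have : 2 * (‖b s‖ * (‖g‖ * ‖a s‖ / s ^ 2)) = ‖g‖ / s ^ 2 * (2 * ‖a s‖ * ‖b s‖) := by ring
      rw [this]
      exact mul_le_mul_of_nonneg_left (two_mul_le_add_sq _ _) (by positivity)
    linarith
  have hanti : AntitoneOn (fun s => E s * Real.exp (‖g‖ / s)) (Set.Ici s₀) := by
    have hd : ∀ s, 0 < s → HasDerivAt (fun s => E s * Real.exp (‖g‖ / s))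
        ((2 * inner ℝ (a s) (2 * π * I * b s) +
      2 * inner ℝ (b s) (2 * π * I * a s + g * a s / s ^ 2)) * Real.exp (‖g‖ / s) +
        E s * (Real.exp (‖g‖ / s) * (-‖g‖ / s ^ 2))) s := fun s hs => by
      refine (hE s hs).mul (HasDerivAt.exp ?_)
      refine ((hasDerivAt_const s ‖g‖).div (hasDerivAt_id s) hs.ne').congr_deriv ?_
      simp
    refine antitoneOn_of_deriv_nonpos (convex_Ici s₀)
      (fun s hs => (hd s (hs₀.trans_le hs)).continuousAt.continuousWithinAt)
      (fun s hs => ?_) fun s hs => ?_ <;> rw [interior_Ici] at hs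
    · exact (hd s (hs₀.trans hs)).differentiableAt.differentiableWithinAt
    · rw [(hd s (hs₀.trans hs)).deriv]
      have := mul_le_mul_of_nonneg_right (hE' s (hs₀.trans hs)) (Real.exp_pos (‖g‖ / s)).le
      have e : E s * (Real.exp (‖g‖ / s) * (-‖g‖ / s ^ 2)) =
        -(‖g‖ / s ^ 2 * E s * Real.exp (‖g‖ / s)) := by ring
      linarith
  refine ⟨√(E s₀ * Real.exp (‖g‖ / s₀)), fun s hs => ?_⟩
  have h := hanti Set.self_mem_Ici hs hs
  have h1 : E s ≤ E s₀ * Real.exp (‖g‖ / s₀) := by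
    refine le_trans ?_ h
    have hs0 : 0 < s := hs₀.trans_le hs
    exact le_mul_of_one_le_right (by positivity) (Real.one_le_exp (by positivity))
  exact ⟨Real.le_sqrt_of_sq_le (le_trans (le_add_of_nonneg_right (sq_nonneg _)) h1),
    Real.le_sqrt_of_sq_le (le_trans (le_add_of_nonneg_left (sq_nonneg _)) h1)⟩

/-- Solutions of the Bessel-type system `J' = 2πi J₁`, `J₁' = 2πi J - (2α/s) J₁` are, up to the
factor `s^{-α}`, sums of two plane waves with slowly varying amplitudes. -/
lemma exists_slowly_varying_amplitudes {J J₁ : ℝ → ℂ} {α s₀ : ℝ} (hs₀ : 0 < s₀)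
    (hJ : ∀ s, 0 < s → HasDerivAt J (2 * π * I * J₁ s) s)
    (hJ₁ : ∀ s, 0 < s → HasDerivAt J₁ (2 * π * I * J s - 2 * α / s * J₁ s) s) :
    ∃ (A₁ A₂ A₁' A₂' : ℝ → ℂ) (C : ℝ),
      (∀ s, 0 < s → J s * ((s ^ α : ℝ) : ℂ) =
        Complex.exp (2 * π * s * I) * A₁ s + Complex.exp (-(2 * π * s * I)) * A₂ s) ∧
      (∀ s, 0 < s → HasDerivAt A₁ (A₁' s) s) ∧ (∀ s, 0 < s → HasDerivAt A₂ (A₂' s) s) ∧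
      ContinuousOn A₁' (Set.Ioi 0) ∧ ContinuousOn A₂' (Set.Ioi 0) ∧
      ∀ s, s₀ ≤ s → ‖A₁ s‖ ≤ C ∧ ‖A₂ s‖ ≤ C ∧ ‖A₁' s‖ ≤ C / s ^ 2 ∧ ‖A₂' s‖ ≤ C / s ^ 2 := by
  set a : ℝ → ℂ := fun s => J s * ((s ^ α : ℝ) : ℂ) with haa
  set b : ℝ → ℂ := fun s => (J₁ s + α * J s / (2 * π * I * s)) * ((s ^ α : ℝ) : ℂ) with hbb
  set g : ℂ := (α ^ 2 - α) / (2 * π * I) with hg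
  have hpi : (π : ℂ) ≠ 0 := by exact_mod_cast Real.pi_ne_zero
  have hpow : ∀ s, 0 < s → HasDerivAt (fun s : ℝ => ((s ^ α : ℝ) : ℂ))
      ((α : ℂ) / s * ((s ^ α : ℝ) : ℂ)) s := fun s hs => by
    refine (Real.hasDerivAt_rpow_const (p := α) (Or.inl hs.ne')).ofReal_comp.congr_deriv ?_
    rw [Real.rpow_sub_one hs.ne']
    push_cast
    ring
  have ha : ∀ s, 0 < s → HasDerivAt a (2 * π * I * b s) s := fun s hs => by
    have hsc : (s : ℂ) ≠ 0 := by exact_mod_cast hs.ne'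
    refine ((hJ s hs).mul (hpow s hs)).congr_deriv ?_
    simp only [hbb]
    field_simp
  have hb : ∀ s, 0 < s → HasDerivAt b (2 * π * I * a s + g * a s / s ^ 2) s := fun s hs => by
    have hsc : (s : ℂ) ≠ 0 := by exact_mod_cast hs.ne'
    have h1 := ((hJ s hs).const_mul (α : ℂ)).div
      ((Complex.ofRealCLM.hasDerivAt (x := s)).const_mul (2 * π * I)) (by simp [hsc, hpi])
    refine (((hJ₁ s hs).add h1).mul (hpow s hs)).congr_deriv ?_
    simp only [haa, hg, Pi.add_apply, Pi.div_apply, ofRealCLM_apply]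
    field_simp
    simp
    linear_combination (4 * π ^ 2 * s ^ 2 * J s * ((s ^ α : ℝ) : ℂ)) * Complex.I_sq
  obtain ⟨C, hC⟩ := norm_le_of_oscillator hs₀ ha hb
  have hexp : ∀ (z : ℂ) (s : ℝ), HasDerivAt (fun s : ℝ => Complex.exp (z * s))
      (Complex.exp (z * s) * z) s := fun z s => by
    simpa using ((Complex.ofRealCLM.hasDerivAt (x := s)).const_mul z).cexp
  have hac : ContinuousOn a (Set.Ioi 0) := fun s hs => (ha s hs).continuousAt.continuousWithinAt
  have hec : ∀ z : ℂ, Continuous fun s : ℝ => Complex.exp (z * s) := fun z => by fun_prop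
  have hne : ∀ s : ℝ, s ∈ Set.Ioi (0 : ℝ) → ((s : ℂ) ^ 2) ≠ 0 := fun s hs => by
    have h : (0 : ℝ) < s := hs
    exact pow_ne_zero _ (by exact_mod_cast h.ne')
  have hgc : ContinuousOn (fun s : ℝ => g * a s / (s : ℂ) ^ 2) (Set.Ioi 0) :=
    (continuousOn_const.mul hac).div (by fun_prop) hne
  have hnorm : ∀ (z : ℝ) (s : ℝ), ‖Complex.exp (z * I * s)‖ = 1 := fun z s => by
    rw [show (z * I * s : ℂ) = ((z * s : ℝ) : ℂ) * I by push_cast; ring,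
      Complex.norm_exp_ofReal_mul_I]
  have hgs : ∀ s, s₀ ≤ s → ‖g * a s / (s : ℂ) ^ 2‖ ≤ ‖g‖ * C / s ^ 2 := fun s hs => by
    rw [norm_div, norm_mul, norm_pow, Complex.norm_real,
      Real.norm_of_nonneg (hs₀.le.trans hs)]
    have := (hC s hs).1
    gcongr
  have hC0 : 0 ≤ C := (norm_nonneg _).trans (hC s₀ le_rfl).1
  refine ⟨fun s => Complex.exp (((-(2 * π) : ℝ) : ℂ) * I * s) * ((a s + b s) / 2),
    fun s => Complex.exp (((2 * π : ℝ) : ℂ) * I * s) * ((a s - b s) / 2),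
    fun s => Complex.exp (((-(2 * π) : ℝ) : ℂ) * I * s) * (g * a s / s ^ 2 / 2),
    fun s => Complex.exp (((2 * π : ℝ) : ℂ) * I * s) * (-(g * a s / s ^ 2) / 2),
    C + ‖g‖ * C, fun s hs => ?_, fun s hs => ?_, fun s hs => ?_,
    (hec _).continuousOn.mul (hgc.div_const 2), (hec _).continuousOn.mul (hgc.neg.div_const 2),
    fun s hs => ⟨?_, ?_, ?_, ?_⟩⟩
  · have e1 : Complex.exp (2 * π * s * I) * Complex.exp (((-(2 * π) : ℝ) : ℂ) * I * s) = 1 := by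
      rw [← Complex.exp_add]; push_cast; ring_nf; simp
    have e2 : Complex.exp (-(2 * π * s * I)) * Complex.exp (((2 * π : ℝ) : ℂ) * I * s) = 1 := by
      rw [← Complex.exp_add]; push_cast; ring_nf; simp
    rw [← mul_assoc, ← mul_assoc, e1, e2]
    simp only [haa]
    ring
  · refine ((hexp _ s).mul (((ha s hs).add (hb s hs)).div_const 2)).congr_deriv ?_
    simp only [Pi.add_apply]
    push_cast
    ring
  · refine ((hexp _ s).mul (((ha s hs).sub (hb s hs)).div_const 2)).congr_deriv ?_
    simp only [Pi.sub_apply]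
    push_cast
    ring
  · rw [norm_mul, hnorm, one_mul, norm_div, Complex.norm_two]
    have := norm_add_le (a s) (b s)
    have := hC s hs
    have : 0 ≤ ‖g‖ * C := by positivity
    linarith
  · rw [norm_mul, hnorm, one_mul, norm_div, Complex.norm_two]
    have := norm_sub_le (a s) (b s)
    have := hC s hs
    have : 0 ≤ ‖g‖ * C := by positivity
    linarith
  · rw [norm_mul, hnorm, one_mul, norm_div, Complex.norm_two]
    have h1 := hgs s hs
    have : 0 ≤ C / s ^ 2 := by positivity
    rw [add_div]
    linarith [norm_nonneg (g * a s / (s : ℂ) ^ 2)]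
  · rw [norm_mul, hnorm, one_mul, norm_div, norm_neg, Complex.norm_two]
    have h1 := hgs s hs
    have : 0 ≤ C / s ^ 2 := by positivity
    rw [add_div]
    linarith [norm_nonneg (g * a s / (s : ℂ) ^ 2)]

section Sphere

variable {E : Type*} [NormedAddCommGroup E] [NormedSpace ℝ E] [MeasurableSpace E]
  [BorelSpace E] [FiniteDimensional ℝ E] (μ : Measure E) [μ.IsAddHaarMeasure]

open Module (finrank)

lemma integral_volumeIoiPow (n : ℕ) (f : ℝ → ℂ) :
    ∫ r : Set.Ioi (0 : ℝ), f r ∂(Measure.volumeIoiPow n) =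
      ∫ r in Set.Ioi (0 : ℝ), (r : ℂ) ^ n * f r := by
  simp only [Measure.volumeIoiPow, ENNReal.ofReal]
  rw [integral_withDensity_eq_integral_smul,
    integral_subtype_comap measurableSet_Ioi fun a ↦ Real.toNNReal (a ^ n) • f a,
    setIntegral_congr_fun measurableSet_Ioi fun x hx ↦ ?_]
  · rw [NNReal.smul_def, Real.coe_toNNReal _ (pow_nonneg (le_of_lt hx) _)]
    simp
  · exact (measurable_subtype_coe.pow_const _).real_toNNReal

lemma integrable_comp_homeomorphUnitSphereProd {F : E → ℂ} (hF : Integrable F μ) :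
    Integrable (fun z : Metric.sphere (0 : E) 1 × Set.Ioi (0 : ℝ) => F ((z.2 : ℝ) • (z.1 : E)))
      (μ.toSphere.prod (Measure.volumeIoiPow (finrank ℝ E - 1))) := by
  rw [← μ.measurePreserving_homeomorphUnitSphereProd.integrable_comp_emb
        (Homeomorph.measurableEmbedding _)]
  have h : Integrable (fun x : ({(0)}ᶜ : Set E) => F x.1) (μ.comap (↑)) := by
    have := hF.integrableOn (s := {(0 : E)}ᶜ)
    rwa [integrableOn_iff_comap_subtypeVal (measurableSet_singleton _).compl] at this
  refine h.congr (.of_forall fun x => ?_)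
  simp only [Function.comp]
  congr 1
  exact congrArg Subtype.val ((homeomorphUnitSphereProd E).symm_apply_apply x).symm

variable [Nontrivial E]

lemma integral_comp_homeomorphUnitSphereProd (F : E → ℂ) :
    ∫ x, F x ∂μ = ∫ z : Metric.sphere (0 : E) 1 × Set.Ioi (0 : ℝ), F ((z.2 : ℝ) • (z.1 : E))
      ∂(μ.toSphere.prod (Measure.volumeIoiPow (finrank ℝ E - 1))) := by
  calc
    ∫ x, F x ∂μ = ∫ x : ({(0)}ᶜ : Set E), F x.1 ∂(μ.comap (↑)) := by
      rw [integral_subtype_comap (measurableSet_singleton _).compl fun x ↦ F x,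
        restrict_compl_singleton]
    _ = _ := by
      rw [← μ.measurePreserving_homeomorphUnitSphereProd.integral_comp
        (Homeomorph.measurableEmbedding _) (fun z => F ((z.2 : ℝ) • (z.1 : E)))]
      refine integral_congr_ae (.of_forall fun x => ?_)
      simp only []
      congr 1
      exact congrArg Subtype.val ((homeomorphUnitSphereProd E).symm_apply_apply x).symm

/-- Polar coordinates, with the radial integral inside. -/
lemma integral_eq_integral_sphere_integral {F : E → ℂ} (hF : Integrable F μ) :
    ∫ x, F x ∂μ = ∫ ω : Metric.sphere (0 : E) 1,
      (∫ r in Set.Ioi (0 : ℝ), (r : ℂ) ^ (finrank ℝ E - 1) * F (r • (ω : E))) ∂μ.toSphere := by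
  rw [integral_comp_homeomorphUnitSphereProd,
    integral_prod _ (integrable_comp_homeomorphUnitSphereProd μ hF)]
  refine integral_congr_ae (.of_forall fun ω => ?_)
  exact integral_volumeIoiPow _ (fun r => F (r • (ω : E)))

/-- Polar coordinates, with the spherical integral inside. -/
lemma integral_eq_integral_integral_sphere {F : E → ℂ} (hF : Integrable F μ) :
    ∫ x, F x ∂μ = ∫ r in Set.Ioi (0 : ℝ), (r : ℂ) ^ (finrank ℝ E - 1) *
      ∫ ω : Metric.sphere (0 : E) 1, F (r • (ω : E)) ∂μ.toSphere := by
  rw [integral_comp_homeomorphUnitSphereProd,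
    integral_prod_symm _ (integrable_comp_homeomorphUnitSphereProd μ hF)]
  exact integral_volumeIoiPow _ (fun r => ∫ ω : Metric.sphere (0 : E) 1,
    F (r • (ω : E)) ∂μ.toSphere)

end Sphere

section Invariance

variable {E : Type*} [NormedAddCommGroup E] [InnerProductSpace ℝ E] [MeasurableSpace E]
  [BorelSpace E] [FiniteDimensional ℝ E]

/-- The homeomorphism of the unit sphere induced by a linear isometry. -/
def sphereHomeomorph (R : E ≃ₗᵢ[ℝ] E) : Metric.sphere (0 : E) 1 ≃ₜ Metric.sphere (0 : E) 1 where
  toFun ω := ⟨R ω, by simp⟩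
  invFun ω := ⟨R.symm ω, by simp⟩
  left_inv ω := by simp
  right_inv ω := by simp
  continuous_toFun := by fun_prop
  continuous_invFun := by fun_prop

lemma measurePreserving_sphereHomeomorph (R : E ≃ₗᵢ[ℝ] E) :
    MeasurePreserving (sphereHomeomorph R) (volume : Measure E).toSphere
      (volume : Measure E).toSphere := by
  refine ⟨(sphereHomeomorph R).continuous.measurable, ?_⟩
  ext s hs
  rw [Measure.map_apply (sphereHomeomorph R).continuous.measurable hs,
    Measure.toSphere_apply' _ ((sphereHomeomorph R).continuous.measurable hs),
    Measure.toSphere_apply' _ hs]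
  congr 1
  refine Eq.trans (congrArg _ ?_) ((R.measurePreserving).measure_preimage_equiv
    (f := R.toMeasurableEquiv) _)
  ext x
  simp only [Set.mem_smul, Set.mem_image, Set.mem_preimage]
  constructor
  · rintro ⟨r, hr, _, ⟨ω, hω, rfl⟩, rfl⟩
    exact ⟨r, hr, _, ⟨_, hω, rfl⟩, by simp [sphereHomeomorph]⟩
  · rintro ⟨r, hr, _, ⟨ω, hω, rfl⟩, h⟩
    refine ⟨r, hr, _, ⟨(sphereHomeomorph R).symm ω, by simpa using hω, rfl⟩, ?_⟩
    have : R (r • R.symm ω) = R x := by simpa using h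
    exact R.injective this

lemma integral_sphere_comp_isometry (R : E ≃ₗᵢ[ℝ] E) (g : E → ℂ) :
    ∫ ω : Metric.sphere (0 : E) 1, g (R ω) ∂(volume : Measure E).toSphere =
      ∫ ω : Metric.sphere (0 : E) 1, g ω ∂(volume : Measure E).toSphere :=
  (measurePreserving_sphereHomeomorph R).integral_comp
    (sphereHomeomorph R).measurableEmbedding (fun ω => g ω)

end Invariance

lemma hasDerivAt_integral_of_continuous_compact {S : Type*} [TopologicalSpace S] [CompactSpace S]
    [MeasurableSpace S] [BorelSpace S] [SecondCountableTopology S] {ν : Measure S}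
      [IsFiniteMeasure ν]
    {F F' : ℝ → S → ℂ} (hF : Continuous (Function.uncurry F))
      (hF' : Continuous (Function.uncurry F'))
    (h : ∀ s ω, HasDerivAt (fun s => F s ω) (F' s ω) s) (s₀ : ℝ) :
    HasDerivAt (fun s => ∫ ω, F s ω ∂ν) (∫ ω, F' s₀ ω ∂ν) s₀ := by
  obtain ⟨C, hC⟩ := ((isCompact_closedBall s₀ 1).prod
    (isCompact_univ (X := S))).exists_bound_of_continuousOn
    hF'.continuousOn
  have hcF : ∀ s, Continuous (F s) := fun s => hF.comp (by fun_prop : Continuous fun ω => (s, ω))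
  have hcF' : ∀ s, Continuous (F' s) := fun s => hF'.comp (by fun_prop : Continuous fun ω => (s, ω))
  have hInt : ∀ g : S → ℂ, Continuous g → Integrable g ν := fun g hg => by
    obtain ⟨C, hC⟩ := (isCompact_univ (X := S)).exists_bound_of_continuousOn hg.continuousOn
    exact Integrable.of_bound hg.measurable.aestronglyMeasurable C
      (.of_forall fun ω => hC ω (Set.mem_univ _))
  refine (hasDerivAt_integral_of_dominated_loc_of_deriv_le (bound := fun _ => C)
    (Metric.closedBall_mem_nhds s₀ one_pos)
    (.of_forall fun s => (hcF s).measurable.aestronglyMeasurable) (hInt _ (hcF s₀))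
    (hcF' s₀).measurable.aestronglyMeasurable (.of_forall fun ω s hs => ?_)
    (integrable_const C) (.of_forall fun ω s _ => h s ω)).2
  exact hC (s, ω) ⟨hs, Set.mem_univ _⟩

section

variable {d : ℕ}

/-- Surface measure on the unit sphere. -/
abbrev sph (d : ℕ) : Measure (Metric.sphere (0 : Euc d) 1) := (volume : Measure (Euc d)).toSphere

/-- The oscillating factor `e^{2π i s ω_i}`. -/
def sphExp (i : Fin d) (s : ℝ) (ω : Euc d) : ℂ := Complex.exp (2 * π * s * ω i * I)

/-- The Fourier transform of surface measure along a coordinate axis. -/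
def sphJ (i : Fin d) (s : ℝ) : ℂ := ∫ ω : Metric.sphere (0 : Euc d) 1, sphExp i s ω ∂sph d

/-- The first moment of the oscillating factor. -/
def sphJ₁ (i : Fin d) (s : ℝ) : ℂ :=
  ∫ ω : Metric.sphere (0 : Euc d) 1, ((ω : Euc d) i : ℂ) * sphExp i s ω ∂sph d

lemma integrable_sphere_of_continuous {g : Metric.sphere (0 : Euc d) 1 → ℂ} (hg : Continuous g) :
    Integrable g (sph d) := by
  obtain ⟨C, hC⟩ := (isCompact_univ).exists_bound_of_continuousOn hg.continuousOn
  exact Integrable.of_bound hg.measurable.aestronglyMeasurable C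
    (.of_forall fun ω => hC ω (Set.mem_univ _))

lemma hasDerivAt_sphExp (i : Fin d) (s : ℝ) (ω : Euc d) :
    HasDerivAt (fun s => sphExp i s ω) (2 * π * I * ((ω i : ℂ) * sphExp i s ω)) s := by
  have := (((Complex.ofRealCLM.hasDerivAt (x := s)).const_mul (2 * π : ℂ)).mul_const
    ((ω i : ℂ) * I)).cexp
  refine (this.congr_deriv ?_).congr_of_eventuallyEq (.of_forall fun s => ?_)
  · simp [sphExp]; ring_nf
  · simp [sphExp]; ring_nf

lemma hasDerivAt_sphJ (i : Fin d) (s : ℝ) :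
    HasDerivAt (sphJ i) (2 * π * I * sphJ₁ i s) s := by
  refine (hasDerivAt_integral_of_continuous_compact (ν := sph d)
    (F := fun s ω => sphExp i s ω)
      (F' := fun s ω => 2 * π * I * (((ω : Euc d) i : ℂ) * sphExp i s ω))
    (by unfold Function.uncurry sphExp; fun_prop) (by unfold Function.uncurry sphExp; fun_prop)
    (fun s ω => hasDerivAt_sphExp i s ω) s).congr_deriv ?_
  rw [integral_const_mul, sphJ₁]

/-- Rotational invariance of surface measure in infinitesimal form. -/
lemma sphJ₁_eq {i k : Fin d} (hik : i ≠ k) (s : ℝ) :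
    sphJ₁ i s = 2 * π * I * s *
      ∫ ω : Metric.sphere (0 : Euc d) 1, ((ω : Euc d) k : ℂ) ^ 2 * sphExp i s ω ∂sph d := by
  let F : ℝ → Metric.sphere (0 : Euc d) 1 → ℂ := fun θ ω =>
    (Real.sin θ * (ω : Euc d) i - Real.cos θ * (ω : Euc d) k : ℂ) *
      Complex.exp (2 * π * s * I * (Real.cos θ * (ω : Euc d) i + Real.sin θ * (ω : Euc d) k))
  let F' : ℝ → Metric.sphere (0 : Euc d) 1 → ℂ := fun θ ω =>
    ((Real.cos θ * (ω : Euc d) i + Real.sin θ * (ω : Euc d) k : ℂ) +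
      (Real.sin θ * (ω : Euc d) i - Real.cos θ * (ω : Euc d) k : ℂ) * (2 * π * s * I) *
      (-Real.sin θ * (ω : Euc d) i + Real.cos θ * (ω : Euc d) k)) *
      Complex.exp (2 * π * s * I * (Real.cos θ * (ω : Euc d) i + Real.sin θ * (ω : Euc d) k))
  have hsin : ∀ θ, HasDerivAt (fun θ : ℝ => (Real.sin θ : ℂ)) (Real.cos θ : ℂ) θ :=
    fun θ => (Real.hasDerivAt_sin θ).ofReal_comp
  have hcos : ∀ θ, HasDerivAt (fun θ : ℝ => (Real.cos θ : ℂ)) (-Real.sin θ : ℂ) θ :=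
    fun θ => by simpa using (Real.hasDerivAt_cos θ).ofReal_comp
  have hd := hasDerivAt_integral_of_continuous_compact (ν := sph d) (F := F) (F' := F')
    (by unfold Function.uncurry; fun_prop) (by unfold Function.uncurry; fun_prop)
    (fun θ ω => by
      refine ((((hsin θ).mul_const _).sub ((hcos θ).mul_const _)).mul
        ((((hcos θ).mul_const _).add ((hsin θ).mul_const _)).const_mul
          (2 * π * s * I)).cexp).congr_deriv ?_
      simp only [F', Pi.add_apply, Pi.sub_apply]
      ring) 0
  have hconst : ∀ θ, ∫ ω, F θ ω ∂sph d =
      ∫ ω : Metric.sphere (0 : Euc d) 1, ((ω : Euc d) k : ℂ) * sphExp i s ω ∂sph d := fun θ => by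
    let u : Euc d := EuclideanSpace.single i (Real.cos (θ / 2)) +
      EuclideanSpace.single k (Real.sin (θ / 2))
    have hui : u i = Real.cos (θ / 2) := by simp [u, hik]
    have huk : u k = Real.sin (θ / 2) := by simp [u, hik.symm]
    have hu : ∀ v : Euc d, inner ℝ u v = Real.cos (θ / 2) * v i + Real.sin (θ / 2) * v k :=
      fun v => by simp [u, inner_add_left, EuclideanSpace.inner_single_left]
    have hn : ‖u‖ ^ 2 = 1 := by
      rw [← real_inner_self_eq_norm_sq, hu, hui, huk]
      nlinarith [Real.sin_sq_add_cos_sq (θ / 2)]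
    have hR : ∀ v : Euc d, (Submodule.reflection (ℝ ∙ u)) v = (2 * inner ℝ u v) • u - v := fun v =>
      by
      rw [Submodule.reflection_singleton_apply]
      simp [hn, two_smul, ← add_smul, two_mul]
    have h2 : Real.cos θ = 2 * Real.cos (θ / 2) ^ 2 - 1 := by
      rw [← Real.cos_two_mul]; congr 1; ring
    have h3 : Real.sin θ = 2 * Real.sin (θ / 2) * Real.cos (θ / 2) := by
      rw [← Real.sin_two_mul]; congr 1; ring
    have h4 := Real.sin_sq_add_cos_sq (θ / 2)
    have hRi : ∀ v : Euc d, (Submodule.reflection (ℝ ∙ u)) v i =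
        Real.cos θ * v i + Real.sin θ * v k := fun v => by
      rw [hR, PiLp.sub_apply, PiLp.smul_apply, hu, hui, h2, h3, smul_eq_mul]; ring
    have hRk : ∀ v : Euc d, (Submodule.reflection (ℝ ∙ u)) v k =
        Real.sin θ * v i - Real.cos θ * v k := fun v => by
      rw [hR, PiLp.sub_apply, PiLp.smul_apply, hu, huk, h2, h3, smul_eq_mul]
      linear_combination (2 * v k) * h4
    rw [← integral_sphere_comp_isometry (Submodule.reflection (ℝ ∙ u))
      (fun v : Euc d => (v k : ℂ) * sphExp i s v)]
    refine integral_congr_ae (.of_forall fun ω => ?_)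
    simp only [F, sphExp, hRi, hRk]
    push_cast
    ring_nf
  have h0 : ∫ ω, F' 0 ω ∂sph d = 0 := by
    refine hd.unique ?_
    simp_rw [hconst]
    exact hasDerivAt_const _ _
  have h5 : ∀ ω, F' 0 ω = ((ω : Euc d) i : ℂ) * sphExp i s ω -
      2 * π * I * s * (((ω : Euc d) k : ℂ) ^ 2 * sphExp i s ω) := fun ω => by
    simp only [F', sphExp, Real.sin_zero, Real.cos_zero]
    push_cast
    ring_nf
  simp_rw [h5] at h0
  rw [integral_sub, integral_const_mul, sub_eq_zero] at h0
  · exact h0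
  · exact integrable_sphere_of_continuous (by unfold sphExp; fun_prop)
  · exact integrable_sphere_of_continuous (by unfold sphExp; fun_prop)

lemma hasDerivAt_sphJ₁ (i : Fin d) {s : ℝ} (hs : 0 < s) :
    HasDerivAt (sphJ₁ i) (2 * π * I * sphJ i s -
      2 * (((d : ℝ) - 1) / 2 : ℝ) / s * sphJ₁ i s) s := by
  have hsc : (s : ℂ) ≠ 0 := by exact_mod_cast hs.ne'
  have hd := hasDerivAt_integral_of_continuous_compact (ν := sph d)
    (F := fun s ω => ((ω : Euc d) i : ℂ) * sphExp i s ω)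
    (F' := fun s ω => ((ω : Euc d) i : ℂ) * (2 * π * I * (((ω : Euc d) i : ℂ) * sphExp i s ω)))
    (by unfold Function.uncurry sphExp; fun_prop) (by unfold Function.uncurry sphExp; fun_prop)
    (fun s ω => (hasDerivAt_sphExp i s ω).const_mul _) s
  refine hd.congr_deriv ?_
  have hI : ∀ k : Fin d, Integrable (fun ω : Metric.sphere (0 : Euc d) 1 =>
      ((ω : Euc d) k : ℂ) ^ 2 * sphExp i s ω) (sph d) := fun k =>
    integrable_sphere_of_continuous (by unfold sphExp; fun_prop)
  have hsum : ∑ k ∈ Finset.univ.erase i, sphJ₁ i s = 2 * π * I * s * (sphJ i s -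
      ∫ ω : Metric.sphere (0 : Euc d) 1, ((ω : Euc d) i : ℂ) ^ 2 * sphExp i s ω ∂sph d) := by
    rw [Finset.sum_congr rfl fun k hk => sphJ₁_eq (Finset.ne_of_mem_erase hk).symm s,
      ← Finset.mul_sum, ← integral_finsetSum _ fun k _ => hI k, sphJ, ← integral_sub
        (integrable_sphere_of_continuous (by unfold sphExp; fun_prop)) (hI i)]
    congr 1
    refine integral_congr_ae (.of_forall fun ω => ?_)
    simp only [← Finset.sum_mul, ← one_sub_mul]
    congr 1
    have h1 : ∑ k, ((ω : Euc d) k) ^ 2 = 1 := by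
      have := EuclideanSpace.norm_sq_eq (ω : Euc d)
      simp only [norm_eq_of_mem_sphere, one_pow, Real.norm_eq_abs, sq_abs] at this
      exact this.symm
    have h2 : ∑ k, ((ω : Euc d) k : ℂ) ^ 2 = 1 := by exact_mod_cast h1
    rw [← h2, ← Finset.add_sum_erase _ _ (Finset.mem_univ i)]
    ring
  have hcard : ((Finset.univ.erase i).card : ℂ) = d - 1 := by
    rw [Finset.card_erase_of_mem (Finset.mem_univ i), Finset.card_univ, Fintype.card_fin,
      Nat.cast_sub (Nat.one_le_of_lt i.2), Nat.cast_one]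
  rw [Finset.sum_const, nsmul_eq_mul, hcard] at hsum
  have h6 : ∫ ω : Metric.sphere (0 : Euc d) 1,
      ((ω : Euc d) i : ℂ) * (2 * π * I * (((ω : Euc d) i : ℂ) * sphExp i s ω)) ∂sph d =
      2 * π * I * ∫ ω : Metric.sphere (0 : Euc d) 1, ((ω : Euc d) i : ℂ) ^ 2 * sphExp i s ω ∂sph
        d := by
    rw [← integral_const_mul]
    congr 1
    ext ω
    ring
  rw [h6]
  push_cast
  field_simp
  linear_combination hsum

/-- The Fourier transform of surface measure is radial. -/
lemma integral_sphere_exp_inner (i : Fin d) (x : Euc d) (r : ℝ) :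
    ∫ ω : Metric.sphere (0 : Euc d) 1,
      Complex.exp (2 * π * (r * inner ℝ x (ω : Euc d) : ℝ) * I) ∂sph d = sphJ i (r * ‖x‖) := by
  let y : Euc d := EuclideanSpace.single i ‖x‖
  have hy : ‖x‖ = ‖y‖ := by simp [y]
  have hR := Submodule.reflection_sub (F := Euc d) hy
  set R := Submodule.reflection (ℝ ∙ (x - y))ᗮ
  have hv : ∀ v : Euc d, inner ℝ x (R v) = ‖x‖ * v i := fun v => by
    have h1 : R (R x) = x := Submodule.reflection_reflection _ _
    rw [← R.inner_map_map, Submodule.reflection_reflection, hR]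
    simp [y, EuclideanSpace.inner_single_left]
  rw [← integral_sphere_comp_isometry R
    (fun v : Euc d => Complex.exp (2 * π * (r * inner ℝ x v : ℝ) * I)), sphJ]
  refine integral_congr_ae (.of_forall fun ω => ?_)
  simp only [hv, sphExp]
  push_cast
  ring_nf

end

lemma integral_Ioi_pow_mul_eq {G : ℝ → ℂ} {lam : ℝ} (hl : 0 < lam)
    (hG : ∀ v, v ∉ Set.Icc (3 / 8 : ℝ) 3 → G (lam * v) = 0) (n : ℕ) :
    ∫ r in Set.Ioi (0 : ℝ), (r : ℂ) ^ n * G r =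
      lam ^ (n + 1) * ∫ v in (1 / 3 : ℝ)..(7 / 2), (v : ℂ) ^ n * G (lam * v) := by
  have h1 := integral_comp_mul_left_Ioi (fun r : ℝ => (r : ℂ) ^ n * G r) 0 hl
  rw [mul_zero, eq_inv_smul_iff₀ hl.ne'] at h1
  rw [← h1, intervalIntegral.integral_of_le (by norm_num), ← integral_const_mul,
    setIntegral_eq_of_subset_of_forall_sdiff_eq_zero measurableSet_Ioi
    (s := Set.Ioc (1 / 3 : ℝ) (7 / 2)) (fun v hv => lt_trans (by norm_num) hv.1), ← integral_smul]
  · refine integral_congr_ae (.of_forall fun v => ?_)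
    simp only [real_smul]
    push_cast
    ring
  · intro v hv
    rw [hG v fun h => hv.2 ⟨by linarith [h.1], by linarith [h.2]⟩, mul_zero]

lemma continuous_tanh_real : Continuous Real.tanh := by
  have : Real.tanh = fun x => Real.sinh x / Real.cosh x := funext Real.tanh_eq_sinh_div_cosh
  rw [this]
  exact Real.continuous_sinh.div Real.continuous_cosh fun x => (Real.cosh_pos x).ne'

lemma continuous_mSymb (β : ℝ) : Continuous (mSymb β) := by
  have := continuous_tanh_real
  unfold mSymb
  fun_prop

/-- The frequency localised propagator, as a function on the Fourier side. -/
def freqProp (β : ℝ) (Ψ : ℝ → ℝ) (lam t r : ℝ) : ℂ :=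
  Complex.exp (-(t * mSymb β r * I)) * Ψ (r / lam)

/-- The convolution kernel of the frequency localised propagator. -/
def kernel (β : ℝ) (d : ℕ) (Ψ : ℝ → ℝ) (lam t : ℝ) (x : Euc d) : ℂ :=
  ∫ ξ : Euc d, Complex.exp (2 * π * (inner ℝ x ξ : ℝ) * I) * freqProp β Ψ lam t ‖ξ‖

section

variable {β : ℝ} {d : ℕ} {Ψ : ℝ → ℝ} (hΨ : ContDiff ℝ (⊤ : ℕ∞) Ψ)
  (hs : ∀ v, v ∉ Set.Icc (3 / 8 : ℝ) 3 → Ψ v = 0)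

include hΨ in
lemma continuous_freqProp (lam t : ℝ) : Continuous (freqProp β Ψ lam t) := by
  have h1 := continuous_mSymb β
  have h2 := hΨ.continuous
  unfold freqProp
  fun_prop

include hs in
lemma freqProp_eq_zero {lam : ℝ} (hl : 0 < lam) (t : ℝ) {v : ℝ}
    (hv : v ∉ Set.Icc (3 / 8 : ℝ) 3) : freqProp β Ψ lam t (lam * v) = 0 := by
  rw [freqProp, mul_div_cancel_left₀ _ hl.ne', hs v hv, ofReal_zero, mul_zero]

include hs in
lemma freqProp_eq_zero_of_gt {lam : ℝ} (hl : 0 < lam) (t : ℝ) {r : ℝ}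
    (hr : 3 * lam < r) : freqProp β Ψ lam t r = 0 := by
  have h := freqProp_eq_zero (β := β) hs hl t (v := r / lam) fun h => by
    have := h.2
    rw [div_le_iff₀ hl] at this
    linarith
  rwa [mul_div_cancel₀ _ hl.ne'] at h

include hs in
lemma hasCompactSupport_of_mul_freqProp {lam : ℝ} (hl : 0 < lam) (t : ℝ) (g : Euc d → ℂ) :
    HasCompactSupport fun ξ : Euc d => g ξ * freqProp β Ψ lam t ‖ξ‖ :=
  HasCompactSupport.intro (isCompact_closedBall (0 : Euc d) (3 * lam)) fun ξ hξ => by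
    rw [Metric.mem_closedBall, dist_zero_right, not_le] at hξ
    rw [freqProp_eq_zero_of_gt hs hl t hξ, mul_zero]

include hΨ hs in
lemma integrable_mul_freqProp {lam : ℝ} (hl : 0 < lam) (t : ℝ) {g : Euc d → ℂ}
    (hg : Continuous g) : Integrable fun ξ : Euc d => g ξ * freqProp β Ψ lam t ‖ξ‖ :=
  (hg.mul ((continuous_freqProp hΨ lam t).comp continuous_norm)).integrable_of_hasCompactSupport
    (hasCompactSupport_of_mul_freqProp hs hl t g)

lemma freqProp_mul (hβ : 0 ≤ β) {lam : ℝ} (hl : 0 < lam) (t v : ℝ) :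
    freqProp β Ψ lam t (lam * v) =
      Complex.exp (-((t * mSymb β lam : ℝ) * phase β lam v * I)) * Ψ v := by
  rw [freqProp, mul_div_cancel_left₀ _ hl.ne', phase]
  have : (mSymb β lam : ℂ) ≠ 0 := by exact_mod_cast (mSymb_pos hβ hl).ne'
  congr 2
  push_cast
  field_simp

include hΨ hs in
lemma kernel_eq_sphere (hβ : 0 ≤ β) (hd : 1 ≤ d) {lam : ℝ} (hl : 0 < lam) (t : ℝ) (x : Euc d) :
    kernel β d Ψ lam t x = ∫ ω : Metric.sphere (0 : Euc d) 1, ((lam : ℂ) ^ d *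
      ∫ v in (1 / 3 : ℝ)..(7 / 2),
        Complex.exp ((2 * π * lam * (inner ℝ x (ω : Euc d) : ℝ) * v -
          t * mSymb β lam * phase β lam v : ℝ) * I) * (v ^ (d - 1) * Ψ v)) ∂sph d := by
  have : NeZero d := ⟨by omega⟩
  rw [kernel, integral_eq_integral_sphere_integral _
    (integrable_mul_freqProp hΨ hs hl t (by fun_prop))]
  refine integral_congr_ae (.of_forall fun ω => ?_)
  simp only [finrank_euclideanSpace, Fintype.card_fin]
  have h1 : ∀ r ∈ Set.Ioi (0 : ℝ), (r : ℂ) ^ (d - 1) *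
      (Complex.exp (2 * π * (inner ℝ x (r • (ω : Euc d)) : ℝ) * I) *
        freqProp β Ψ lam t ‖r • (ω : Euc d)‖) = (r : ℂ) ^ (d - 1) *
      (Complex.exp (2 * π * (r * inner ℝ x (ω : Euc d) : ℝ) * I) *
        freqProp β Ψ lam t r) := fun r hr => by
    rw [norm_smul, norm_eq_of_mem_sphere, mul_one, Real.norm_of_nonneg (le_of_lt hr),
      inner_smul_right]
  rw [setIntegral_congr_fun measurableSet_Ioi h1, integral_Ioi_pow_mul_eq
    (G := fun r => Complex.exp (2 * π * (r * inner ℝ x (ω : Euc d) : ℝ) * I) *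
        freqProp β Ψ lam t r) hl fun v hv => by rw [freqProp_eq_zero hs hl t hv, mul_zero]]
  rw [Nat.sub_add_cancel hd]
  congr 1
  refine intervalIntegral.integral_congr fun v _ => ?_
  rw [freqProp_mul hβ hl, sub_eq_add_neg, ofReal_add, add_mul, Complex.exp_add]
  push_cast
  ring_nf

include hΨ hs in
lemma kernel_eq_radial (hβ : 0 ≤ β) (i : Fin d) {lam : ℝ} (hl : 0 < lam) (t : ℝ) (x : Euc d) :
    kernel β d Ψ lam t x = (lam : ℂ) ^ d *
      ∫ v in (1 / 3 : ℝ)..(7 / 2), (v : ℂ) ^ (d - 1) * (sphJ i (lam * ‖x‖ * v) *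
        (Complex.exp (-((t * mSymb β lam : ℝ) * phase β lam v * I)) * Ψ v)) := by
  have hd : 1 ≤ d := Nat.one_le_of_lt i.2
  have : NeZero d := ⟨by omega⟩
  rw [kernel, integral_eq_integral_integral_sphere _
    (integrable_mul_freqProp hΨ hs hl t (by fun_prop))]
  simp only [finrank_euclideanSpace, Fintype.card_fin]
  have h1 : ∀ r ∈ Set.Ioi (0 : ℝ), (r : ℂ) ^ (d - 1) * (∫ ω : Metric.sphere (0 : Euc d) 1,
      (Complex.exp (2 * π * (inner ℝ x (r • (ω : Euc d)) : ℝ) * I) *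
        freqProp β Ψ lam t ‖r • (ω : Euc d)‖) ∂sph d) = (r : ℂ) ^ (d - 1) *
      (sphJ i (r * ‖x‖) * freqProp β Ψ lam t r) := fun r hr => by
    rw [← integral_sphere_exp_inner i x r, ← integral_mul_const]
    congr 1
    refine integral_congr_ae (.of_forall fun ω => ?_)
    simp only []
    rw [norm_smul, norm_eq_of_mem_sphere, mul_one, Real.norm_of_nonneg (le_of_lt hr),
      inner_smul_right]
  rw [setIntegral_congr_fun measurableSet_Ioi h1, integral_Ioi_pow_mul_eq
    (G := fun r => sphJ i (r * ‖x‖) * freqProp β Ψ lam t r) hl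
    fun v hv => by rw [freqProp_eq_zero hs hl t hv, mul_zero], Nat.sub_add_cancel hd]
  congr 1
  refine intervalIntegral.integral_congr fun v _ => ?_
  rw [freqProp_mul hβ hl, mul_right_comm]

end

section

variable {β : ℝ} {d : ℕ} {Ψ : ℝ → ℝ} (hΨ : ContDiff ℝ (⊤ : ℕ∞) Ψ)
  (hs : ∀ v, v ∉ Set.Icc (3 / 8 : ℝ) 3 → Ψ v = 0)

include hΨ hs in
lemma norm_kernel_le_of_sphere (hβ : 0 ≤ β) (hd : 1 ≤ d) {lam : ℝ} (hl : 0 < lam) (t : ℝ)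
    (x : Euc d) {B : ℝ} (hB : ∀ ω : Metric.sphere (0 : Euc d) 1,
      ‖∫ v in (1 / 3 : ℝ)..(7 / 2),
        Complex.exp ((2 * π * lam * (inner ℝ x (ω : Euc d) : ℝ) * v -
          t * mSymb β lam * phase β lam v : ℝ) * I) * (v ^ (d - 1) * Ψ v)‖ ≤ B) :
    ‖kernel β d Ψ lam t x‖ ≤ (sph d).real Set.univ * (lam ^ d * B) := by
  rw [kernel_eq_sphere hΨ hs hβ hd hl]
  refine (norm_integral_le_of_norm_le_const (μ := sph d) (.of_forall fun ω => ?_)).trans_eq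
    (mul_comm _ _)
  rw [norm_mul, norm_pow, Complex.norm_real, Real.norm_of_nonneg hl.le]
  exact mul_le_mul_of_nonneg_left (hB ω) (by positivity)

include hΨ hs in
lemma norm_kernel_le_pow (hβ : 0 ≤ β) (hd : 1 ≤ d) : ∃ C > 0, ∀ lam > 0, ∀ (t : ℝ) (x : Euc d),
    ‖kernel β d Ψ lam t x‖ ≤ C * lam ^ d := by
  obtain ⟨M, hM⟩ := (isCompact_Icc (a := (1 / 3 : ℝ)) (b := 7 / 2)).exists_bound_of_continuousOn
    (f := fun v : ℝ => v ^ (d - 1) * Ψ v) (by have := hΨ.continuous; fun_prop)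
  have hM0 : 0 ≤ M := (norm_nonneg _).trans (hM 1 ⟨by norm_num, by norm_num⟩)
  refine ⟨(sph d).real Set.univ * (M * |7 / 2 - 1 / 3|) + 1, by positivity,
    fun lam hl t x => ?_⟩
  refine (norm_kernel_le_of_sphere hΨ hs hβ hd hl t x (B := M * |7 / 2 - 1 / 3|)
    fun ω => ?_).trans ?_
  · refine intervalIntegral.norm_integral_le_of_norm_le_const fun v hv => ?_
    rw [norm_mul, Complex.norm_exp_ofReal_mul_I, one_mul]
    rw [Set.uIoc_of_le (by norm_num)] at hv
    have := hM v ⟨hv.1.le, hv.2⟩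
    rw [Real.norm_eq_abs] at this
    rwa [← ofReal_pow, ← ofReal_mul, Complex.norm_real]
  · have : 0 ≤ lam ^ d := by positivity
    nlinarith

include hΨ hs in
lemma norm_kernel_le_near (hβ : 0 ≤ β) (hd : 1 ≤ d) : ∃ C, ∀ lam > 0, ∀ t > 0, ∀ x : Euc d,
    2 * π * (lam * ‖x‖) ≤ t * mSymb β lam / 256 →
    ‖kernel β d Ψ lam t x‖ ≤ C * (lam ^ d * ((t * mSymb β lam) ^ d)⁻¹) := by
  let ι := Set.Ioi (0 : ℝ) × Set.Icc (-(1 / 256) : ℝ) (1 / 256)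
  have hb : ∀ i : ι, |(i.2 : ℝ)| ≤ 1 / 256 := fun i => abs_le.2 i.2.2
  obtain ⟨C, hC⟩ := norm_integral_exp_mul_le_of_nonstationary (ι := ι) (n := d)
    (φ := fun i v => i.2 * v - phase β i.1 v) (p := fun i v => i.2 - phaseDeriv β i.1 v)
    (fun i v hv => by
      have h := ((hasDerivAt_id v).const_mul (i.2 : ℝ)).sub
        (hasDerivAt_phase hβ i.1.2 (v := v) (by linarith [hv.1]))
      refine h.congr_deriv ?_
      rw [mul_one]; rfl)
    (by
      have h1 : UnifSmooth d fun (i : ι) (_ : ℝ) => ((i.2 : ℝ) : ℂ) :=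
        UnifSmooth.const (C := 1 / 256) fun i => by
          rw [Complex.norm_real]; exact hb i
      have h2 := (unifSmooth_phaseDeriv hβ d).comp (κ := ι) Prod.fst
      simpa using h1.sub h2)
    (c := 1 / 256) (by norm_num)
    (fun i v hv => by
      have h1 := phaseDeriv_ge hβ i.1.2 hv
      have h2 := (abs_le.1 (hb i)).2
      rw [abs_sub_comm]
      refine le_trans ?_ (le_abs_self _)
      linarith)
    (a := fun _ v => (v : ℂ) ^ (d - 1) * Ψ v)
    ((UnifSmooth.ofReal_id.pow _).mul (UnifSmooth.of_contDiff hΨ))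
    (fun i v hv => by rw [hs v hv]; simp)
  refine ⟨(sph d).real Set.univ * C, fun lam hl t ht x hx => ?_⟩
  have hT : 0 < t * mSymb β lam := mul_pos ht (mSymb_pos hβ hl)
  set T := t * mSymb β lam with hTdef
  refine (norm_kernel_le_of_sphere hΨ hs hβ hd hl t x (B := C * (T ^ d)⁻¹)
    fun ω => ?_).trans (le_of_eq (by ring))
  have hin : |2 * π * lam * (inner ℝ x (ω : Euc d) : ℝ)| ≤ T / 256 := by
    refine le_trans ?_ hx
    rw [abs_mul, abs_of_pos (by positivity), mul_assoc, mul_assoc, mul_assoc]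
    have := abs_real_inner_le_norm x (ω : Euc d)
    rw [norm_eq_of_mem_sphere, mul_one] at this
    gcongr
  rw [abs_le] at hin
  have key := hC (⟨lam, hl⟩, ⟨2 * π * lam * (inner ℝ x (ω : Euc d) : ℝ) / T, by
    rw [Set.mem_Icc, le_div_iff₀ hT, div_le_iff₀ hT]
    constructor <;> linarith [hin.1, hin.2]⟩) T hT
  refine le_trans (le_of_eq ?_) key
  congr 1
  refine intervalIntegral.integral_congr fun v _ => ?_
  have hTc : (T : ℂ) ≠ 0 := by exact_mod_cast hT.ne'
  simp only []
  congr 2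
  push_cast
  field_simp
  rw [hTdef]
  push_cast
  ring

lemma continuousOn_phase_second_deriv (hβ : 0 ≤ β) {lam : ℝ} (hl : 0 < lam) :
    ContinuousOn (fun v => phase β lam v * symG β (lam * v) / v ^ 2) (Set.Ioi 0) := by
  intro v hv
  have hv : 0 < v := hv
  have hlv : 0 < lam * v := mul_pos hl hv
  have hm : ContinuousAt (fun v : ℝ => lam * v) v := by fun_prop
  have h1 := (hasDerivAt_phase hβ hl hv).continuousAt
  have h2 : ContinuousAt (fun v => symK (lam * v)) v :=
    ContinuousAt.comp (hasDerivAt_symK hlv).continuousAt hm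
  have h3 : ContinuousAt (fun v => symC (lam * v)) v :=
    ContinuousAt.comp (hasDerivAt_symC hlv).continuousAt hm
  have h4 : ContinuousAt (fun v => symU β (lam * v)) v :=
    ContinuousAt.comp (hasDerivAt_symU hβ hlv).continuousAt hm
  refine ContinuousAt.continuousWithinAt ?_
  unfold symG symH
  have : v ^ 2 ≠ 0 := by positivity
  fun_prop (disch := assumption)


lemma norm_integral_exp_phase_mul_le (hβ : 0 ≤ β) {lam : ℝ} (hl : 0 < lam) {Λ T X b s₀ M C : ℝ}
    (hT : 0 < T) (hΛ : 0 < Λ) (hs₀ : 0 < s₀) (hX : s₀ ≤ X / 3)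
    (hconv : (∀ v ∈ Set.Ioo (1 / 4 : ℝ) 4, Λ ≤ phase β lam v * symG β (lam * v) / v ^ 2) ∨
      ∀ v ∈ Set.Ioo (1 / 4 : ℝ) 4, Λ ≤ -(phase β lam v * symG β (lam * v) / v ^ 2))
    {g g' : ℝ → ℝ} (hg : ∀ v, 0 < v → HasDerivAt g (g' v) v)
    (hg' : ContinuousOn g' (Set.Icc (1 / 3) (7 / 2)))
    (hM : ∀ v ∈ Set.Icc (1 / 3 : ℝ) (7 / 2), |g v| ≤ M ∧ |g' v| ≤ M)
    (hg0 : g (1 / 3) = 0) (hg1 : g (7 / 2) = 0)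
    {A A' : ℝ → ℂ} (hA : ∀ s, 0 < s → HasDerivAt A (A' s) s)
    (hA' : ContinuousOn A' (Set.Ioi 0)) (hAb : ∀ s, s₀ ≤ s → ‖A s‖ ≤ C ∧ ‖A' s‖ ≤ C / s ^ 2) :
    ‖∫ v in (1 / 3 : ℝ)..(7 / 2), Complex.exp ((b * v - T * phase β lam v : ℝ) * I) *
      (g v * A (X * v))‖ ≤ (M * C * (2 * π + (1 + 3 / s₀) * (7 / 2 - 1 / 3))) / √(T * Λ) := by
  have hX0 : 0 < X := by linarith
  have hmem : ∀ v ∈ Set.Icc (1 / 3 : ℝ) (7 / 2), v ∈ Set.Ioo (1 / 4 : ℝ) 4 ∧ 0 < v :=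
    fun v hv => ⟨⟨by linarith [hv.1], by linarith [hv.2]⟩, by linarith [hv.1]⟩
  have hXv : ∀ v ∈ Set.Icc (1 / 3 : ℝ) (7 / 2), s₀ ≤ X * v ∧ 0 < X * v := fun v hv => by
    have : s₀ ≤ X * v := by nlinarith [hv.1]
    exact ⟨this, by linarith⟩
  have hM0 : 0 ≤ M := (abs_nonneg _).trans (hM 1 ⟨by norm_num, by norm_num⟩).1
  have hC0 : 0 ≤ C := (norm_nonneg _).trans (hAb s₀ le_rfl).1
  have hcomp : ∀ v ∈ Set.Icc (1 / 3 : ℝ) (7 / 2),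
      HasDerivAt (fun v => A (X * v)) (X * A' (X * v)) v := fun v hv => by
    have h := (hA (X * v) (hXv v hv).2).scomp v ((hasDerivAt_id v).const_mul X)
    simpa [Function.comp_def] using h
  have key := norm_integral_exp_mul_le_of_second_deriv (a := 1 / 3) (b := 7 / 2) (Λ := T * Λ)
    (M := M * C) (M₁ := M * C * (1 + 3 / s₀)) (by norm_num) (by positivity)
    (φ := fun v => b * v - T * phase β lam v) (p := fun v => b - T * phaseDeriv β lam v)
    (p' := fun v => -(T * (phase β lam v * symG β (lam * v) / v ^ 2)))
    (ψ := fun v => g v * A (X * v))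
    (ψ' := fun v => g' v * A (X * v) + g v * (X * A' (X * v)))
    (fun v hv => by
      have h := ((hasDerivAt_id v).const_mul b).sub
        ((hasDerivAt_phase hβ hl (hmem v hv).2).const_mul T)
      refine h.congr_deriv ?_
      rw [mul_one]; rfl)
    (fun v hv => by
      have h := ((hasDerivAt_phaseDeriv hβ hl (hmem v hv).2).const_mul T).const_sub b
      exact h)
    ((continuousOn_const.mul ((continuousOn_phase_second_deriv hβ hl).mono
      fun v hv => (hmem v hv).2)).neg)
    (by
      rcases hconv with h | h
      · right
        intro v hv
        rw [neg_neg]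
        exact mul_le_mul_of_nonneg_left (h v (hmem v hv).1) hT.le
      · left
        intro v hv
        rw [← mul_neg]
        exact mul_le_mul_of_nonneg_left (h v (hmem v hv).1) hT.le)
    (fun v hv => (hg v (hmem v hv).2).ofReal_comp.mul (hcomp v hv))
    (by
      have h1 : ContinuousOn (fun v => A (X * v)) (Set.Icc (1 / 3 : ℝ) (7 / 2)) :=
        fun v hv => (hcomp v hv).continuousAt.continuousWithinAt
      have h2 : ContinuousOn (fun v => A' (X * v)) (Set.Icc (1 / 3 : ℝ) (7 / 2)) :=
        hA'.comp (by fun_prop) fun v hv => (hXv v hv).2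
      have h3 : ContinuousOn g (Set.Icc (1 / 3 : ℝ) (7 / 2)) :=
        fun v hv => (hg v (hmem v hv).2).continuousAt.continuousWithinAt
      have h4 := Complex.continuous_ofReal.comp_continuousOn h3
      have h5 := Complex.continuous_ofReal.comp_continuousOn hg'
      exact (h5.mul h1).add (h4.mul (continuousOn_const.mul h2)))
    (fun v hv => by
      rw [norm_mul, Complex.norm_real]
      exact mul_le_mul (hM v hv).1 (hAb _ (hXv v hv).1).1 (norm_nonneg _) hM0)
    (fun v hv => by
      have h1 : ‖(g' v : ℂ) * A (X * v)‖ ≤ M * C := by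
        rw [norm_mul, Complex.norm_real]
        exact mul_le_mul (hM v hv).2 (hAb _ (hXv v hv).1).1 (norm_nonneg _) hM0
      have h3 : X * ‖A' (X * v)‖ ≤ C * (3 / s₀) := by
        have h4 := (hAb _ (hXv v hv).1).2
        have hv0 := (hmem v hv).2
        calc X * ‖A' (X * v)‖ ≤ X * (C / (X * v) ^ 2) := by gcongr
          _ = C * ((1 / v) / (X * v)) := by field_simp
          _ ≤ C * (3 / s₀) := by
            have : 1 / v ≤ 3 := by
              rw [div_le_iff₀ hv0]; linarith [hv.1]
            have := (hXv v hv).1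
            gcongr
      have h2 : ‖(g v : ℂ) * (X * A' (X * v))‖ ≤ M * (C * (3 / s₀)) := by
        rw [norm_mul, norm_mul, Complex.norm_real, Complex.norm_real, Real.norm_of_nonneg hX0.le]
        exact mul_le_mul (hM v hv).1 h3 (by positivity) hM0
      refine (norm_add_le _ _).trans ((add_le_add h1 h2).trans (le_of_eq ?_))
      ring)
    (by rw [hg0]; simp) (by rw [hg1]; simp)
  refine key.trans (le_of_eq ?_)
  ring

end

lemma jap_pos (x : ℝ) : 0 < jap x := Real.sqrt_pos.2 (by positivity)

lemma jap_sq (x : ℝ) : jap x ^ 2 = 1 + x ^ 2 := Real.sq_sqrt (by positivity)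

section

variable {β : ℝ} {d : ℕ} {Ψ : ℝ → ℝ} (hΨ : ContDiff ℝ (⊤ : ℕ∞) Ψ)
  (hs : ∀ v, v ∉ Set.Icc (3 / 8 : ℝ) 3 → Ψ v = 0)

include hΨ hs in
lemma norm_kernel_le_far (hβ : β = 0 ∨ β = 1) (hd : 1 ≤ d) : ∃ C > 0, ∀ lam > 0, ∀ t > 0,
    ∀ x : Euc d, 1 ≤ t * mSymb β lam → t * mSymb β lam / 256 ≤ 2 * π * (lam * ‖x‖) →
    ‖kernel β d Ψ lam t x‖ ≤
      C * (lam ^ d * (t * mSymb β lam) ^ (-((d : ℝ) / 2)) * (jap lam / lam)) := by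
  have hβ0 : 0 ≤ β := by rcases hβ with h | h <;> simp [h]
  set α : ℝ := ((d : ℝ) - 1) / 2 with hα
  have hα0 : 0 ≤ α := by
    have : (1 : ℝ) ≤ d := by exact_mod_cast hd
    rw [hα]; linarith
  let i : Fin d := ⟨0, by omega⟩
  set s₀ : ℝ := 1 / (1536 * π) with hs₀def
  have hs₀ : 0 < s₀ := by positivity
  obtain ⟨A₁, A₂, A₁', A₂', C, hJ, hA₁, hA₂, hA₁', hA₂', hb⟩ :=
    exists_slowly_varying_amplitudes (J := sphJ i) (J₁ := sphJ₁ i) (α := α) hs₀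
      (fun s _ => hasDerivAt_sphJ i s) (fun s hs => by
        have := hasDerivAt_sphJ₁ i hs
        rwa [← hα] at this)
  obtain ⟨c, hc, hsec⟩ := phase_second_deriv_bounds hβ
  set g : ℝ → ℝ := fun v => v ^ α * Ψ v with hgdef
  set g' : ℝ → ℝ := fun v => α * v ^ (α - 1) * Ψ v + v ^ α * deriv Ψ v with hg'def
  have hg : ∀ v, 0 < v → HasDerivAt g (g' v) v := fun v hv =>
    (Real.hasDerivAt_rpow_const (p := α) (Or.inl hv.ne')).mul
      ((hΨ.differentiable (by simp)).differentiableAt.hasDerivAt)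
  have hgc : ContinuousOn g (Set.Icc (1 / 3) (7 / 2)) := fun v hv =>
    (hg v (by linarith [hv.1])).continuousAt.continuousWithinAt
  have hrp : ∀ p : ℝ, ContinuousOn (fun v : ℝ => v ^ p) (Set.Icc (1 / 3) (7 / 2)) := fun p v hv =>
    (Real.continuousAt_rpow_const _ _ (Or.inl (by linarith [hv.1]))).continuousWithinAt
  have hg' : ContinuousOn g' (Set.Icc (1 / 3) (7 / 2)) :=
    ((continuousOn_const.mul (hrp _)).mul hΨ.continuous.continuousOn).add
      ((hrp _).mul (hΨ.continuous_deriv (by simp)).continuousOn)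
  obtain ⟨M₀, hM₀⟩ := isCompact_Icc.exists_bound_of_continuousOn hgc
  obtain ⟨M₁, hM₁⟩ := isCompact_Icc.exists_bound_of_continuousOn hg'
  set M := max M₀ M₁
  have hM : ∀ v ∈ Set.Icc (1 / 3 : ℝ) (7 / 2), |g v| ≤ M ∧ |g' v| ≤ M := fun v hv =>
    ⟨(hM₀ v hv).trans (le_max_left _ _), (hM₁ v hv).trans (le_max_right _ _)⟩
  have hg0 : g (1 / 3) = 0 := by
    simp only [hgdef]; rw [hs _ (fun h => by linarith [h.1]), mul_zero]
  have hg1 : g (7 / 2) = 0 := by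
    simp only [hgdef]; rw [hs _ (fun h => by linarith [h.2]), mul_zero]
  set K := M * C * (2 * π + (1 + 3 / s₀) * (7 / 2 - 1 / 3))
  refine ⟨2 * |K| * ((512 * π) ^ α * (√c)⁻¹) + 1, by positivity, fun lam hl t ht x hT1 hX => ?_⟩
  have hm := mSymb_pos hβ0 hl
  have hT : 0 < t * mSymb β lam := mul_pos ht hm
  set T := t * mSymb β lam with hTdef
  set X := lam * ‖x‖ with hXdef
  have hXT : T / (512 * π) ≤ X := by
    rw [div_le_iff₀ (by positivity)]
    linarith
  have hX3 : s₀ ≤ X / 3 := by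
    have : 1 / (512 * π) ≤ X := le_trans (by gcongr) hXT
    have h2 : s₀ = 1 / (512 * π) / 3 := by rw [hs₀def]; field_simp; norm_num
    rw [h2]; linarith
  have hX0 : 0 < X := by linarith
  set Λ := c * (lam ^ 2 / (1 + lam ^ 2))
  have hΛ : 0 < Λ := by positivity
  have e₁ := norm_integral_exp_phase_mul_le hβ0 hl (b := 2 * π * X) hT hΛ hs₀ hX3 (hsec lam hl)
    hg hg' hM hg0 hg1 hA₁ hA₁' (fun s hs => ⟨(hb s hs).1, (hb s hs).2.2.1⟩)
  have e₂ := norm_integral_exp_phase_mul_le hβ0 hl (b := -(2 * π * X)) hT hΛ hs₀ hX3 (hsec lam hl)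
    hg hg' hM hg0 hg1 hA₂ hA₂' (fun s hs => ⟨(hb s hs).2.1, (hb s hs).2.2.2⟩)
  have hcont : ∀ (b : ℝ) (A A' : ℝ → ℂ), (∀ s, 0 < s → HasDerivAt A (A' s) s) →
      IntervalIntegrable (fun v : ℝ => Complex.exp ((b * v - T * phase β lam v : ℝ) * I) *
        (g v * A (X * v))) volume (1 / 3) (7 / 2) := fun b A A' hA => by
    refine ContinuousOn.intervalIntegrable ?_
    rw [Set.uIcc_of_le (by norm_num)]
    have h1 : ContinuousOn (fun v => phase β lam v) (Set.Icc (1 / 3) (7 / 2)) := fun v hv =>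
      (hasDerivAt_phase hβ0 hl (by linarith [hv.1])).continuousAt.continuousWithinAt
    have h2 : ContinuousOn (fun v => A (X * v)) (Set.Icc (1 / 3) (7 / 2)) := fun v hv =>
      (ContinuousAt.comp (f := fun v : ℝ => X * v)
        (hA (X * v) (mul_pos hX0 (by linarith [hv.1]))).continuousAt
        (by fun_prop)).continuousWithinAt
    have h3 : ContinuousOn (fun v => b * v - T * phase β lam v) (Set.Icc (1 / 3) (7 / 2)) := by
      fun_prop
    exact (((Complex.continuous_ofReal.comp_continuousOn h3).mul continuousOn_const).cexp).mul
      ((Complex.continuous_ofReal.comp_continuousOn hgc).mul h2)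
  have hdec : kernel β d Ψ lam t x = (lam : ℂ) ^ d * (((X ^ (-α) : ℝ) : ℂ) *
      ((∫ v in (1 / 3 : ℝ)..(7 / 2), Complex.exp ((2 * π * X * v - T * phase β lam v : ℝ) * I) *
        (g v * A₁ (X * v))) +
      ∫ v in (1 / 3 : ℝ)..(7 / 2), Complex.exp ((-(2 * π * X) * v - T * phase β lam v : ℝ) * I) *
        (g v * A₂ (X * v)))) := by
    rw [kernel_eq_radial hΨ hs hβ0 i hl, ← intervalIntegral.integral_add (hcont _ _ _ hA₁)
      (hcont _ _ _ hA₂), ← intervalIntegral.integral_const_mul (((X ^ (-α) : ℝ) : ℂ))]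
    refine congrArg (fun z : ℂ => (lam : ℂ) ^ d * z)
      (intervalIntegral.integral_congr fun v hv => ?_)
    rw [Set.uIcc_of_le (by norm_num)] at hv
    have hv0 : 0 < v := by linarith [hv.1]
    have hj := hJ (X * v) (mul_pos hX0 hv0)
    have hp : (v : ℂ) ^ (d - 1) = ((v ^ α : ℝ) : ℂ) * ((v ^ α : ℝ) : ℂ) := by
      rw [← ofReal_mul, ← Real.rpow_add hv0, ← ofReal_pow, ← Real.rpow_natCast,
        Nat.cast_sub hd]
      congr 2
      rw [hα, Nat.cast_one]; ring
    have hxx : ((X ^ (-α) : ℝ) : ℂ) * ((X ^ α : ℝ) : ℂ) = 1 := by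
      rw [← ofReal_mul, ← Real.rpow_add hX0]; simp
    rw [Real.mul_rpow hX0.le hv0.le] at hj
    simp only [hgdef]
    have ex₁ : Complex.exp ((2 * π * X * v - T * phase β lam v : ℝ) * I) =
        Complex.exp (2 * π * (X * v : ℝ) * I) * Complex.exp (-(T * phase β lam v * I)) := by
      rw [← Complex.exp_add]; congr 1; push_cast; ring
    have ex₂ : Complex.exp ((-(2 * π * X) * v - T * phase β lam v : ℝ) * I) =
        Complex.exp (-(2 * π * (X * v : ℝ) * I)) * Complex.exp (-(T * phase β lam v * I)) := by
      rw [← Complex.exp_add]; congr 1; push_cast; ring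
    rw [ex₁, ex₂, hp, ← hTdef, ← hXdef]
    push_cast at hj ⊢
    linear_combination (((X ^ (-α) : ℝ) : ℂ) * ((v ^ α : ℝ) : ℂ) *
      Complex.exp (-(T * phase β lam v * I)) * Ψ v) * hj -
      (sphJ i (X * v) * ((v ^ α : ℝ) : ℂ) ^ 2 * Complex.exp (-(T * phase β lam v * I)) * Ψ v) * hxx
  rw [hdec, norm_mul, norm_mul, norm_pow, Complex.norm_real, Complex.norm_real,
    Real.norm_of_nonneg hl.le, Real.norm_of_nonneg (Real.rpow_nonneg hX0.le _)]
  have hsum := (norm_add_le _ _).trans (add_le_add e₁ e₂)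
  have hXα : X ^ (-α) ≤ (512 * π) ^ α * T ^ (-α) := by
    calc X ^ (-α) ≤ (T / (512 * π)) ^ (-α) :=
          Real.rpow_le_rpow_of_nonpos (by positivity) hXT (by linarith)
      _ = (512 * π) ^ α * T ^ (-α) := by
          rw [Real.div_rpow hT.le (by positivity), Real.rpow_neg (by positivity : 0 ≤ 512 * π),
            div_inv_eq_mul, mul_comm]
  have hsq : √(T * Λ) = √T * (√c * (lam / jap lam)) := by
    rw [Real.sqrt_mul hT.le, Real.sqrt_mul hc.le, Real.sqrt_div (by positivity),
      Real.sqrt_sq hl.le, jap]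
  have hTd : T ^ (-((d : ℝ) / 2)) = T ^ (-α) * (√T)⁻¹ := by
    rw [Real.sqrt_eq_rpow, ← Real.rpow_neg hT.le, ← Real.rpow_add hT]
    congr 1
    rw [hα]; ring
  have hjl := jap_pos lam
  have hTs : 0 < √T := Real.sqrt_pos.2 hT
  have hcs : 0 < √c := Real.sqrt_pos.2 hc
  calc lam ^ d * (X ^ (-α) * _) ≤ lam ^ d * ((512 * π) ^ α * T ^ (-α) *
        (|K| / √(T * Λ) + |K| / √(T * Λ))) := by
        gcongr
        refine hsum.trans ?_
        gcongr <;> exact le_abs_self _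
    _ = 2 * |K| * ((512 * π) ^ α * (√c)⁻¹) * (lam ^ d * T ^ (-((d : ℝ) / 2)) * (jap lam / lam)) :=
      by
        rw [hsq, hTd]
        field_simp
        ring
    _ ≤ _ := by
        have : 0 ≤ lam ^ d * T ^ (-((d : ℝ) / 2)) * (jap lam / lam) := by positivity
        nlinarith

end

lemma div_jap_le_tanh {x : ℝ} (hx : 0 < x) : x / jap x ≤ Real.tanh x := by
  rw [Real.tanh_eq_sinh_div_cosh, div_le_div_iff₀ (jap_pos x) (Real.cosh_pos x)]
  have h1 : x ≤ Real.sinh x := Real.self_le_sinh_iff.2 hx.le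
  have h2 := Real.cosh_sq x
  have hj := jap_pos x
  refine abs_le_of_sq_le_sq' ?_ (mul_nonneg (by linarith) hj.le) |>.2
  rw [mul_pow, mul_pow, jap_sq, h2]
  nlinarith

lemma mSymb_ge {β : ℝ} (hβ : 0 ≤ β) {x : ℝ} (hx : 0 < x) :
    x * jap (√β * x) * jap x ^ (-(1 / 2) : ℝ) ≤ mSymb β x := by
  have hj := jap_pos x
  refine Real.le_sqrt_of_sq_le ?_
  have h1 : (jap x ^ (-(1 / 2) : ℝ)) ^ 2 = (jap x)⁻¹ := by
    rw [← Real.rpow_natCast, ← Real.rpow_mul hj.le, ← Real.rpow_neg_one]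
    norm_num
  rw [mul_pow, mul_pow, h1, jap_sq, mul_pow, Real.sq_sqrt hβ]
  have h2 := div_jap_le_tanh hx
  have h3 : 0 < 1 + β * x ^ 2 := by positivity
  calc x ^ 2 * (1 + β * x ^ 2) * (jap x)⁻¹ = x * (1 + β * x ^ 2) * (x / jap x) := by
        rw [div_eq_mul_inv]; ring
    _ ≤ _ := by gcongr

lemma cFactor_pos (β : ℝ) (d : ℕ) {lam : ℝ} (hl : 0 < lam) : 0 < cFactor β d lam := by
  have := jap_pos lam
  have := jap_pos (√β * lam)
  unfold cFactor
  positivity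

lemma pow_mul_rpow_le_cFactor {β : ℝ} (hβ : 0 ≤ β) (d : ℕ) {lam t : ℝ} (hl : 0 < lam)
    (ht : 0 < t) : lam ^ d * (t * mSymb β lam) ^ (-((d : ℝ) / 2)) * (jap lam / lam) ≤
      cFactor β d lam * t ^ (-((d : ℝ) / 2)) := by
  have hj := jap_pos lam
  have hj2 := jap_pos (√β * lam)
  have hm := mSymb_pos hβ hl
  have h1 : mSymb β lam ^ (-((d : ℝ) / 2)) ≤
      lam ^ (-((d : ℝ) / 2)) * jap (√β * lam) ^ (-((d : ℝ) / 2)) * jap lam ^ ((d : ℝ) / 4) := by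
    refine (Real.rpow_le_rpow_of_nonpos (by positivity) (mSymb_ge hβ hl)
      (by simp; positivity)).trans (le_of_eq ?_)
    rw [Real.mul_rpow (by positivity) (by positivity), Real.mul_rpow hl.le hj2.le,
      ← Real.rpow_mul hj.le]
    congr 2
    ring
  rw [Real.mul_rpow ht.le hm.le]
  calc lam ^ d * (t ^ (-((d : ℝ) / 2)) * mSymb β lam ^ (-((d : ℝ) / 2))) * (jap lam / lam)
      ≤ lam ^ d * (t ^ (-((d : ℝ) / 2)) * (lam ^ (-((d : ℝ) / 2)) *
        jap (√β * lam) ^ (-((d : ℝ) / 2)) * jap lam ^ ((d : ℝ) / 4))) * (jap lam / lam) := by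
        gcongr
    _ = _ := by
      have e1 : lam ^ ((d : ℝ) / 2 - 1) = lam ^ d * lam ^ (-((d : ℝ) / 2)) / lam := by
        rw [← Real.rpow_natCast, ← Real.rpow_add hl, ← Real.rpow_sub_one hl.ne']
        congr 1; ring
      have e2 : jap lam ^ ((d : ℝ) / 4 + 1) = jap lam ^ ((d : ℝ) / 4) * jap lam := by
        rw [Real.rpow_add hj, Real.rpow_one]
      rw [cFactor, e1, e2, neg_div]
      field_simp

section

variable {β : ℝ} {d : ℕ} {Ψ : ℝ → ℝ} (hΨ : ContDiff ℝ (⊤ : ℕ∞) Ψ)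
  (hs : ∀ v, v ∉ Set.Icc (3 / 8 : ℝ) 3 → Ψ v = 0)

lemma norm_kernel_neg (lam t : ℝ) (x : Euc d) :
    ‖kernel β d Ψ lam (-t) x‖ = ‖kernel β d Ψ lam t (-x)‖ := by
  rw [← RCLike.norm_conj (kernel β d Ψ lam t (-x)), kernel, kernel, ← integral_conj]
  congr 1
  refine integral_congr_ae (.of_forall fun ξ => ?_)
  simp only [freqProp, map_mul, ← Complex.exp_conj, map_neg, conj_ofReal, conj_I, inner_neg_left,
    map_ofNat]
  push_cast
  ring_nf

include hΨ hs in
/-- The dispersive estimate for the frequency localised propagator. -/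
theorem norm_kernel_le_dispersive (hβ : β = 0 ∨ β = 1) (hd : 1 ≤ d) : ∃ C > 0, ∀ lam > 0,
    ∀ t : ℝ, t ≠ 0 → ∀ x : Euc d,
    ‖kernel β d Ψ lam t x‖ ≤ C * (cFactor β d lam * |t| ^ (-((d : ℝ) / 2))) := by
  have hβ0 : 0 ≤ β := by rcases hβ with h | h <;> simp [h]
  obtain ⟨C₀, hC₀, h₀⟩ := norm_kernel_le_pow (d := d) hΨ hs hβ0 hd
  obtain ⟨C₁, h₁⟩ := norm_kernel_le_near (d := d) hΨ hs hβ0 hd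
  obtain ⟨C₂, hC₂, h₂⟩ := norm_kernel_le_far (d := d) hΨ hs hβ hd
  have main : ∀ lam > 0, ∀ t > 0, ∀ x : Euc d, ‖kernel β d Ψ lam t x‖ ≤
      (C₀ + |C₁| + C₂) * (cFactor β d lam * t ^ (-((d : ℝ) / 2))) := fun lam hl t ht x => by
    have hT : 0 < t * mSymb β lam := mul_pos ht (mSymb_pos hβ0 hl)
    refine le_trans ?_ (mul_le_mul_of_nonneg_left (pow_mul_rpow_le_cFactor hβ0 d hl ht)
      (by positivity))
    set T := t * mSymb β lam with hTdef
    have hj : 1 ≤ jap lam / lam := by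
      rw [one_le_div hl]
      exact Real.le_sqrt_of_sq_le (by linarith)
    have hB : 0 ≤ lam ^ d * T ^ (-((d : ℝ) / 2)) * (jap lam / lam) := by positivity
    have hdn : -((d : ℝ) / 2) ≤ 0 := by simp; positivity
    rcases le_total T 1 with hT1 | hT1
    · have h3 : 1 ≤ T ^ (-((d : ℝ) / 2)) := Real.one_le_rpow_of_pos_of_le_one_of_nonpos hT hT1 hdn
      have h4 : lam ^ d ≤ lam ^ d * T ^ (-((d : ℝ) / 2)) * (jap lam / lam) := by
        rw [mul_assoc]
        exact le_mul_of_one_le_right (by positivity) (one_le_mul_of_one_le_of_one_le h3 hj)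
      have := h₀ lam hl t x
      nlinarith [abs_nonneg C₁]
    · rcases le_total (2 * π * (lam * ‖x‖)) (T / 256) with hx | hx
      · have h3 : (T ^ d)⁻¹ ≤ T ^ (-((d : ℝ) / 2)) := by
          rw [← Real.rpow_natCast, ← Real.rpow_neg hT.le]
          exact Real.rpow_le_rpow_of_exponent_le hT1 (by
            have : (0 : ℝ) ≤ d := by positivity
            linarith)
        have h4 : lam ^ d * (T ^ d)⁻¹ ≤ lam ^ d * T ^ (-((d : ℝ) / 2)) * (jap lam / lam) :=
          (mul_le_mul_of_nonneg_left h3 (by positivity)).trans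
            (le_mul_of_one_le_right (by positivity) hj)
        have h5 := h₁ lam hl t ht x hx
        have h6 : C₁ * (lam ^ d * (T ^ d)⁻¹) ≤ |C₁| * (lam ^ d * (T ^ d)⁻¹) := by
          gcongr; exact le_abs_self _
        have h7 := mul_le_mul_of_nonneg_left h4 (abs_nonneg C₁)
        nlinarith
      · have h5 := h₂ lam hl t ht x hT1 hx
        nlinarith [abs_nonneg C₁]
  refine ⟨C₀ + |C₁| + C₂, by positivity, fun lam hl t ht x => ?_⟩
  rcases lt_or_gt_of_ne ht with h | h
  · have := main lam hl (-t) (by linarith) (-x)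
    rw [abs_of_neg h]
    refine le_trans (le_of_eq ?_) this
    rw [norm_kernel_neg, neg_neg]
  · rw [abs_of_pos h]
    exact main lam hl t h x

end

lemma fourierInv_eq_vectorFourier {d : ℕ} (k : Euc d → ℂ) :
    𝓕⁻ k = VectorFourier.fourierIntegral 𝐞 volume (-innerₗ (Euc d)) k := by
  ext ξ
  simp [VectorFourier.fourierIntegral, Real.fourierInv_eq]

lemma continuous_neg_innerₗ (d : ℕ) :
    Continuous fun p : Euc d × Euc d => (-innerₗ (Euc d)) p.1 p.2 := by
  simp only [LinearMap.neg_apply, innerₗ_apply_apply]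
  exact continuous_inner.neg

lemma continuous_fourierInv {d : ℕ} {g : Euc d → ℂ} (hg : Integrable g) :
    Continuous (𝓕⁻ g) := by
  rw [fourierInv_eq_vectorFourier]
  exact VectorFourier.fourierIntegral_continuous Real.continuous_fourierChar
    (continuous_neg_innerₗ d) hg

lemma norm_fourierInv_le {d : ℕ} (g : Euc d → ℂ) (ξ : Euc d) : ‖𝓕⁻ g ξ‖ ≤ ∫ x, ‖g x‖ := by
  rw [fourierInv_eq_vectorFourier]
  exact VectorFourier.norm_fourierIntegral_le_integral_norm _ _ _ _ _

/-- The inverse Fourier transform is self-adjoint for the bilinear pairing. -/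
lemma integral_fourierInv_mul_eq {d : ℕ} {f g : Euc d → ℂ} (hf : Integrable f)
    (hg : Integrable g) : ∫ ξ, 𝓕⁻ f ξ * g ξ = ∫ x, f x * 𝓕⁻ g x := by
  have h := VectorFourier.integral_fourierIntegral_smul_eq_flip Real.continuous_fourierChar
    (continuous_neg_innerₗ d) hf hg
  have e : (-innerₗ (Euc d)).flip = -innerₗ (Euc d) := by
    ext x y; simp [real_inner_comm]
  rw [e] at h
  simpa [← fourierInv_eq_vectorFourier] using h

/-- Plancherel's theorem on `L¹ ∩ L²`. -/
lemma fourierInv_memLp_two {d : ℕ} {g : Euc d → ℂ} (h1 : Integrable g) (h2 : MemLp g 2) :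
    MemLp (𝓕⁻ g) 2 ∧ eLpNorm (𝓕⁻ g) 2 = eLpNorm g 2 := by
  set G : Lp ℂ 2 (volume : Measure (Euc d)) := h2.toLp g with hG
  have hae : 𝓕⁻ g =ᵐ[volume] (𝓕⁻ G : Lp ℂ 2 (volume : Measure (Euc d))) := by
    refine ae_eq_of_integral_contDiff_smul_eq (continuous_fourierInv h1).locallyIntegrable
      ((Lp.memLp _).locallyIntegrable (by norm_num)) fun φ hφ hφc => ?_
    set Φ : SchwartzMap (Euc d) ℂ := HasCompactSupport.toSchwartzMap (f := fun x => (φ x : ℂ))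
      (hφc.comp_left (g := fun x : ℝ => (x : ℂ)) (by simp))
      (Complex.ofRealCLM.contDiff.comp hφ) with hΦ
    have hΦa : ∀ x, Φ x = φ x := fun x => rfl
    have h3 : (𝓕⁻ (G : TemperedDistribution (Euc d) ℂ)) Φ =
        ((𝓕⁻ G : Lp ℂ 2 (volume : Measure (Euc d))) : TemperedDistribution (Euc d) ℂ) Φ := by
      rw [Lp.fourierInv_toTemperedDistribution_eq]
    rw [TemperedDistribution.fourierInv_apply, Lp.toTemperedDistribution_apply,
      Lp.toTemperedDistribution_apply] at h3
    have h4 : ∫ x, φ x • 𝓕⁻ g x = ∫ x, 𝓕⁻ g x * Φ x := by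
      refine integral_congr_ae (.of_forall fun x => ?_)
      simp only [hΦa, real_smul]; ring
    rw [h4, integral_fourierInv_mul_eq h1 Φ.integrable]
    have h5 : ∫ x, g x * 𝓕⁻ (Φ : Euc d → ℂ) x =
        ∫ x, (𝓕⁻ Φ : SchwartzMap (Euc d) ℂ) x • G x := by
      refine integral_congr_ae ?_
      filter_upwards [h2.coeFn_toLp] with x hx
      rw [hG, hx, SchwartzMap.fourierInv_coe, smul_eq_mul, mul_comm]
    rw [h5, h3]
    refine integral_congr_ae (.of_forall fun x => ?_)
    simp only [hΦa, real_smul, smul_eq_mul]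
  refine ⟨(memLp_congr_ae hae).2 (Lp.memLp _), ?_⟩
  rw [eLpNorm_congr_ae hae, ← Lp.enorm_def, ← Lp.enorm_toLp h2]
  have : ‖(𝓕⁻ G : Lp ℂ 2 (volume : Measure (Euc d)))‖ = ‖G‖ := by
    rw [← Lp.norm_fourier_eq, FourierTransform.fourier_fourierInv_eq]
  rw [← ofReal_norm, this, ofReal_norm]

lemma integral_norm_sq_fourierInv {d : ℕ} {g : Euc d → ℂ} (h1 : Integrable g)
    (h2 : MemLp g 2) : ∫ ξ, ‖𝓕⁻ g ξ‖ ^ (2 : ℝ) = ∫ x, ‖g x‖ ^ (2 : ℝ) := by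
  obtain ⟨h3, h4⟩ := fourierInv_memLp_two h1 h2
  rw [h3.eLpNorm_eq_integral_rpow_norm (by norm_num) (by norm_num),
    h2.eLpNorm_eq_integral_rpow_norm (by norm_num) (by norm_num)] at h4
  have h5 := (ENNReal.ofReal_eq_ofReal_iff (by positivity) (by positivity)).1 h4
  simp only [ENNReal.toReal_ofNat] at h5
  exact (Real.rpow_left_inj (integral_nonneg fun x => by positivity)
    (integral_nonneg fun x => by positivity) (by norm_num)).1 h5

/-- The sesquilinear form of the frequency localised propagator. -/
def freqForm (β : ℝ) {d : ℕ} (Ψ : ℝ → ℝ) (lam t : ℝ) (h k : Euc d → ℂ) : ℂ :=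
  ∫ ξ : Euc d, 𝓕⁻ h ξ * (conj (𝓕⁻ k ξ) * freqProp β Ψ lam t ‖ξ‖)

section

variable {β : ℝ} {d : ℕ} {Ψ : ℝ → ℝ} (hΨ : ContDiff ℝ (⊤ : ℕ∞) Ψ)
  (hs : ∀ v, v ∉ Set.Icc (3 / 8 : ℝ) 3 → Ψ v = 0) {lam : ℝ} (hl : 0 < lam) (t : ℝ)

lemma conj_fourierInv (k : Euc d → ℂ) (ξ : Euc d) :
    conj (𝓕⁻ k ξ) = 𝓕⁻ (fun x => conj (k (-x))) ξ := by
  rw [Real.fourierInv_eq', Real.fourierInv_eq', ← integral_conj, ← integral_neg_eq_self]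
  refine integral_congr_ae (.of_forall fun x => ?_)
  simp only [smul_eq_mul, map_mul, ← Complex.exp_conj, conj_ofReal, conj_I, inner_neg_left]
  congr 2
  push_cast
  ring

include hΨ hs hl in
lemma norm_freqForm_le_of_kernel {M : ℝ} (hM : ∀ x, ‖kernel β d Ψ lam t x‖ ≤ M)
    {h k : Euc d → ℂ} (hh : Integrable h) (hk : Integrable k) :
    ‖freqForm β Ψ lam t h k‖ ≤ M * (∫ x, ‖h x‖) * ∫ x, ‖k x‖ := by
  have hk' : Integrable fun x => conj (k (-x)) :=
    (Complex.conjLIE.toContinuousLinearEquiv.toContinuousLinearMap.integrable_comp hk.comp_neg)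
  have hg : Continuous fun ξ => conj (𝓕⁻ k ξ) := continuous_conj.comp (continuous_fourierInv hk)
  have hInt := integrable_mul_freqProp (β := β) hΨ hs hl t hg
  rw [freqForm, integral_fourierInv_mul_eq hh hInt]
  have key : ∀ y, ‖𝓕⁻ (fun ξ => conj (𝓕⁻ k ξ) * freqProp β Ψ lam t ‖ξ‖) y‖ ≤
      M * ∫ x, ‖k x‖ := by
    intro y
    set e : Euc d → ℂ := fun ξ => cexp (2 * π * (inner ℝ y ξ : ℝ) * I) * freqProp β Ψ lam t ‖ξ‖
    have he : Integrable e := integrable_mul_freqProp (β := β) hΨ hs hl t (by fun_prop)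
    have h1 : 𝓕⁻ (fun ξ => conj (𝓕⁻ k ξ) * freqProp β Ψ lam t ‖ξ‖) y =
        ∫ ξ, 𝓕⁻ (fun x => conj (k (-x))) ξ * e ξ := by
      rw [Real.fourierInv_eq']
      refine integral_congr_ae (.of_forall fun ξ => ?_)
      simp only [smul_eq_mul, conj_fourierInv, e]
      rw [real_inner_comm]
      push_cast
      ring
    rw [h1, integral_fourierInv_mul_eq hk' he]
    have h2 : ∀ x, 𝓕⁻ e x = kernel β d Ψ lam t (x + y) := by
      intro x
      rw [Real.fourierInv_eq', kernel]
      refine integral_congr_ae (.of_forall fun ξ => ?_)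
      simp only [smul_eq_mul, e]
      rw [← mul_assoc, ← Complex.exp_add, inner_add_left, real_inner_comm]
      congr 2
      push_cast
      ring
    calc _ ≤ ∫ x, M * ‖k (-x)‖ := by
          refine norm_integral_le_of_norm_le (hk.comp_neg.norm.const_mul M) (.of_forall fun x => ?_)
          rw [norm_mul, RCLike.norm_conj, h2, mul_comm]
          gcongr
          exact hM _
      _ = _ := by
          rw [integral_const_mul, integral_neg_eq_self (fun x => ‖k x‖)]
  calc _ ≤ ∫ x, ‖h x‖ * (M * ∫ x, ‖k x‖) := by
        refine norm_integral_le_of_norm_le (hh.norm.mul_const _) (.of_forall fun x => ?_)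
        rw [norm_mul]
        gcongr
        exact key x
    _ = _ := by rw [integral_mul_const]; ring

lemma norm_freqForm_le_L2 (h1 : ∀ v, |Ψ v| ≤ 1) {h k : Euc d → ℂ} (hh : Integrable h)
    (hk : Integrable k) (hh2 : MemLp h 2) (hk2 : MemLp k 2) :
    ‖freqForm β Ψ lam t h k‖ ≤ √(∫ x, ‖h x‖ ^ 2) * √(∫ x, ‖k x‖ ^ 2) := by
  have hF := (fourierInv_memLp_two hh hh2).1
  have hK := (fourierInv_memLp_two hk hk2).1
  calc ‖freqForm β Ψ lam t h k‖ ≤ ∫ ξ, ‖𝓕⁻ h ξ‖ * ‖𝓕⁻ k ξ‖ := by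
        refine norm_integral_le_of_norm_le ?_ (.of_forall fun ξ => ?_)
        · exact hF.norm.integrable_mul hK.norm
        · rw [norm_mul, norm_mul, RCLike.norm_conj]
          gcongr
          refine mul_le_of_le_one_right (norm_nonneg _) ?_
          rw [freqProp, norm_mul, Complex.norm_real, ← neg_mul, ← Complex.ofReal_mul,
            ← Complex.ofReal_neg, Complex.norm_exp_ofReal_mul_I, one_mul]
          exact h1 _
    _ ≤ (∫ ξ, ‖𝓕⁻ h ξ‖ ^ (2 : ℝ)) ^ (1 / (2 : ℝ)) * (∫ ξ, ‖𝓕⁻ k ξ‖ ^ (2 : ℝ)) ^ (1 / (2 : ℝ)) :=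
        integral_mul_norm_le_Lp_mul_Lq Real.HolderConjugate.two_two (by simpa using hF)
          (by simpa using hK)
    _ = _ := by
        rw [integral_norm_sq_fourierInv hh hh2, integral_norm_sq_fourierInv hk hk2,
          Real.sqrt_eq_rpow, Real.sqrt_eq_rpow]
        norm_cast

end

lemma fourierInv_finset_sum {d : ℕ} {ι : Type*} (s : Finset ι) (x : ι → ℂ) {h : ι → Euc d → ℂ}
    (hh : ∀ i ∈ s, Integrable (h i)) (ξ : Euc d) :
    𝓕⁻ (fun y => ∑ i ∈ s, x i * h i y) ξ = ∑ i ∈ s, x i * 𝓕⁻ (h i) ξ := by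
  have hc : ∀ g : Euc d → ℂ, Integrable g →
      Integrable fun v => cexp (↑(2 * π * inner ℝ v ξ) * I) * g v := by
    intro g hg
    refine hg.bdd_mul (c := 1) (by fun_prop) (.of_forall fun v => ?_)
    rw [Complex.norm_exp_ofReal_mul_I]
  simp only [Real.fourierInv_eq', smul_eq_mul, Finset.mul_sum]
  rw [integral_finsetSum _ fun i hi => ?_]
  · refine Finset.sum_congr rfl fun i _ => ?_
    rw [← integral_const_mul]
    refine integral_congr_ae (.of_forall fun v => ?_)
    ring
  · refine ((hc _ (hh i hi)).const_mul (x i)).congr (.of_forall fun v => ?_)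
    ring

namespace MeasureTheory.SimpleFunc

variable {α : Type*} [MeasurableSpace α] {μ : Measure α}

/-- The indicator function of the level set `{h = i}`, `i ≠ 0`. -/
def levelInd (h : SimpleFunc α ℂ) (i : ℂ) : SimpleFunc α ℂ :=
  h.map fun c => if c = i ∧ c ≠ 0 then 1 else 0

/-- Replace every nonzero value `c` of `h` by `x c`. -/
def recolor (h : SimpleFunc α ℂ) (x : ℂ → ℂ) : SimpleFunc α ℂ :=
  h.map fun c => if c = 0 then 0 else x c

lemma integrable_map {h : SimpleFunc α ℂ} (hh : Integrable h μ) {g : ℂ → ℂ} (hg : g 0 = 0) :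
    Integrable (h.map g) μ :=
  SimpleFunc.integrable_iff_finMeasSupp.2
    ((SimpleFunc.integrable_iff_finMeasSupp.1 hh).map hg)

lemma integrable_levelInd {h : SimpleFunc α ℂ} (hh : Integrable h μ) (i : ℂ) :
    Integrable (h.levelInd i) μ :=
  integrable_map hh (by simp)

lemma integrable_recolor {h : SimpleFunc α ℂ} (hh : Integrable h μ) (x : ℂ → ℂ) :
    Integrable (h.recolor x) μ :=
  integrable_map hh (by simp)

lemma memLp_of_integrable {h : SimpleFunc α ℂ} (hh : Integrable h μ) (p : ℝ≥0∞) :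
    MemLp h p μ :=
  SimpleFunc.memLp_of_finite_measure_preimage p (SimpleFunc.integrable_iff.1 hh)

lemma recolor_apply (h : SimpleFunc α ℂ) (x : ℂ → ℂ) (a : α) :
    h.recolor x a = ∑ i ∈ h.range, x i * h.levelInd i a := by
  simp only [recolor, levelInd, SimpleFunc.map_apply, mul_ite, mul_one, mul_zero]
  by_cases h0 : h a = 0
  · simp [h0]
  · simp [h0, Finset.sum_ite_eq]

lemma recolor_id (h : SimpleFunc α ℂ) : h.recolor (fun c => c) = h := by
  ext a
  simp only [recolor, SimpleFunc.map_apply]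
  split_ifs with h0
  · exact h0.symm
  · rfl

lemma integral_norm_rpow_eq_sum {h : SimpleFunc α ℂ} (hh : Integrable h μ) {p : ℝ}
    (hp : 0 < p) : ∫ a, ‖h a‖ ^ p ∂μ = ∑ i ∈ h.range, ‖i‖ ^ p * μ.real (h ⁻¹' {i}) := by
  have hi : Integrable (h.map fun c => ‖c‖ ^ p) μ :=
    SimpleFunc.integrable_iff_finMeasSupp.2
      ((SimpleFunc.integrable_iff_finMeasSupp.1 hh).map (by simp [hp.ne']))
  have e : (fun a => ‖h a‖ ^ p) = h.map fun c => ‖c‖ ^ p := rfl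
  rw [e, ← SimpleFunc.integral_eq_integral _ hi, SimpleFunc.map_integral _ _ hh (by simp [hp.ne'])]
  exact Finset.sum_congr rfl fun i _ => by rw [smul_eq_mul, mul_comm]

lemma integral_recolor_rpow_le {h : SimpleFunc α ℂ} (hh : Integrable h μ) (x : ℂ → ℂ) {p : ℝ}
    (hp : 0 < p) : ∫ a, ‖h.recolor x a‖ ^ p ∂μ ≤
      ∑ i ∈ h.range, ‖x i‖ ^ p * μ.real (h ⁻¹' {i}) := by
  have e : (fun a => ‖h.recolor x a‖ ^ p) =
      h.map fun c => ‖if c = 0 then (0 : ℂ) else x c‖ ^ p := by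
    ext a; simp [recolor]
  have hi : Integrable (h.map fun c => ‖if c = 0 then (0 : ℂ) else x c‖ ^ p) μ :=
    SimpleFunc.integrable_iff_finMeasSupp.2
      ((SimpleFunc.integrable_iff_finMeasSupp.1 hh).map (by simp [hp.ne']))
  rw [e, ← SimpleFunc.integral_eq_integral _ hi, SimpleFunc.map_integral _ _ hh (by simp [hp.ne'])]
  refine Finset.sum_le_sum fun i _ => ?_
  rw [smul_eq_mul, mul_comm]
  gcongr
  split_ifs <;> simp

end MeasureTheory.SimpleFunc

section

variable {β : ℝ} {d : ℕ} {Ψ : ℝ → ℝ} (hΨ : ContDiff ℝ (⊤ : ℕ∞) Ψ)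
  (hs : ∀ v, v ∉ Set.Icc (3 / 8 : ℝ) 3 → Ψ v = 0) {lam : ℝ} (hl : 0 < lam) (t : ℝ)

include hΨ hs hl in
lemma freqForm_sum {ι κ : Type*} (s : Finset ι) (u : Finset κ) (x : ι → ℂ) (y : κ → ℂ)
    {h : ι → Euc d → ℂ} {k : κ → Euc d → ℂ} (hh : ∀ i ∈ s, Integrable (h i))
    (hk : ∀ j ∈ u, Integrable (k j)) :
    freqForm β Ψ lam t (fun a => ∑ i ∈ s, x i * h i a) (fun a => ∑ j ∈ u, conj (y j) * k j a) =
      ∑ i ∈ s, ∑ j ∈ u, x i * y j * freqForm β Ψ lam t (h i) (k j) := by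
  have hInt : ∀ i ∈ s, ∀ j ∈ u, Integrable fun ξ =>
      x i * y j * (𝓕⁻ (h i) ξ * (conj (𝓕⁻ (k j) ξ) * freqProp β Ψ lam t ‖ξ‖)) := by
    intro i hi j hj
    have := integrable_mul_freqProp (β := β) hΨ hs hl t
      (g := fun ξ => 𝓕⁻ (h i) ξ * conj (𝓕⁻ (k j) ξ))
      ((continuous_fourierInv (hh i hi)).mul
        (continuous_conj.comp (continuous_fourierInv (hk j hj))))
    simpa only [mul_assoc] using this.const_mul (x i * y j)
  simp only [freqForm]
  simp_rw [fourierInv_finset_sum s x hh, fourierInv_finset_sum u (fun j => conj (y j)) hk,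
    ← integral_const_mul]
  rw [Finset.sum_congr rfl fun i hi => (integral_finsetSum u (hInt i hi)).symm,
    ← integral_finsetSum s fun i hi => integrable_finsetSum u (hInt i hi)]
  refine integral_congr_ae (.of_forall fun ξ => ?_)
  simp only [map_sum, map_mul, conj_conj, Finset.sum_mul, Finset.mul_sum]
  rw [Finset.sum_comm]
  refine Finset.sum_congr rfl fun i _ => ?_
  refine Finset.sum_congr rfl fun j _ => ?_
  ring

include hΨ hs hl in
/-- The interpolated `L^p → L^{p'}` dispersive bound, on simple functions. -/
lemma norm_freqForm_le_interpolated (h1 : ∀ v, |Ψ v| ≤ 1) {M : ℝ}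
    (hM : ∀ x, ‖kernel β d Ψ lam t x‖ ≤ M) {p θ : ℝ} (hp : 0 < p) (hθ0 : 0 ≤ θ) (hθ1 : θ ≤ 1)
    (hpθ : p * (1 - θ / 2) = 1) {h k : SimpleFunc (Euc d) ℂ} (hh : Integrable h)
    (hk : Integrable k) :
    ‖freqForm β Ψ lam t h k‖ ≤ M ^ (1 - θ) * (∫ x, ‖h x‖ ^ p) ^ (1 / p) *
      (∫ x, ‖k x‖ ^ p) ^ (1 / p) := by
  have hM0 : 0 ≤ M := (norm_nonneg _).trans (hM 0)
  have e : ∀ x y : ℂ → ℂ, ∑ i ∈ h.range, ∑ j ∈ k.range, x i * y j *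
      freqForm β Ψ lam t (h.levelInd i) (k.levelInd j) =
        freqForm β Ψ lam t (h.recolor x) (k.recolor fun c => conj (y c)) := by
    intro x y
    rw [← freqForm_sum hΨ hs hl t _ _ _ _ (fun i _ => SimpleFunc.integrable_levelInd hh i)
      (fun j _ => SimpleFunc.integrable_levelInd hk j)]
    congr 1 <;> ext a <;> rw [SimpleFunc.recolor_apply]
  have hhx : ∀ x, Integrable (h.recolor x) := SimpleFunc.integrable_recolor hh
  have hky : ∀ x, Integrable (k.recolor x) := SimpleFunc.integrable_recolor hk
  have main := norm_bilin_le_of_interpolation h.range k.range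
    (μ := fun i => volume.real (h ⁻¹' {i})) (ν := fun j => volume.real (k ⁻¹' {j}))
    (fun i => measureReal_nonneg) (fun j => measureReal_nonneg)
    (fun i j => freqForm β Ψ lam t (h.levelInd i) (k.levelInd j)) (M₀ := M) (M₁ := 1)
    (fun x y => ?_) (fun x y => ?_) hp hθ0 hθ1 hpθ (fun c => c) (fun c => conj c)
  · rw [e] at main
    simp only [conj_conj, SimpleFunc.recolor_id, Real.one_rpow, mul_one, RCLike.norm_conj] at main
    rwa [SimpleFunc.integral_norm_rpow_eq_sum hh hp, SimpleFunc.integral_norm_rpow_eq_sum hk hp]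
  · rw [e]
    refine (norm_freqForm_le_of_kernel hΨ hs hl t hM (hhx _) (hky _)).trans ?_
    have a1 := SimpleFunc.integral_recolor_rpow_le hh x one_pos
    have a2 := SimpleFunc.integral_recolor_rpow_le hk (fun c => conj (y c)) one_pos
    simp only [Real.rpow_one, RCLike.norm_conj] at a1 a2
    gcongr
  · rw [e, one_mul]
    refine (norm_freqForm_le_L2 t h1 (hhx _) (hky _) (SimpleFunc.memLp_of_integrable (hhx _) _)
      (SimpleFunc.memLp_of_integrable (hky _) _)).trans ?_
    have a1 := SimpleFunc.integral_recolor_rpow_le hh x two_pos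
    have a2 := SimpleFunc.integral_recolor_rpow_le hk (fun c => conj (y c)) two_pos
    simp only [Real.rpow_two, RCLike.norm_conj] at a1 a2
    gcongr

end

section

variable {α : Type*} [MeasurableSpace α] {μ : Measure α}

lemma exists_dual_of_ne_top {p r : ℝ≥0∞} [hpr : p.HolderConjugate r] (hr2 : 2 < r) (hr : r ≠ ∞)
    {u : α → ℂ} (hu : Measurable u) (hur : MemLp u r μ) (h0 : eLpNorm u r μ ≠ 0) :
    ∃ w : α → ℂ, MemLp w p μ ∧ eLpNorm w p μ ≤ ENNReal.ofReal (1 / 2) ∧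
      (eLpNorm u r μ).toReal / 4 ≤ ‖∫ x, u x * w x ∂μ‖ := by
  set A := (eLpNorm u r μ).toReal with hA
  have hAe : eLpNorm u r μ = ENNReal.ofReal A := (ENNReal.ofReal_toReal hur.2.ne).symm
  have hApos : 0 < A := ENNReal.toReal_pos h0 hur.2.ne
  set ρ := r.toReal with hρ
  have hρ2 : 2 < ρ := by
    have := (ENNReal.toReal_lt_toReal (by simp) hr).2 hr2
    simpa using this
  have hre : r = ENNReal.ofReal ρ := (ENNReal.ofReal_toReal hr).symm
  have hp : p ≠ ∞ := by
    rintro rfl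
    have := hpr.inv_add_inv_eq_inv
    simp only [ENNReal.inv_top, zero_add, inv_one, ENNReal.inv_eq_one] at this
    rw [this] at hr2
    norm_num at hr2
  have hmul : p * ENNReal.ofReal (ρ - 1) = r := by
    have h1 := (ENNReal.HolderConjugate.toReal_of_ne_top hp hr).symm.sub_one_mul_conj
    rw [← ENNReal.ofReal_toReal hp, ← ENNReal.ofReal_mul ENNReal.toReal_nonneg, mul_comm, h1,
      ENNReal.ofReal_toReal hr]
  set c : ℝ := (1 / 2) * A ^ (-(ρ - 1))
  have hc : 0 < c := by positivity
  set w : α → ℂ := fun x => (c * ‖u x‖ ^ (ρ - 2) : ℝ) * conj (u x) with hw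
  have hwn : ∀ x, ‖w x‖ = c * ‖u x‖ ^ (ρ - 1) := by
    intro x
    rw [hw, norm_mul, RCLike.norm_conj, Complex.norm_real,
      Real.norm_of_nonneg (by positivity), mul_assoc]
    congr 1
    rcases eq_or_ne (u x) 0 with h | h
    · simp [h, (by linarith : ρ - 1 ≠ 0)]
    · rw [← Real.rpow_add_one (by simpa using h)]; congr 1; ring
  have hwm : Measurable w := by fun_prop
  have hnorm : eLpNorm w p μ = ENNReal.ofReal (1 / 2) := by
    rw [← eLpNorm_norm]
    simp only [hwn]
    have : (fun x => c * ‖u x‖ ^ (ρ - 1)) = c • fun x => ‖u x‖ ^ (ρ - 1) := by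
      ext x; simp
    rw [this, eLpNorm_const_smul, eLpNorm_norm_rpow _ (by linarith), hmul, hAe,
      ENNReal.ofReal_rpow_of_nonneg hApos.le (by linarith), Real.enorm_eq_ofReal hc.le,
      ← ENNReal.ofReal_mul hc.le]
    congr 1
    rw [mul_assoc, ← Real.rpow_add hApos]
    simp
  refine ⟨w, ⟨hwm.aestronglyMeasurable, ?_⟩, hnorm.le, ?_⟩
  · rw [hnorm]; exact ENNReal.ofReal_lt_top
  · have h1 : ∫ x, u x * w x ∂μ = ((c * ∫ x, ‖u x‖ ^ ρ ∂μ : ℝ) : ℂ) := by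
      rw [← integral_const_mul, ← integral_complex_ofReal]
      refine integral_congr_ae (.of_forall fun x => ?_)
      simp only [hw]
      rw [mul_left_comm, Complex.mul_conj, ← Complex.ofReal_mul, mul_assoc,
        Complex.normSq_eq_norm_sq]
      congr 2
      rcases eq_or_ne (u x) 0 with h | h
      · simp [h, (by linarith : ρ ≠ 0)]
      · rw [← Real.rpow_natCast, ← Real.rpow_add (by simpa using h)]; congr 1; push_cast; ring
    have h2 := hur.eLpNorm_eq_integral_rpow_norm (by rintro rfl; simp at hr2) hr
    rw [hAe, ← hρ, ENNReal.ofReal_eq_ofReal_iff hApos.le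
      (Real.rpow_nonneg (integral_nonneg fun x => by positivity) _)] at h2
    have h3 : ∫ x, ‖u x‖ ^ ρ ∂μ = A ^ ρ := by
      rw [h2, ← Real.rpow_mul (integral_nonneg fun x => by positivity),
        inv_mul_cancel₀ (by linarith), Real.rpow_one]
    rw [h1, h3, Complex.norm_real, Real.norm_of_nonneg (by positivity), mul_assoc,
      ← Real.rpow_add hApos]
    have : -(ρ - 1) + ρ = 1 := by ring
    rw [this, Real.rpow_one]
    linarith

lemma exists_dual_top {u : α → ℂ} (hu : Measurable u) (hu2 : MemLp u 2 μ)
    (hur : MemLp u ∞ μ) (h0 : eLpNorm u ∞ μ ≠ 0) :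
    ∃ w : α → ℂ, MemLp w 1 μ ∧ eLpNorm w 1 μ ≤ ENNReal.ofReal (1 / 2) ∧
      (eLpNorm u ∞ μ).toReal / 4 ≤ ‖∫ x, u x * w x ∂μ‖ := by
  set A := (eLpNorm u ∞ μ).toReal with hA
  have hAe : eLpNorm u ∞ μ = ENNReal.ofReal A := (ENNReal.ofReal_toReal hur.2.ne).symm
  have hApos : 0 < A := ENNReal.toReal_pos h0 hur.2.ne
  set E : Set α := {x | A / 2 ≤ ‖u x‖}
  have hE : MeasurableSet E := measurableSet_le measurable_const hu.norm
  have hEpos : μ E ≠ 0 := by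
    intro h
    have : eLpNorm u ∞ μ ≤ ENNReal.ofReal (A / 2) := by
      rw [eLpNorm_exponent_top]
      refine eLpNormEssSup_le_of_ae_bound ?_
      have : ∀ᵐ x ∂μ, x ∉ E := measure_eq_zero_iff_ae_notMem.1 h
      filter_upwards [this] with x hx
      exact (not_le.1 hx).le
    rw [hAe, ENNReal.ofReal_le_ofReal_iff (by positivity)] at this
    linarith
  have hEtop : μ E ≠ ∞ := by
    have := hu2.meas_ge_lt_top (by norm_num) (by norm_num) (ε := ⟨A / 2, by positivity⟩)
      (by intro h; have : A / 2 = 0 := congrArg NNReal.toReal h; linarith)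
    exact this.ne
  have hEr : 0 < μ.real E := ENNReal.toReal_pos hEpos hEtop
  set c : ℝ := 1 / (2 * μ.real E)
  have hc : 0 < c := by positivity
  set w : α → ℂ := E.indicator fun x => (c / ‖u x‖ : ℝ) * conj (u x) with hw
  have hwn : ∀ x, ‖w x‖ = E.indicator (fun _ => c) x := by
    intro x
    rw [hw, norm_indicator_eq_indicator_norm]
    by_cases hx : x ∈ E
    · have : 0 < ‖u x‖ := lt_of_lt_of_le (by positivity) hx
      simp only [Set.indicator_of_mem hx, norm_mul, Complex.norm_real, RCLike.norm_conj]
      rw [Real.norm_of_nonneg (by positivity)]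
      field_simp
    · simp [hx]
  have hnorm : eLpNorm w 1 μ = ENNReal.ofReal (1 / 2) := by
    rw [← eLpNorm_norm]
    simp only [hwn]
    rw [eLpNorm_indicator_const hE (by simp) (by simp), Real.enorm_eq_ofReal hc.le]
    simp only [ENNReal.toReal_one, div_one, ENNReal.rpow_one]
    rw [← ENNReal.ofReal_toReal hEtop, ← ENNReal.ofReal_mul hc.le]
    congr 1
    change 1 / (2 * μ.real E) * μ.real E = _
    field_simp
  have hwm : Measurable w := by
    refine Measurable.indicator ?_ hE
    fun_prop
  refine ⟨w, ⟨hwm.aestronglyMeasurable, ?_⟩, hnorm.le, ?_⟩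
  · rw [hnorm]; exact ENNReal.ofReal_lt_top
  · have hInt : IntegrableOn (fun x => c * ‖u x‖) E μ := by
      have : IsFiniteMeasure (μ.restrict E) := ⟨by simpa using hEtop.lt_top⟩
      exact ((hu2.restrict E).integrable (by norm_num)).norm.const_mul c
    have h1 : ∫ x, u x * w x ∂μ = ((∫ x in E, c * ‖u x‖ ∂μ : ℝ) : ℂ) := by
      rw [← integral_indicator hE, ← integral_complex_ofReal]
      refine integral_congr_ae (.of_forall fun x => ?_)
      simp only [hw]
      by_cases hx : x ∈ E
      · have : 0 < ‖u x‖ := lt_of_lt_of_le (by positivity) hx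
        simp only [Set.indicator_of_mem hx]
        rw [mul_left_comm, Complex.mul_conj, ← Complex.ofReal_mul, Complex.normSq_eq_norm_sq]
        congr 1
        field_simp
      · simp [hx]
    rw [h1, Complex.norm_real, Real.norm_of_nonneg
      (integral_nonneg fun x => by positivity)]
    calc A / 4 = ∫ x in E, c * (A / 2) ∂μ := by
          rw [setIntegral_const, smul_eq_mul]
          change _ = μ.real E * (1 / (2 * μ.real E) * (A / 2))
          field_simp
          norm_num
      _ ≤ _ := by
          refine setIntegral_mono_on (integrableOn_const hEtop) hInt hE fun x hx => ?_
          gcongr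
          exact hx

end

section

variable {α : Type*} [MeasurableSpace α] {μ : Measure α}

lemma norm_integral_mul_le_eLpNorm {p r : ℝ≥0∞} [p.HolderConjugate r] {u w : α → ℂ}
    (hu : MemLp u r μ) (hw : MemLp w p μ) :
    ‖∫ x, u x * w x ∂μ‖ ≤ (eLpNorm u r μ).toReal * (eLpNorm w p μ).toReal := by
  rw [← ENNReal.toReal_mul, ← toReal_enorm]
  refine ENNReal.toReal_mono (ENNReal.mul_ne_top hu.2.ne hw.2.ne) ?_
  refine (enorm_integral_le_lintegral_enorm _).trans ?_
  rw [← eLpNorm_one_eq_lintegral_enorm]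
  have : r.HolderConjugate p := ENNReal.HolderConjugate.symm
  have h := eLpNorm_smul_le_mul_eLpNorm (p := r) (q := p) (r := 1) hw.1 hu.1
  rwa [smul_eq_mul] at h

/-- A countable norming family of simple functions for `L^r`, `r > 2`. -/
lemma exists_norming_simpleFunc_seq [IsSeparable μ] {p r : ℝ≥0∞}
    [hpr : p.HolderConjugate r] (hr2 : 2 < r) :
    ∃ g : ℕ → SimpleFunc α ℂ, (∀ j, Integrable (g j) μ) ∧ (∀ j, eLpNorm (g j) p μ ≤ 1) ∧
      ∀ u : α → ℂ, Measurable u → MemLp u 2 μ → MemLp u r μ →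
        eLpNorm u r μ ≤ 8 * ⨆ j, ‖∫ x, u x * g j x ∂μ‖ₑ := by
  have hp : p ≠ ∞ := by
    rintro rfl
    have := hpr.inv_add_inv_eq_inv
    simp only [ENNReal.inv_top, zero_add, inv_one, ENNReal.inv_eq_one] at this
    rw [this] at hr2
    norm_num at hr2
  have hp1 : 1 ≤ p := ENNReal.HolderConjugate.one_le p r
  have : Fact (1 ≤ p) := ⟨hp1⟩
  have : Fact (p ≠ ∞) := ⟨hp⟩
  have hp0 : p ≠ 0 := (lt_of_lt_of_le one_pos hp1).ne'
  let Y := {g : Lp.simpleFunc ℂ p μ // ‖g‖ ≤ 1}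
  have : Nonempty Y := ⟨⟨0, by simp⟩⟩
  let D : ℕ → Y := TopologicalSpace.denseSeq Y
  have hD : DenseRange D := TopologicalSpace.denseRange_denseSeq Y
  let g : ℕ → SimpleFunc α ℂ := fun j => Lp.simpleFunc.toSimpleFunc (D j).1
  have hgp : ∀ j, MemLp (g j) p μ := fun j => Lp.simpleFunc.memLp _
  refine ⟨g, fun j => (SimpleFunc.memLp_iff_integrable hp0 hp).1 (hgp j), fun j => ?_,
    fun u hu hu2 hur => ?_⟩
  · have := (D j).2
    rw [Lp.simpleFunc.norm_toSimpleFunc] at this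
    exact (ENNReal.toReal_le_toReal (hgp j).2.ne (by simp)).1
      (this.trans_eq ENNReal.toReal_one.symm)
  by_cases h0 : eLpNorm u r μ = 0
  · rw [h0]; exact zero_le
  set A := (eLpNorm u r μ).toReal with hA
  have hApos : 0 < A := ENNReal.toReal_pos h0 hur.2.ne
  obtain ⟨w, hw, hw1, hw2⟩ : ∃ w : α → ℂ, MemLp w p μ ∧ eLpNorm w p μ ≤ ENNReal.ofReal (1 / 2) ∧
      A / 4 ≤ ‖∫ x, u x * w x ∂μ‖ := by
    by_cases hr : r = ∞
    · subst hr
      have : p = 1 := by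
        have := hpr.inv_add_inv_eq_inv
        simpa using this
      subst this
      exact exists_dual_top hu hu2 hur h0
    · exact exists_dual_of_ne_top hr2 hr hu hur h0
  obtain ⟨s, hsS, hs⟩ := Metric.dense_iff.1 (Lp.simpleFunc.dense (E := ℂ) (μ := μ) hp) (hw.toLp w)
    (1 / 16)
    (by norm_num)
  set W : Lp ℂ p μ := hw.toLp w
  have hWn : ‖W‖ ≤ 1 / 2 := by
    rw [Lp.norm_toLp]
    exact ENNReal.toReal_le_of_le_ofReal (by norm_num) hw1
  rw [Metric.mem_ball, dist_eq_norm] at hsS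
  have hs1 : ‖s‖ ≤ 1 := by
    have := norm_add_le (s - W) W
    rw [sub_add_cancel] at this
    linarith
  obtain ⟨j, hj⟩ := hD.exists_dist_lt (⟨⟨s, hs⟩, hs1⟩ : Y) (ε := 1 / 16) (by norm_num)
  have hj' : ‖s - ((D j).1 : Lp ℂ p μ)‖ < 1 / 16 := by
    rw [← dist_eq_norm]; exact hj
  have hDj : (hgp j).toLp (g j) = ((D j).1 : Lp ℂ p μ) := by
    have := Lp.simpleFunc.toLp_toSimpleFunc (D j).1
    rw [← this, Lp.simpleFunc.toLp_eq_toLp]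
  have hdiff : (eLpNorm (w - ⇑(g j)) p μ).toReal ≤ 1 / 8 := by
    rw [← Lp.norm_toLp (w - ⇑(g j)) (hw.sub (hgp j)), MemLp.toLp_sub hw (hgp j), hDj]
    have := norm_sub_le (W - s) (((D j).1 : Lp ℂ p μ) - s)
    rw [sub_sub_sub_cancel_right, norm_sub_rev W s, norm_sub_rev _ s] at this
    linarith
  have hwi : Integrable (fun x => u x * w x) μ := hur.integrable_mul hw
  have hgi : Integrable (fun x => u x * g j x) μ := hur.integrable_mul (hgp j)
  have hsub : ‖∫ x, u x * (w - ⇑(g j)) x ∂μ‖ ≤ A * (1 / 8) :=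
    (norm_integral_mul_le_eLpNorm hur (hw.sub (hgp j))).trans (by gcongr)
  have e : ∫ x, u x * (w - ⇑(g j)) x ∂μ = ∫ x, u x * w x ∂μ - ∫ x, u x * g j x ∂μ := by
    rw [← integral_sub hwi hgi]
    simp only [Pi.sub_apply, mul_sub]
  have hfin : A ≤ 8 * ‖∫ x, u x * g j x ∂μ‖ := by
    have := norm_sub_norm_le (∫ x, u x * w x ∂μ) (∫ x, u x * g j x ∂μ)
    rw [← e] at this
    linarith
  calc eLpNorm u r μ = ENNReal.ofReal A := (ENNReal.ofReal_toReal hur.2.ne).symm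
    _ ≤ ENNReal.ofReal (8 * ‖∫ x, u x * g j x ∂μ‖) := ENNReal.ofReal_le_ofReal hfin
    _ = 8 * ‖∫ x, u x * g j x ∂μ‖ₑ := by
        rw [ENNReal.ofReal_mul (by norm_num), ofReal_norm]; norm_num
    _ ≤ _ := by
        gcongr
        exact le_iSup (fun j => ‖∫ x, u x * g j x ∂μ‖ₑ) j

end

/-- The maximal version of the abstract `TT*` estimate, for a countable family of vectors. -/
lemma lintegral_iSup_inner_rpow_le_of_gram_decay {H : Type*} [NormedAddCommGroup H]
    [InnerProductSpace ℂ H] [CompleteSpace H] [SecondCountableTopology H]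
    {γ : ℝ} (hγ0 : 0 < γ) (hγ1 : γ < 1) {v : ℕ → ℝ → H} (hv : ∀ j, Continuous (v j)) {B D : ℝ}
    (hB : ∀ j t, ‖v j t‖ ≤ B) (hD : 0 < D)
    (hdec : ∀ i j s t, s ≠ t → ‖inner ℂ (v i s) (v j t)‖ ≤ D * |s - t| ^ (-γ)) (F : H) :
    ∫⁻ t, (⨆ j, ‖inner ℂ (v j t) F‖ₑ) ^ (2 / γ) ≤
      ENNReal.ofReal (2 ^ (2 / γ) *
        ((D * (2 * (2 / (1 - γ) + 2 ^ (γ / 2)))) ^ (1 / γ) * ‖F‖ ^ (2 / γ))) := by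
  borelize H
  set N : ℝ → ℝ≥0∞ := fun t => ⨆ j, ‖inner ℂ (v j t) F‖ₑ with hN
  have hm : ∀ j, Measurable fun t => ‖inner ℂ (v j t) F‖ₑ := fun j =>
    ((hv j).inner continuous_const).enorm.measurable
  have hNm : Measurable N := .iSup hm
  have hNtop : ∀ t, N t ≠ ∞ := by
    intro t
    refine ne_top_of_le_ne_top (ENNReal.ofReal_ne_top (r := B * ‖F‖)) (iSup_le fun j => ?_)
    rw [← ofReal_norm]
    refine ENNReal.ofReal_le_ofReal ((norm_inner_le_norm _ _).trans ?_)
    gcongr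
    exact hB j t
  have hex : ∀ t, ∃ j, N t ≤ 2 * ‖inner ℂ (v j t) F‖ₑ := by
    intro t
    by_cases h0 : N t = 0
    · exact ⟨0, by rw [h0]; exact zero_le⟩
    · have : N t / 2 < N t := ENNReal.half_lt_self h0 (hNtop t)
      obtain ⟨j, hj⟩ := lt_iSup_iff.1 this
      refine ⟨j, ?_⟩
      calc N t = 2 * (N t / 2) := (ENNReal.mul_div_cancel (by norm_num) (by norm_num)).symm
        _ ≤ _ := by gcongr
  classical
  set V : ℝ → H := fun t => v (Nat.find (hex t)) t with hV
  have hVm : Measurable V := Measurable.find (fun j => (hv j).measurable)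
    (fun j => measurableSet_le hNm ((hm j).const_mul 2)) hex
  have main := lintegral_norm_inner_rpow_le_of_gram_decay hγ0 hγ1 hVm.stronglyMeasurable
    (fun t => hB _ t) hD (fun s t hst => hdec _ _ s t hst) F
  have hγ2 : 0 ≤ 2 / γ := by positivity
  calc ∫⁻ t, N t ^ (2 / γ) ≤ ∫⁻ t, ENNReal.ofReal (2 ^ (2 / γ)) *
        ENNReal.ofReal (‖inner ℂ (V t) F‖ ^ (2 / γ)) := by
        refine lintegral_mono fun t => ?_
        calc N t ^ (2 / γ) ≤ (2 * ‖inner ℂ (V t) F‖ₑ) ^ (2 / γ) := by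
              gcongr
              exact Nat.find_spec (hex t)
          _ = _ := by
              rw [ENNReal.mul_rpow_of_nonneg _ _ hγ2, ← ofReal_norm,
                ENNReal.ofReal_rpow_of_nonneg (norm_nonneg _) hγ2,
                ← ENNReal.ofReal_rpow_of_nonneg zero_le_two hγ2, ENNReal.ofReal_ofNat]
    _ = ENNReal.ofReal (2 ^ (2 / γ)) * ∫⁻ t, ENNReal.ofReal (‖inner ℂ (V t) F‖ ^ (2 / γ)) :=
        lintegral_const_mul' _ _ ENNReal.ofReal_ne_top
    _ ≤ _ := by
        rw [ENNReal.ofReal_mul (by positivity)]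
        gcongr

lemma rho_eq_zero_of_notMem {χ : ℝ → ℝ} (hχ : IsCutoff χ) {s : ℝ} (h0 : 0 ≤ s)
    (hs : s ∉ Set.Ioc (1 / 2 : ℝ) 2) : rho χ s = 0 := by
  obtain ⟨-, -, -, h1, h2⟩ := hχ
  unfold rho
  by_cases h : s ≤ 1 / 2
  · rw [h1 s ⟨by linarith, by linarith⟩, h1 (2 * s) ⟨by linarith, by linarith⟩, sub_self]
  · have h3 : 2 < s := by
      by_contra h4
      exact hs ⟨by linarith, by linarith⟩
    have h4 : ∀ v, 2 < v → χ v = 0 := fun v hv => by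
      by_contra h5
      exact absurd (h2 h5).2 (by linarith)
    rw [h4 s h3, h4 (2 * s) (by linarith), sub_self]

lemma contDiff_rho_norm_div {χ : ℝ → ℝ} (hχ : IsCutoff χ) {lam : ℝ} (hl : 0 < lam) (d : ℕ) :
    ContDiff ℝ (⊤ : ℕ∞) fun ξ : Euc d => rho χ (‖ξ‖ / lam) := by
  have hr : ContDiff ℝ (⊤ : ℕ∞) (rho χ) :=
    hχ.1.sub (hχ.1.comp (contDiff_const.mul contDiff_id))
  rw [contDiff_iff_contDiffAt]
  intro ξ
  by_cases h : ξ = 0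
  · have h1 : (fun ξ : Euc d => rho χ (‖ξ‖ / lam)) =ᶠ[nhds ξ] fun _ => 0 := by
      subst h
      filter_upwards [Metric.ball_mem_nhds (0 : Euc d) (half_pos hl)] with y hy
      refine rho_eq_zero_of_notMem hχ (by positivity) fun h2 => ?_
      have h3 := h2.1
      rw [lt_div_iff₀ hl] at h3
      rw [mem_ball_zero_iff] at hy
      linarith
    exact contDiffAt_const.congr_of_eventuallyEq h1
  · exact hr.contDiffAt.comp ξ ((contDiffAt_norm ℝ h).div_const lam)

/-- The frequency localisation of a Schwartz function, on the Fourier side. -/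
def localised {d : ℕ} (χ : ℝ → ℝ) (lam : ℝ) (f : SchwartzMap (Euc d) ℂ) (ξ : Euc d) : ℂ :=
  rho χ (‖ξ‖ / lam) * 𝓕 (f : Euc d → ℂ) ξ

section

variable {d : ℕ} {χ : ℝ → ℝ} (hχ : IsCutoff χ) {lam : ℝ} (hl : 0 < lam)
  (f : SchwartzMap (Euc d) ℂ)

include hχ hl in
lemma contDiff_localised : ContDiff ℝ (⊤ : ℕ∞) (localised χ lam f) := by
  refine (Complex.ofRealCLM.contDiff.comp (contDiff_rho_norm_div hχ hl d)).mul ?_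
  rw [← SchwartzMap.fourier_coe]
  exact (𝓕 f).smooth _

include hχ hl in
lemma localised_eq_zero {ξ : Euc d} (hξ : 2 * lam < ‖ξ‖) : localised χ lam f ξ = 0 := by
  have : rho χ (‖ξ‖ / lam) = 0 := by
    refine rho_eq_zero_of_notMem hχ (by positivity) fun h => ?_
    have := h.2
    rw [div_le_iff₀ hl] at this
    linarith
  simp [localised, this]

include hχ hl in
lemma hasCompactSupport_localised : HasCompactSupport (localised χ lam f) := by
  refine HasCompactSupport.intro (isCompact_closedBall (0 : Euc d) (2 * lam)) fun ξ hξ => ?_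
  exact localised_eq_zero hχ hl f (by simpa using hξ)

lemma proj_eq_fourierInv_localised : proj χ lam (f : Euc d → ℂ) = 𝓕⁻ (localised χ lam f) := rfl

include hχ hl in
lemma fourier_proj : 𝓕 (proj χ lam (f : Euc d → ℂ)) = localised χ lam f := by
  set Φ : SchwartzMap (Euc d) ℂ := HasCompactSupport.toSchwartzMap
    (hasCompactSupport_localised hχ hl f) (contDiff_localised hχ hl f) with hΦ
  have h1 : (Φ : Euc d → ℂ) = localised χ lam f := rfl
  rw [proj_eq_fourierInv_localised, ← h1, ← SchwartzMap.fourierInv_coe, ← SchwartzMap.fourier_coe,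
    FourierTransform.fourier_fourierInv_eq]

/-- The Fourier transform of the evolution at time `t`. -/
def evolved (β : ℝ) (χ : ℝ → ℝ) (lam t : ℝ) (f : SchwartzMap (Euc d) ℂ) (ξ : Euc d) : ℂ :=
  Complex.exp (-Complex.I * (t * mSymb β ‖ξ‖)) * localised χ lam f ξ

include hχ hl in
lemma propg_proj_eq (β t : ℝ) :
    propg β t (proj χ lam (f : Euc d → ℂ)) = 𝓕⁻ (evolved β χ lam t f) := by
  unfold propg mulOp
  rw [fourier_proj hχ hl]
  rfl

include hχ hl in
lemma continuous_evolved (β t : ℝ) : Continuous (evolved β χ lam t f) := by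
  have h1 := (contDiff_localised hχ hl f).continuous
  have h2 : Continuous fun ξ : Euc d => mSymb β ‖ξ‖ := (continuous_mSymb β).comp continuous_norm
  unfold evolved
  fun_prop

include hχ hl in
lemma hasCompactSupport_evolved (β t : ℝ) : HasCompactSupport (evolved β χ lam t f) :=
  (hasCompactSupport_localised hχ hl f).mul_left

lemma norm_evolved (β t : ℝ) (ξ : Euc d) : ‖evolved β χ lam t f ξ‖ = ‖localised χ lam f ξ‖ := by
  have : -Complex.I * (t * mSymb β ‖ξ‖) = ((-(t * mSymb β ‖ξ‖) : ℝ) : ℂ) * Complex.I := by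
    push_cast; ring
  rw [evolved, norm_mul, this, Complex.norm_exp_ofReal_mul_I, one_mul]

include hχ hl in
lemma memLp_localised (p : ℝ≥0∞) : MemLp (localised χ lam f) p :=
  (contDiff_localised hχ hl f).continuous.memLp_of_hasCompactSupport
    (hasCompactSupport_localised hχ hl f)

include hχ hl in
lemma memLp_evolved (β t : ℝ) (p : ℝ≥0∞) : MemLp (evolved β χ lam t f) p :=
  (continuous_evolved hχ hl f β t).memLp_of_hasCompactSupport
    (hasCompactSupport_evolved hχ hl f β t)

include hχ hl in
lemma eLpNorm_proj_two :
    eLpNorm (proj χ lam (f : Euc d → ℂ)) 2 = eLpNorm (localised χ lam f) 2 :=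
  (fourierInv_memLp_two (memLp_one_iff_integrable.1 (memLp_localised hχ hl f 1))
    (memLp_localised hχ hl f 2)).2

include hχ hl in
lemma integrable_evolved (β t : ℝ) : Integrable (evolved β χ lam t f) :=
  memLp_one_iff_integrable.1 (memLp_evolved hχ hl f β t 1)

include hχ hl in
lemma continuous_propg_proj (β t : ℝ) : Continuous (propg β t (proj χ lam (f : Euc d → ℂ))) := by
  rw [propg_proj_eq hχ hl]
  exact continuous_fourierInv (integrable_evolved hχ hl f β t)

include hχ hl in
lemma memLp_propg_proj_two (β t : ℝ) : MemLp (propg β t (proj χ lam (f : Euc d → ℂ))) 2 := by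
  rw [propg_proj_eq hχ hl]
  exact (fourierInv_memLp_two (integrable_evolved hχ hl f β t) (memLp_evolved hχ hl f β t 2)).1

include hχ hl in
/-- Conservation of the `L²` norm. -/
lemma eLpNorm_propg_proj_two (β t : ℝ) : eLpNorm (propg β t (proj χ lam (f : Euc d → ℂ))) 2 =
    eLpNorm (proj χ lam (f : Euc d → ℂ)) 2 := by
  rw [propg_proj_eq hχ hl, eLpNorm_proj_two hχ hl, (fourierInv_memLp_two
    (integrable_evolved hχ hl f β t) (memLp_evolved hχ hl f β t 2)).2]
  exact eLpNorm_congr_norm_ae (.of_forall fun ξ => norm_evolved f β t ξ)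

include hχ hl in
lemma memLp_propg_proj_top (β t : ℝ) : MemLp (propg β t (proj χ lam (f : Euc d → ℂ))) ∞ := by
  refine memLp_top_of_bound (continuous_propg_proj hχ hl f β t).aestronglyMeasurable
    (∫ ξ, ‖evolved β χ lam t f ξ‖) (.of_forall fun x => ?_)
  rw [propg_proj_eq hχ hl]
  exact norm_fourierInv_le _ _

end

/-- A smooth cutoff adapted to the support of the Littlewood-Paley multiplier. -/
lemma exists_fattened_cutoff : ∃ η : ℝ → ℝ, ContDiff ℝ (⊤ : ℕ∞) η ∧
    (∀ v, v ∉ Set.Icc (3 / 8 : ℝ) 3 → η v = 0) ∧ (∀ v ∈ Set.Icc (1 / 2 : ℝ) 2, η v = 1) ∧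
    ∀ v, |η v| ≤ 1 := by
  let b : ContDiffBump (5 / 4 : ℝ) := ⟨3 / 4, 7 / 8, by norm_num, by norm_num⟩
  refine ⟨b, b.contDiff, fun v hv => b.zero_of_le_dist ?_, fun v hv =>
    b.one_of_mem_closedBall ?_, fun v => ?_⟩
  · change (7 / 8 : ℝ) ≤ dist v (5 / 4)
    by_contra h
    rw [not_le, Real.dist_eq, abs_lt] at h
    exact hv ⟨by linarith, by linarith⟩
  · change dist v (5 / 4) ≤ (3 / 4 : ℝ)
    rw [Real.dist_eq, abs_le]
    exact ⟨by linarith [hv.1], by linarith [hv.2]⟩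
  · rw [abs_of_nonneg b.nonneg]
    exact b.le_one

lemma MeasureTheory.MemLp.of_two_of_top {α : Type*} [MeasurableSpace α] {μ : Measure α} {u : α → ℂ}
    (h2 : MemLp u 2 μ) (ht : MemLp u ∞ μ) {r : ℝ≥0∞} (hr : 2 ≤ r) : MemLp u r μ := by
  rcases eq_or_ne r ∞ with rfl | hrt
  · exact ht
  have hr0 : r ≠ 0 := (two_pos.trans_le hr).ne'
  have hr2 : 2 ≤ r.toReal := by
    have := ENNReal.toReal_mono hrt hr
    simpa using this
  have hM : ∀ᵐ x ∂μ, ‖u x‖ ≤ (eLpNorm u ∞ μ).toReal := by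
    have h := ae_le_eLpNormEssSup (f := u) (μ := μ)
    filter_upwards [h] with x hx
    rw [← eLpNorm_exponent_top] at hx
    have := ENNReal.toReal_mono ht.2.ne hx
    simpa using this
  rw [← integrable_norm_rpow_iff h2.1 hr0 hrt]
  have hi := (integrable_norm_rpow_iff h2.1 (by norm_num) (by norm_num)).2 h2
  simp only [ENNReal.toReal_ofNat] at hi
  refine (hi.const_mul ((eLpNorm u ∞ μ).toReal ^ (r.toReal - 2))).mono'
    ((h2.1.norm.aemeasurable.pow_const _).aestronglyMeasurable) ?_
  filter_upwards [hM] with x hx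
  rw [Real.norm_of_nonneg (by positivity)]
  rcases (norm_nonneg (u x)).eq_or_lt with h | h
  · rw [← h, Real.zero_rpow (by linarith), Real.zero_rpow (by norm_num), mul_zero]
  · calc ‖u x‖ ^ r.toReal = ‖u x‖ ^ (r.toReal - 2) * ‖u x‖ ^ (2 : ℝ) := by
          rw [← Real.rpow_add h]; congr 1; ring
      _ ≤ _ := by gcongr

/-- The test vectors of the `TT*` argument, on the Fourier side. -/
def waveFun (β : ℝ) {d : ℕ} (η : ℝ → ℝ) (lam t : ℝ) (g : Euc d → ℂ) (ξ : Euc d) : ℂ :=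
  conj (𝓕⁻ g ξ * freqProp β η lam t ‖ξ‖)

section

variable {β : ℝ} {d : ℕ} {η : ℝ → ℝ} (hη : ContDiff ℝ (⊤ : ℕ∞) η)
  (hs : ∀ v, v ∉ Set.Icc (3 / 8 : ℝ) 3 → η v = 0) {lam : ℝ} (hl : 0 < lam)
  {g k : Euc d → ℂ} (hg : Integrable g) (hk : Integrable k)

include hη hs hl hg in
lemma memLp_waveFun (t : ℝ) : MemLp (waveFun β η lam t g) 2 := by
  have h1 : Continuous fun ξ : Euc d => 𝓕⁻ g ξ * freqProp β η lam t ‖ξ‖ :=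
    (continuous_fourierInv hg).mul ((continuous_freqProp hη lam t).comp continuous_norm)
  refine Continuous.memLp_of_hasCompactSupport (Complex.continuous_conj.comp h1) ?_
  exact (hasCompactSupport_of_mul_freqProp (β := β) hs hl t (𝓕⁻ g)).comp_left (map_zero conj)

/-- The test vectors of the `TT*` argument, as elements of `L²`. -/
def waveVec (β : ℝ) (t : ℝ) : Lp ℂ 2 (volume : Measure (Euc d)) :=
  (memLp_waveFun (β := β) hη hs hl hg t).toLp _

lemma coeFn_waveVec (t : ℝ) :
    waveVec hη hs hl hg β t =ᵐ[volume] waveFun β η lam t g := MemLp.coeFn_toLp _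

lemma norm_freqProp_sub_le (s t v : ℝ) : ‖freqProp β η lam s v - freqProp β η lam t v‖ ≤
    |s - t| * mSymb β v * ‖freqProp β η lam 0 v‖ := by
  have e : freqProp β η lam s v - freqProp β η lam t v = freqProp β η lam t v *
      (Complex.exp (Complex.I * ((t - s) * mSymb β v : ℝ)) - 1) := by
    have : Complex.exp (-(s * mSymb β v * I)) = Complex.exp (-(t * mSymb β v * I)) *
        Complex.exp (Complex.I * ((t - s) * mSymb β v : ℝ)) := by
      rw [← Complex.exp_add]; congr 1; push_cast; ring
    simp only [freqProp, this]; ring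
  have e2 : ‖freqProp β η lam t v‖ = ‖freqProp β η lam 0 v‖ := by
    have : -(t * mSymb β v * I) = ((-(t * mSymb β v) : ℝ) : ℂ) * I := by push_cast; ring
    simp only [freqProp, norm_mul, this, Complex.norm_exp_ofReal_mul_I]
    simp
  rw [e, norm_mul, e2, mul_comm]
  gcongr
  refine Real.norm_exp_I_mul_ofReal_sub_one_le.trans_eq ?_
  rw [Real.norm_eq_abs, abs_mul, abs_sub_comm,
    abs_of_nonneg (show 0 ≤ mSymb β v from Real.sqrt_nonneg _)]

lemma continuous_waveVec : Continuous (waveVec hη hs hl hg β) := by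
  obtain ⟨K, hK⟩ := (isCompact_Icc (a := (0 : ℝ)) (b := 3 * lam)).exists_bound_of_continuousOn
    (continuous_mSymb β).continuousOn
  have hK0 : 0 ≤ K := (norm_nonneg _).trans (hK 0 ⟨le_rfl, by positivity⟩)
  have hlip : ∀ s t, dist (waveVec hη hs hl hg β s) (waveVec hη hs hl hg β t) ≤
      K * ‖waveVec hη hs hl hg β 0‖ * dist s t := fun s t => by
    have : ‖waveVec hη hs hl hg β s - waveVec hη hs hl hg β t‖ ≤
        (|s - t| * K) * ‖waveVec hη hs hl hg β 0‖ := by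
      refine Lp.norm_le_mul_norm_of_ae_le_mul ?_
      filter_upwards [coeFn_waveVec (β := β) hη hs hl hg s, coeFn_waveVec (β := β) hη hs hl hg t,
        coeFn_waveVec (β := β) hη hs hl hg 0, Lp.coeFn_sub (waveVec hη hs hl hg β s)
          (waveVec hη hs hl hg β t)] with ξ h1 h2 h3 h4
      rw [h4, Pi.sub_apply, h1, h2, h3]
      simp only [waveFun, ← map_sub, RCLike.norm_conj, ← mul_sub, norm_mul]
      by_cases h : 3 * lam < ‖ξ‖
      · simp [freqProp_eq_zero_of_gt hs hl _ h]
      · calc _ ≤ ‖𝓕⁻ g ξ‖ * (|s - t| * mSymb β ‖ξ‖ * ‖freqProp β η lam 0 ‖ξ‖‖) := by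
              gcongr; exact norm_freqProp_sub_le _ _ _
          _ ≤ ‖𝓕⁻ g ξ‖ * (|s - t| * K * ‖freqProp β η lam 0 ‖ξ‖‖) := by
              gcongr
              exact (le_abs_self _).trans (hK _ ⟨norm_nonneg _, not_lt.1 h⟩)
          _ = _ := by ring
    rw [dist_eq_norm, Real.dist_eq]
    exact this.trans_eq (by ring)
  exact (LipschitzWith.of_dist_le_mul (K := ⟨K * ‖waveVec hη hs hl hg β 0‖, by positivity⟩)
    hlip).continuous

/-- The Gram matrix of the test vectors. -/
lemma inner_waveVec_waveVec (s t : ℝ) :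
    inner ℂ (waveVec hη hs hl hg β s) (waveVec hη hs hl hk β t) =
      freqForm β (fun v => η v ^ 2) lam (s - t) g k := by
  rw [L2.inner_def, freqForm]
  refine integral_congr_ae ?_
  filter_upwards [coeFn_waveVec (β := β) hη hs hl hg s, coeFn_waveVec (β := β) hη hs hl hk t]
    with ξ h1 h2
  rw [h1, h2]
  simp only [waveFun, RCLike.inner_apply, map_mul, Complex.conj_conj, freqProp, ← Complex.exp_conj,
    map_neg, conj_ofReal, conj_I, mul_neg, neg_neg]
  have : Complex.exp (-((s - t : ℝ) * mSymb β ‖ξ‖ * I)) = Complex.exp (-(s * mSymb β ‖ξ‖ * I)) *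
      Complex.exp (t * mSymb β ‖ξ‖ * I) := by
    rw [← Complex.exp_add]; congr 1; push_cast; ring
  rw [this]
  push_cast
  ring

variable {χ : ℝ → ℝ} (hχ : IsCutoff χ) (f : SchwartzMap (Euc d) ℂ)

/-- The localised datum on the Fourier side, as an element of `L²`. -/
def datumVec : Lp ℂ 2 (volume : Measure (Euc d)) := (memLp_localised hχ hl f 2).toLp _

lemma enorm_datumVec :
    ENNReal.ofReal ‖datumVec hl hχ f‖ = eLpNorm (proj χ lam (f : Euc d → ℂ)) 2 := by
  rw [datumVec, Lp.norm_toLp, ENNReal.ofReal_toReal (memLp_localised hχ hl f 2).2.ne,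
    eLpNorm_proj_two hχ hl]

lemma inner_waveVec_datumVec (h1 : ∀ v ∈ Set.Icc (1 / 2 : ℝ) 2, η v = 1) (t : ℝ) :
    inner ℂ (waveVec hη hs hl hg β t) (datumVec hl hχ f) =
      ∫ x, propg β t (proj χ lam (f : Euc d → ℂ)) x * g x := by
  rw [propg_proj_eq hχ hl, integral_fourierInv_mul_eq (integrable_evolved hχ hl f β t) hg,
    L2.inner_def]
  refine integral_congr_ae ?_
  filter_upwards [coeFn_waveVec (β := β) hη hs hl hg t, (memLp_localised hχ hl f 2).coeFn_toLp]
    with ξ h2 h3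
  rw [h2, datumVec, h3]
  simp only [waveFun, RCLike.inner_apply, Complex.conj_conj, freqProp, evolved, localised]
  by_cases h : ‖ξ‖ / lam ∈ Set.Ioc (1 / 2 : ℝ) 2
  · rw [h1 _ (Set.Ioc_subset_Icc_self h)]
    have : -I * (t * mSymb β ‖ξ‖) = -(t * mSymb β ‖ξ‖ * I) := by ring
    rw [this]
    push_cast
    ring
  · rw [rho_eq_zero_of_notMem hχ (by positivity) h]
    simp

end

lemma ENNReal.holderConjugate_one_sub_inv {r : ℝ≥0∞} (hr : 1 ≤ r) :
    (1 - r⁻¹)⁻¹.HolderConjugate r := by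
  refine ⟨?_⟩
  rw [inv_inv, inv_one]
  exact tsub_add_cancel_of_le (ENNReal.inv_le_one.2 hr)

lemma admissible_toReal {d : ℕ} {q r : ℝ≥0∞} (hq : 2 < q) (hr : 2 ≤ r)
    (hadm : 2 / q + (d : ℝ≥0∞) / r = (d : ℝ≥0∞) / 2) :
    2 / q.toReal + d / r.toReal = (d : ℝ) / 2 := by
  have hq0 : q ≠ 0 := (two_pos.trans hq).ne'
  have hr0 : r ≠ 0 := (two_pos.trans_le hr).ne'
  have h := congrArg ENNReal.toReal hadm
  rw [ENNReal.toReal_add (ENNReal.div_ne_top (by norm_num) hq0)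
    (ENNReal.div_ne_top (by simp) hr0)] at h
  simpa using h

lemma integral_norm_rpow_le_one {d : ℕ} {p : ℝ≥0∞} (hp0 : p ≠ 0) (hp : p ≠ ∞)
    {g : SimpleFunc (Euc d) ℂ} (hg : Integrable g) (h1 : eLpNorm g p volume ≤ 1) :
    (∫ x, ‖g x‖ ^ p.toReal) ^ (1 / p.toReal) ≤ 1 := by
  rw [(SimpleFunc.memLp_of_integrable hg p).eLpNorm_eq_integral_rpow_norm hp0 hp,
    ENNReal.ofReal_le_one] at h1
  rwa [one_div]

/-- The localised Strichartz estimate away from the endpoint `q = ∞`, with the space exponent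
expressed through its dual. -/
lemma mixedNorm_propg_proj_le {β : ℝ} {d : ℕ} {η : ℝ → ℝ} (hη : ContDiff ℝ (⊤ : ℕ∞) η)
    (hs : ∀ v, v ∉ Set.Icc (3 / 8 : ℝ) 3 → η v = 0) (h1 : ∀ v ∈ Set.Icc (1 / 2 : ℝ) 2, η v = 1)
    (h2 : ∀ v, |η v| ≤ 1) {χ : ℝ → ℝ} (hχ : IsCutoff χ) {lam : ℝ} (hl : 0 < lam)
    {A B γ θ σ : ℝ} (hA : 0 < A) (hσ : |σ| = 1) {p q r : ℝ≥0∞} [p.HolderConjugate r] (hr : 2 < r)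
    (hγ0 : 0 < γ) (hγ1 : γ < 1) (hq : q.toReal = 2 / γ) (hqt : q ≠ ∞) (hp : p ≠ ∞)
    (hθ0 : 0 ≤ θ) (hθ1 : θ ≤ 1) (hpθ : p.toReal * (1 - θ / 2) = 1)
    (hγ : (d : ℝ) / 2 * (1 - θ) = γ)
    (hB : ∀ t (x : Euc d), ‖kernel β d (fun v => η v ^ 2) lam t x‖ ≤ B)
    (hK : ∀ t, t ≠ 0 → ∀ x : Euc d,
      ‖kernel β d (fun v => η v ^ 2) lam t x‖ ≤ A * |t| ^ (-((d : ℝ) / 2)))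
    (f : SchwartzMap (Euc d) ℂ) :
    mixedNorm q r (fun t => propg β (σ * t) (proj χ lam ⇑f)) ≤
      ENNReal.ofReal (16 * (A ^ (1 - θ) * (2 * (2 / (1 - γ) + 2 ^ (γ / 2)))) ^ (1 / 2 : ℝ)) *
        eLpNorm (proj χ lam ⇑f) 2 volume := by
  obtain ⟨g, hgi, hg1, hg⟩ := exists_norming_simpleFunc_seq (α := Euc d) (μ := volume)
    (p := p) (r := r) hr
  have hp0 : 0 < p.toReal := by
    rcases ENNReal.toReal_nonneg.eq_or_lt with h | h
    · rw [← h] at hpθ; simp at hpθ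
    · exact h
  have hpne : p ≠ 0 := by rintro rfl; simp at hp0
  have hΨ : ContDiff ℝ (⊤ : ℕ∞) fun v => η v ^ 2 := hη.pow 2
  have hsΨ : ∀ v, v ∉ Set.Icc (3 / 8 : ℝ) 3 → η v ^ 2 = 0 := fun v hv => by simp [hs v hv]
  have h2Ψ : ∀ v, |η v ^ 2| ≤ 1 := fun v => by
    rw [abs_pow]; exact pow_le_one₀ (abs_nonneg _) (h2 v)
  have hB0 : 0 ≤ B := (norm_nonneg _).trans (hB 0 0)
  have key : ∀ i j t M, (∀ x : Euc d, ‖kernel β d (fun v => η v ^ 2) lam t x‖ ≤ M) →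
      ‖freqForm β (fun v => η v ^ 2) lam t (g i) (g j)‖ ≤ M ^ (1 - θ) := fun i j t M hM => by
    have hM0 : 0 ≤ M := (norm_nonneg _).trans (hM 0)
    refine (norm_freqForm_le_interpolated hΨ hsΨ hl t h2Ψ hM hp0 hθ0 hθ1 hpθ (hgi i)
      (hgi j)).trans ?_
    have a1 := integral_norm_rpow_le_one hpne hp (hgi i) (hg1 i)
    have a2 := integral_norm_rpow_le_one hpne hp (hgi j) (hg1 j)
    calc _ ≤ M ^ (1 - θ) * 1 * 1 := by gcongr
      _ = _ := by ring
  set v : ℕ → ℝ → Lp ℂ 2 (volume : Measure (Euc d)) := fun j t =>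
    waveVec hη hs hl (hgi j) β (σ * t) with hv
  have hvc : ∀ j, Continuous (v j) := fun j =>
    (continuous_waveVec hη hs hl (hgi j)).comp (continuous_const.mul continuous_id)
  have hvb : ∀ j t, ‖v j t‖ ≤ √(B ^ (1 - θ)) := fun j t => by
    refine Real.le_sqrt_of_sq_le ?_
    have h3 := key j j 0 B (hB 0)
    have h4 := inner_waveVec_waveVec (β := β) hη hs hl (hgi j) (hgi j) (σ * t) (σ * t)
    rw [sub_self] at h4
    rw [← h4, inner_self_eq_norm_sq_to_K] at h3
    simpa using h3
  have hdec : ∀ i j s t, s ≠ t →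
      ‖inner ℂ (v i s) (v j t)‖ ≤ A ^ (1 - θ) * |s - t| ^ (-γ) := fun i j s t hst => by
    have hst0 : σ * s - σ * t ≠ 0 := by
      rw [← mul_sub]
      refine mul_ne_zero (fun h => ?_) (sub_ne_zero.2 hst)
      simp [h] at hσ
    have ha : |σ * s - σ * t| = |s - t| := by rw [← mul_sub, abs_mul, hσ, one_mul]
    rw [hv, inner_waveVec_waveVec]
    refine (key i j _ _ (hK _ hst0)).trans_eq ?_
    rw [ha, Real.mul_rpow hA.le (by positivity), ← Real.rpow_mul (abs_nonneg _), ← hγ]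
    congr 2
    ring
  have : Fact ((2 : ℝ≥0∞) ≠ ∞) := ⟨by norm_num⟩
  have main := lintegral_iSup_inner_rpow_le_of_gram_decay hγ0 hγ1 hvc hvb
    (by positivity : 0 < A ^ (1 - θ)) hdec (datumVec hl hχ f)
  have hpt : ∀ t, eLpNorm (propg β (σ * t) (proj χ lam ⇑f)) r volume ≤
      8 * ⨆ j, ‖inner ℂ (v j t) (datumVec hl hχ f)‖ₑ := fun t => by
    refine (hg _ (continuous_propg_proj hχ hl f β (σ * t)).measurable
      (memLp_propg_proj_two hχ hl f β (σ * t))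
        ((memLp_propg_proj_two hχ hl f β (σ * t)).of_two_of_top
        (memLp_propg_proj_top hχ hl f β (σ * t)) hr.le)).trans_eq ?_
    congr 1
    exact iSup_congr fun j => by rw [hv, inner_waveVec_datumVec hη hs hl (hgi j) hχ f h1]
  have hκ : 0 < 2 * (2 / (1 - γ) + 2 ^ (γ / 2)) := by
    have : 0 < 1 - γ := by linarith
    positivity
  set κ := 2 * (2 / (1 - γ) + 2 ^ (γ / 2)) with hκdef
  set N := ‖datumVec hl hχ f‖ with hN
  have hN0 : 0 ≤ N := norm_nonneg _
  have hDκ : 0 < A ^ (1 - θ) * κ := by positivity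
  rw [mixedNorm, timeLp, if_neg hqt, hq, ← enorm_datumVec hl hχ f, ← hN,
    ← ENNReal.ofReal_mul (by positivity), one_div, ENNReal.rpow_inv_le_iff (by positivity)]
  calc ∫⁻ t, eLpNorm (propg β (σ * t) (proj χ lam ⇑f)) r volume ^ (2 / γ)
      ≤ ∫⁻ t, 8 ^ (2 / γ) * (⨆ j, ‖inner ℂ (v j t) (datumVec hl hχ f)‖ₑ) ^ (2 / γ) := by
        refine lintegral_mono fun t => ?_
        rw [← ENNReal.mul_rpow_of_nonneg _ _ (by positivity)]
        gcongr
        exact hpt t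
    _ = 8 ^ (2 / γ) * ∫⁻ t, (⨆ j, ‖inner ℂ (v j t) (datumVec hl hχ f)‖ₑ) ^ (2 / γ) :=
        lintegral_const_mul' _ _ (ENNReal.rpow_ne_top_of_nonneg (by positivity) (by norm_num))
    _ ≤ 8 ^ (2 / γ) * ENNReal.ofReal
          (2 ^ (2 / γ) * ((A ^ (1 - θ) * κ) ^ (1 / γ) * N ^ (2 / γ))) := by gcongr
    _ = ENNReal.ofReal (16 * (A ^ (1 - θ) * κ) ^ (1 / 2 : ℝ) * N) ^ (2 / γ) := by
        rw [ENNReal.ofReal_rpow_of_nonneg (by positivity) (by positivity),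
          show (8 : ℝ≥0∞) = ENNReal.ofReal 8 by norm_num,
          ENNReal.ofReal_rpow_of_nonneg (by positivity) (by positivity),
          ← ENNReal.ofReal_mul (by positivity)]
        congr 1
        generalize A ^ (1 - θ) * κ = E at hDκ ⊢
        rw [Real.mul_rpow (by positivity) hN0, Real.mul_rpow (by norm_num) (by positivity),
          ← Real.rpow_mul hDκ.le, show (16 : ℝ) = 8 * 2 by norm_num,
          Real.mul_rpow (by norm_num) (by norm_num),
          show (1 / 2 : ℝ) * (2 / γ) = 1 / γ by field_simp]
        ring

/-- Theorem 2, homogeneous localised Strichartz estimate: for `β ∈ {0,1}`, `d ≥ 1`,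
`λ = 2^n ∈ 2^ℤ` and an admissible pair `2 < q ≤ ∞`, `2 ≤ r ≤ ∞`, `2/q + d/r = d/2`,
`‖S_{m_β}(±t) P_λ f‖_{L^q_t L^r_x} ≲ [c_{β,d}(λ)]^{2/(qd)} ‖P_λ f‖_{L^2}`,
with implicit constant independent of `λ` and `f`. -/
theorem strichartz_homogeneous
    (β : ℝ) (hβ : β = 0 ∨ β = 1) (d : ℕ) (hd : 1 ≤ d)
    (q r : ℝ≥0∞) (hq : 2 < q) (hr : 2 ≤ r)
    (hadm : 2 / q + (d : ℝ≥0∞) / r = (d : ℝ≥0∞) / 2)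
    (χ : ℝ → ℝ) (hχ : IsCutoff χ) :
    ∃ C > 0, ∀ (n : ℤ) (σ : ℝ), σ = 1 ∨ σ = -1 →
      ∀ f : SchwartzMap (Euc d) ℂ,
        mixedNorm q r (fun t => propg β (σ * t) (proj χ ((2 : ℝ) ^ n) ⇑f)) ≤
          ENNReal.ofReal (C * cFactor β d ((2 : ℝ) ^ n) ^ (2 / (q.toReal * d))) *
            eLpNorm (proj χ ((2 : ℝ) ^ n) ⇑f) 2 volume := by
  have hd0 : (0 : ℝ) < d := by exact_mod_cast hd
  have hreal := admissible_toReal hq hr hadm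
  rcases eq_or_ne q ∞ with rfl | hqt
  · have hr2 : r = 2 := by
      have h : r.toReal = 2 := by
        rw [ENNReal.toReal_top, div_zero, zero_add] at hreal
        have h0 : r.toReal ≠ 0 := fun h => by
          rw [h, div_zero] at hreal
          linarith
        field_simp at hreal
        linarith
      rw [← ENNReal.ofReal_toReal (a := r) (fun h' => by simp [h'] at h), h]
      norm_num
    subst hr2
    refine ⟨1, one_pos, fun n σ _ f => ?_⟩
    have hl : (0 : ℝ) < 2 ^ n := by positivity
    simp only [mixedNorm, timeLp, if_true, ENNReal.toReal_top, zero_mul, div_zero, Real.rpow_zero,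
      mul_one, ENNReal.ofReal_one, one_mul, eLpNorm_propg_proj_two hχ hl f β]
    exact essSup_le_of_ae_le _ (.of_forall fun _ => le_rfl)
  have hQ : 2 < q.toReal := by
    have := (ENNReal.toReal_lt_toReal (by norm_num) hqt).2 hq
    simpa using this
  have hQ0 : 0 < q.toReal := by linarith
  have hr2 : 2 < r := by
    refine lt_of_le_of_ne hr fun h => ?_
    rw [← h, ENNReal.toReal_ofNat] at hreal
    have : 0 < 2 / q.toReal := by positivity
    linarith
  obtain ⟨η, hη, hs, h1, h2⟩ := exists_fattened_cutoff
  have hΨ : ContDiff ℝ (⊤ : ℕ∞) fun v => η v ^ 2 := hη.pow 2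
  have hsΨ : ∀ v, v ∉ Set.Icc (3 / 8 : ℝ) 3 → η v ^ 2 = 0 := fun v hv => by simp [hs v hv]
  obtain ⟨C₁, -, hC₁⟩ := norm_kernel_le_pow hΨ hsΨ
    (show 0 ≤ β by rcases hβ with rfl | rfl <;> norm_num) hd
  obtain ⟨C₀, hC₀, hK⟩ := norm_kernel_le_dispersive hΨ hsΨ hβ hd
  have hr1 : 1 ≤ r := le_trans (by norm_num) hr
  have hr0 : r ≠ 0 := (two_pos.trans_le hr).ne'
  have := ENNReal.holderConjugate_one_sub_inv hr1
  set γ := 2 / q.toReal with hγdef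
  set θ := 2 / r.toReal with hθdef
  have hγ0 : 0 < γ := by positivity
  have hγ1 : γ < 1 := by rw [hγdef, div_lt_one hQ0]; exact hQ
  have hγ : (d : ℝ) / 2 * (1 - θ) = γ := by
    have : (d : ℝ) / r.toReal = d / 2 * θ := by rw [hθdef]; ring
    linarith
  have hθ0 : 0 ≤ θ := by positivity
  have hθ1 : θ ≤ 1 := by
    by_contra h
    have : (d : ℝ) / 2 * (1 - θ) < 0 := mul_neg_of_pos_of_neg (by positivity) (by linarith)
    linarith
  have hinv : (1 - r⁻¹ : ℝ≥0∞).toReal = 1 - θ / 2 := by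
    rw [ENNReal.toReal_sub_of_le (ENNReal.inv_le_one.2 hr1) (by norm_num), ENNReal.toReal_one,
      ENNReal.toReal_inv, hθdef]
    ring
  have hpθ : (1 - r⁻¹ : ℝ≥0∞)⁻¹.toReal * (1 - θ / 2) = 1 := by
    rw [ENNReal.toReal_inv, hinv]
    exact inv_mul_cancel₀ (by linarith)
  have hpt : (1 - r⁻¹ : ℝ≥0∞)⁻¹ ≠ ∞ := by
    intro h
    rw [h] at hpθ
    simp at hpθ
  have h1γ : 0 < 1 - γ := by linarith
  refine ⟨16 * (C₀ ^ (1 - θ) * (2 * (2 / (1 - γ) + 2 ^ (γ / 2)))) ^ (1 / 2 : ℝ), by positivity,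
    fun n σ hσ f => ?_⟩
  have hl : (0 : ℝ) < 2 ^ n := by positivity
  have hc := cFactor_pos β d hl
  refine (mixedNorm_propg_proj_le (p := (1 - r⁻¹)⁻¹) (A := C₀ * cFactor β d (2 ^ n)) hη hs h1 h2 hχ
    hl
    (by positivity) (by rcases hσ with rfl | rfl <;> simp) hr2 hγ0 hγ1 (by rw [hγdef]; field_simp)
    hqt hpt hθ0 hθ1 hpθ hγ (hC₁ _ hl) (fun t ht x => (hK _ hl t ht x).trans_eq (by ring))
    f).trans_eq ?_
  congr 2
  have e : 2 / (q.toReal * d) = (1 - θ) * (1 / 2) := by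
    have : 2 / (q.toReal * d) = γ / d := by rw [hγdef]; field_simp
    rw [this, ← hγ]
    field_simp
  rw [e, Real.mul_rpow hC₀.le hc.le, Real.rpow_mul hc.le, mul_right_comm (C₀ ^ (1 - θ)),
    Real.mul_rpow (by positivity) (by positivity)]
  ring
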